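/- arXiv:2206.07254 — 8 statements merged into one kernel-verified Lean document; each statement's English description precedes it below -/
import Mathlib

section
/- Assume Heath-Brown's conjecture: there exists a constant C > 0 such that for all natural numbers c and d with d ≥ 2 and gcd(c,d) = 1, there exists a prime p with p ≡ c (mod d) and p ≤ C·d·(log d)². Then the set of Carmichael numbers n for which the number of distinct prime factors of n is a prime number is infinite. -/
/-- A Carmichael number: a composite `n > 1` dividing `a^n - a` for every integer `a`. -/
def IsCarmichael (n : ℕ) : Prop :=
  1 < n ∧ ¬ n.Prime ∧ ∀ a : ℤ, (n : ℤ) ∣ a ^ n - a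


theorem cw_step {ι σ : Type*} [Fintype ι] [DecidableEq σ] (l : ℕ) (hl : l.Prime) (v : σ → ι → ℤ)
    (S : Finset σ) (hS : Fintype.card ι * (l - 1) < S.card) :
    ∃ J ⊆ S, J.Nonempty ∧ ∀ i, (l : ℤ) ∣ ∑ j ∈ J, v j i := by
  classical
  have := Fact.mk hl
  let f : ι → MvPolynomial S (ZMod l) := fun i =>
    ∑ j : S, MvPolynomial.C ((v j i : ℤ) : ZMod l) * MvPolynomial.X j ^ (l - 1)
  have hdeg : ∑ i, (f i).totalDegree < Fintype.card S := by
    have h1 : ∀ i, (f i).totalDegree ≤ l - 1 := by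
      intro i
      apply MvPolynomial.totalDegree_finsetSum_le
      intro j _
      refine (MvPolynomial.totalDegree_mul _ _).trans ?_
      rw [MvPolynomial.totalDegree_C, MvPolynomial.totalDegree_X_pow, zero_add]
    calc ∑ i, (f i).totalDegree ≤ ∑ i : ι, (l - 1) := Finset.sum_le_sum fun i _ => h1 i
      _ = Fintype.card ι * (l - 1) := by simp
      _ < _ := by simpa using hS
  have h := char_dvd_card_solutions_of_fintype_sum_lt l hdeg
  have h0 : ∀ i, MvPolynomial.eval (0 : S → ZMod l) (f i) = 0 := by
    intro i
    have : l - 1 ≠ 0 := by have := hl.two_le; omega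
    simp [f, this]
  have h1 : 1 < Fintype.card {x : S → ZMod l // ∀ i, MvPolynomial.eval x (f i) = 0} := by
    have hpos : 0 < Fintype.card {x : S → ZMod l // ∀ i, MvPolynomial.eval x (f i) = 0} :=
      Fintype.card_pos_iff.mpr ⟨⟨0, h0⟩⟩
    have := Nat.le_of_dvd hpos h
    have := hl.two_le
    omega
  obtain ⟨⟨x, hx⟩, hne⟩ := Fintype.exists_ne_of_one_lt_card h1 ⟨0, h0⟩
  have hx0 : x ≠ 0 := fun h => hne (by simp [h])
  obtain ⟨j0, hj0⟩ := Function.ne_iff.mp hx0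
  refine ⟨(Finset.univ.filter fun j : S => x j ≠ 0).map (Function.Embedding.subtype _), ?_, ?_, ?_⟩
  · intro j hj
    simp only [Finset.mem_map] at hj
    obtain ⟨y, _, rfl⟩ := hj
    exact y.2
  · exact ⟨j0, Finset.mem_map.mpr ⟨j0, by simpa using hj0, rfl⟩⟩
  · intro i
    rw [← ZMod.intCast_zmod_eq_zero_iff_dvd, Finset.sum_map]
    have := hx i
    simp only [f, map_sum, map_mul, MvPolynomial.eval_C, map_pow, MvPolynomial.eval_X] at this
    rw [Int.cast_sum, Finset.sum_filter]
    refine Eq.trans ?_ this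
    apply Finset.sum_congr rfl
    intro j _
    have hl1 : l - 1 ≠ 0 := by have := hl.two_le; omega
    by_cases hxj : x j = 0
    · simp [hxj, hl1]
    · simp [hxj, ZMod.pow_card_sub_one_eq_one hxj]

theorem extract {σ : Type*} [DecidableEq σ] (good : Finset σ → Prop) (B : ℕ) (S : Finset σ)
    (h : ∀ T ⊆ S, B ≤ T.card → ∃ J ⊆ T, J.Nonempty ∧ J.card ≤ B ∧ good J) (n : ℕ)
    (hn : n * B ≤ S.card) :
    ∃ F : Finset (Finset σ), F.card = n ∧ (∀ J ∈ F, J ⊆ S ∧ J.Nonempty ∧ J.card ≤ B ∧ good J) ∧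
      (F : Set (Finset σ)).PairwiseDisjoint id := by
  induction n with
  | zero => exact ⟨∅, by simp⟩
  | succ n ih =>
    have hn' : n * B + B ≤ S.card := by rw [← Nat.succ_mul]; exact hn
    obtain ⟨F, hF, hJ, hd⟩ := ih (by omega)
    have hU : (F.biUnion id).card ≤ n * B := by
      rw [← hF]; exact Finset.card_biUnion_le_card_mul _ _ _ fun J hj => (hJ J hj).2.2.1
    obtain ⟨J, hJS, hne, hc, hg⟩ := h (S \ F.biUnion id) Finset.sdiff_subset (by
      have := Finset.le_card_sdiff (F.biUnion id) S
      omega)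
    have hdis : ∀ I ∈ F, Disjoint J I := by
      intro I hI
      rw [Finset.disjoint_left]
      intro x hx hxI
      have := hJS hx
      rw [Finset.mem_sdiff] at this
      exact this.2 (Finset.mem_biUnion.mpr ⟨I, hI, hxI⟩)
    have hnot : J ∉ F := fun hm => by
      have := hdis J hm
      rw [disjoint_self] at this
      exact hne.ne_empty this
    refine ⟨insert J F, by rw [Finset.card_insert_of_notMem hnot, hF], ?_, ?_⟩
    · intro I hI
      rcases Finset.mem_insert.mp hI with rfl | hI
      · exact ⟨hJS.trans Finset.sdiff_subset, hne, hc, hg⟩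
      · exact hJ I hI
    · rw [Finset.coe_insert]
      exact hd.insert fun I hI _ => hdis I hI

theorem dav_vec {ι : Type*} [Fintype ι] (R : ℕ) (hR : Fintype.card ι ≤ R) (hR1 : 1 ≤ R) (t : ℕ) :
    ∀ (e : ℕ), 0 < e → e ≤ 2 ^ t → ∀ {σ : Type} [DecidableEq σ] (v : σ → ι → ℤ) (S : Finset σ),
    R ^ t * e ≤ S.card →
    ∃ J ⊆ S, J.Nonempty ∧ J.card ≤ R ^ t * e ∧ ∀ i, (e : ℤ) ∣ ∑ j ∈ J, v j i := by
  classical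
  induction t with
  | zero =>
    intro e he he1 σ _ v S hS
    have : e = 1 := by simp at he1; omega
    subst this
    obtain ⟨x, hx⟩ := Finset.card_pos.mp (by simpa using hS : 0 < S.card)
    exact ⟨{x}, by simpa using hx, by simp⟩
  | succ t ih =>
    intro e he he1 σ _ v S hS
    by_cases h1 : e = 1
    · subst h1
      obtain ⟨x, hx⟩ := Finset.card_pos.mp (lt_of_lt_of_le (by positivity) hS : 0 < S.card)
      exact ⟨{x}, by simpa using hx, by simp, by simpa using Nat.one_le_pow _ _ hR1, by simp⟩
    obtain ⟨e', he'⟩ := Nat.minFac_dvd e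
    set l := e.minFac with hl'
    have hl : l.Prime := Nat.minFac_prime h1
    have he'0 : 0 < e' := Nat.pos_of_ne_zero (by rintro rfl; omega)
    have he'1 : e' ≤ 2 ^ t := by
      have h2 := hl.two_le
      have : 2 * e' ≤ 2 * 2 ^ t := by
        calc 2 * e' ≤ l * e' := Nat.mul_le_mul_right _ h2
          _ ≤ 2 * 2 ^ t := by rw [← he', ← pow_succ']; exact he1
      omega
    have hstep : ∀ T ⊆ S, R * l ≤ T.card → ∃ J ⊆ T, J.Nonempty ∧ J.card ≤ R * l ∧
        ∀ i, (l : ℤ) ∣ ∑ j ∈ J, v j i := by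
      intro T _ hT
      obtain ⟨T', hT', hc⟩ := Finset.exists_subset_card_eq hT
      obtain ⟨J, hJ, hne, hg⟩ := cw_step l hl v T' (by
        rw [hc]
        calc _ ≤ R * (l - 1) := Nat.mul_le_mul_right _ hR
          _ < R * l := Nat.mul_lt_mul_of_pos_left (by have := hl.two_le; omega) hR1)
      exact ⟨J, hJ.trans hT', hne, (Finset.card_le_card hJ).trans hc.le, hg⟩
    have hprod : R ^ t * e' * (R * l) = R ^ (t+1) * e := by rw [he']; ring
    obtain ⟨F, hFc, hF, hd⟩ := extract _ (R * l) S hstep (R ^ t * e') (by rw [hprod]; exact hS)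
    obtain ⟨G, hGF, hGne, hGc, hG⟩ := ih e' he'0 he'1 (σ := Finset σ)
      (fun J i => (∑ j ∈ J, v j i) / l) F hFc.ge
    have hd' : (G : Set (Finset σ)).PairwiseDisjoint id := hd.subset (by exact_mod_cast hGF)
    refine ⟨G.biUnion id, ?_, ?_, ?_, ?_⟩
    · exact Finset.biUnion_subset.mpr fun J hJ => (hF J (hGF hJ)).1
    · obtain ⟨J, hJ⟩ := hGne
      obtain ⟨x, hx⟩ := (hF J (hGF hJ)).2.1
      exact ⟨x, Finset.mem_biUnion.mpr ⟨J, hJ, hx⟩⟩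
    · rw [← hprod]
      refine (Finset.card_biUnion_le_card_mul _ _ (R * l)
        fun J hJ => (hF J (hGF hJ)).2.2.1).trans ?_
      exact Nat.mul_le_mul_right _ hGc
    · intro i
      rw [Finset.sum_biUnion hd']
      have : ∑ J ∈ G, ∑ j ∈ id J, v j i = l * ∑ J ∈ G, (∑ j ∈ J, v j i) / l := by
        rw [Finset.mul_sum]
        apply Finset.sum_congr rfl
        intro J hJ
        exact (Int.mul_ediv_cancel' ((hF J (hGF hJ)).2.2.2 i)).symm
      rw [this, he']
      push_cast
      exact mul_dvd_mul_left _ (hG i)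

theorem dav_group {G : Type} [CommGroup G] [Finite G] (e t R : ℕ) (he : 0 < e) (het : e ≤ 2 ^ t)
    (hR1 : 1 ≤ R) (hG : Nat.card G ≤ 2 ^ R) (hexp : ∀ g : G, g ^ e = 1)
    {σ : Type} [DecidableEq σ] (f : σ → G) (S : Finset σ) (hS : R ^ t * e ≤ S.card) :
    ∃ J ⊆ S, J.Nonempty ∧ J.card ≤ R ^ t * e ∧ ∏ j ∈ J, f j = 1 := by
  classical
  obtain ⟨ι, _, n, hn, ⟨φ⟩⟩ := CommGroup.equiv_prod_multiplicative_zmod_of_finite G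
  have hcard : Fintype.card ι ≤ R := by
    have h1 : Nat.card G = ∏ i, n i := by
      rw [Nat.card_congr φ.toEquiv, Nat.card_pi]
      apply Finset.prod_congr rfl
      intro i _
      rw [Nat.card_congr Multiplicative.toAdd, Nat.card_zmod]
    have h2 : 2 ^ Fintype.card ι ≤ ∏ i, n i :=
      Finset.pow_card_le_prod (s := Finset.univ) (fun i => n i) 2 (fun i _ => hn i)
    exact (Nat.pow_le_pow_iff_right (by norm_num)).mp ((h2.trans h1.symm.le).trans hG)
  have hdvd : ∀ i, n i ∣ e := by
    intro i
    have := congrFun (congrArg φ (hexp (φ.symm (Pi.mulSingle i (Multiplicative.ofAdd 1))))) i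
    rw [map_pow, φ.apply_symm_apply, φ.map_one, Pi.pow_apply, Pi.mulSingle_eq_same,
      ← ofAdd_nsmul] at this
    have h2 : e • (1 : ZMod (n i)) = 0 := this
    rw [nsmul_one] at h2
    exact (ZMod.natCast_eq_zero_iff _ _).mp h2
  obtain ⟨J, hJ, hne, hc, h⟩ := dav_vec R hcard hR1 t e he het
    (fun j i => ((Multiplicative.toAdd (φ (f j) i)).cast : ℤ)) S hS
  refine ⟨J, hJ, hne, hc, ?_⟩
  apply φ.injective
  rw [map_prod, map_one]
  funext i
  rw [Finset.prod_apply]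
  have h1 : ((n i : ℕ) : ℤ) ∣ _ := (Int.natCast_dvd_natCast.mpr (hdvd i)).trans (h i)
  rw [← ZMod.intCast_zmod_eq_zero_iff_dvd, Int.cast_sum] at h1
  simp only [ZMod.intCast_cast, ZMod.cast_id', id] at h1
  apply Multiplicative.toAdd.injective
  rw [toAdd_prod]
  exact h1

theorem carm_of (S : Finset ℕ) (hp : ∀ p ∈ S, p.Prime) (N : ℕ) (hN : ∀ p ∈ S, p - 1 ∣ N)
    (h1 : N ∣ ∏ p ∈ S, p - 1) (h2 : 2 ≤ S.card) :
    IsCarmichael (∏ p ∈ S, p) ∧ (∏ p ∈ S, p).primeFactors = S := by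
  have hpf : (∏ p ∈ S, p).primeFactors = S := Nat.primeFactors_prod hp
  have hpos : 0 < ∏ p ∈ S, p := Finset.prod_pos fun p hpS => (hp p hpS).pos
  refine ⟨⟨?_, ?_, ?_⟩, hpf⟩
  · by_contra hlt
    have : ∏ p ∈ S, p = 1 := by omega
    rw [this] at hpf
    simp at hpf
    rw [← hpf] at h2
    simp at h2
  · intro hpr
    rw [hpr.primeFactors] at hpf
    rw [← hpf] at h2
    simp at h2
  · intro a
    rw [Nat.cast_prod]
    apply Finset.prod_dvd_of_coprime
    · intro p hpS q hqS hpq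
      exact Nat.isCoprime_iff_coprime.mpr ((Nat.coprime_primes (hp p hpS) (hp q hqS)).mpr hpq)
    · intro p hpS
      have := Fact.mk (hp p hpS)
      rw [← ZMod.intCast_zmod_eq_zero_iff_dvd]
      push_cast
      by_cases ha : (a : ZMod p) = 0
      · rw [ha, zero_pow hpos.ne', sub_zero]
      · obtain ⟨m, hm⟩ := (hN p hpS).trans h1
        have : ∏ p ∈ S, p = (p - 1) * m + 1 := by omega
        rw [this, pow_succ, pow_mul, ZMod.pow_card_sub_one_eq_one ha]
        simp

/-- exponent of units mod k*L -/
theorem exp_units (L c M : ℕ) (hL : 0 < L) (hc : 0 < c) (Q : Finset ℕ) (hQ : ∀ q ∈ Q, q.Prime)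
    (hLQ : L = ∏ q ∈ Q, q) (hM : ∀ q ∈ Q, q - 1 ∣ M) (g : (ZMod (L * c))ˣ) :
    g ^ (M * c.totient * c) = 1 := by
  have : NeZero (L * c) := ⟨by positivity⟩
  obtain ⟨x, hx⟩ : ∃ x : ℕ, (x : ZMod (L * c)) = g := ⟨(g : ZMod (L*c)).val, by simp⟩
  have hcop : Nat.Coprime x (L * c) := by
    rw [← ZMod.isUnit_iff_coprime, hx]; exact g.isUnit
  have hcL : Nat.Coprime x L := Nat.Coprime.coprime_mul_right_right hcop
  have hcc : Nat.Coprime x c := Nat.Coprime.coprime_mul_left_right hcop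
  set y : ℤ := (x : ℤ) ^ (M * c.totient) with hy
  have hyL : (L : ℤ) ∣ y - 1 := by
    rw [hLQ, Nat.cast_prod]
    apply Finset.prod_dvd_of_coprime
    · intro p hpS q hqS hpq
      exact Nat.isCoprime_iff_coprime.mpr ((Nat.coprime_primes (hQ p hpS) (hQ q hqS)).mpr hpq)
    · intro p hpS
      have := Fact.mk (hQ p hpS)
      rw [← ZMod.intCast_zmod_eq_zero_iff_dvd, hy]
      push_cast
      have hx0 : (x : ZMod p) ≠ 0 := by
        rw [Ne, ZMod.natCast_eq_zero_iff]
        intro hd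
        have hpL : p ∣ L := by rw [hLQ]; exact Finset.dvd_prod_of_mem _ hpS
        exact (hQ p hpS).one_lt.ne' (Nat.dvd_one.mp (hcL ▸ Nat.dvd_gcd hd hpL))
      obtain ⟨m, rfl⟩ := hM p hpS
      rw [mul_assoc, pow_mul, ZMod.pow_card_sub_one_eq_one hx0, one_pow, sub_self]
  have hyc : (c : ℤ) ∣ y - 1 := by
    rw [hy, mul_comm, pow_mul]
    refine dvd_trans ?_ (sub_one_dvd_pow_sub_one _ _)
    have := (Nat.ModEq.pow_totient hcc)
    have h2 := (Nat.modEq_iff_dvd.mp this.symm)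
    push_cast at h2
    exact h2
  have hS : (c : ℤ) ∣ ∑ i ∈ Finset.range c, y ^ i := by
    have : (∑ i ∈ Finset.range c, y ^ i) = ∑ i ∈ Finset.range c, (y ^ i - 1) + c := by
      simp
    rw [this]
    refine dvd_add (Finset.dvd_sum fun i _ => hyc.trans (sub_one_dvd_pow_sub_one _ _)) dvd_rfl
  have hfin : ((L * c : ℕ) : ℤ) ∣ y ^ c - 1 := by
    rw [← mul_geom_sum]
    push_cast
    exact mul_dvd_mul hyL hS
  ext
  rw [Units.val_pow_eq_pow_val, ← hx, Units.val_one]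
  rw [← ZMod.intCast_zmod_eq_zero_iff_dvd, hy, ← pow_mul] at hfin
  push_cast at hfin
  exact sub_eq_zero.mp hfin

theorem hb_one (C : ℕ) (H : ∀ c d x : ℕ, 2 ≤ d → Nat.Coprime c d → d ≤ 2 ^ x →
      ∃ p : ℕ, p.Prime ∧ p % d = c % d ∧ p ≤ C * d * x ^ 2) (d x : ℕ) (h2 : 2 ≤ d)
    (hx : d ≤ 2 ^ x) : ∃ k, 1 ≤ k ∧ k ≤ C * x ^ 2 ∧ (1 + d * k).Prime := by
  obtain ⟨p, hp, hm, hle⟩ := H 1 d x h2 (Nat.coprime_one_left d) hx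
  rw [Nat.mod_eq_of_lt (by omega : 1 < d)] at hm
  have hdiv := Nat.div_add_mod p d
  rw [hm] at hdiv
  refine ⟨p / d, ?_, ?_, ?_⟩
  · rcases Nat.eq_zero_or_pos (p / d) with h | h
    · rw [h] at hdiv; have := hp.two_le; omega
    · exact h
  · have : d * (p / d) ≤ d * (C * x ^ 2) := by nlinarith
    exact Nat.le_of_mul_le_mul_left this (by omega)
  · rw [add_comm, hdiv]; exact hp

/-- pigeonhole -/
theorem pigeon (C : ℕ) (H : ∀ c d x : ℕ, 2 ≤ d → Nat.Coprime c d → d ≤ 2 ^ x →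
      ∃ p : ℕ, p.Prime ∧ p % d = c % d ∧ p ≤ C * d * x ^ 2) (T : Finset ℕ) (x y : ℕ)
    (hT : ∀ d ∈ T, 2 ≤ d ∧ d ≤ 2 ^ x) (hy : y * (C * x ^ 2) ≤ T.card) (hT0 : T.Nonempty) :
    ∃ k T', T' ⊆ T ∧ y ≤ T'.card ∧ 1 ≤ k ∧ k ≤ C * x ^ 2 ∧ ∀ d ∈ T', (1 + d * k).Prime := by
  have key : ∀ d ∈ T, ∃ k, 1 ≤ k ∧ k ≤ C * x ^ 2 ∧ (1 + d * k).Prime := by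
    intro d hd
    obtain ⟨h2, hx⟩ := hT d hd
    exact hb_one C H d x h2 hx
  choose! k hk1 hk2 hk3 using key
  obtain ⟨b, hb, hcard⟩ := Finset.exists_le_card_fiber_of_mul_le_card_of_maps_to
    (s := T) (t := Finset.Icc 1 (C * x ^ 2)) (f := k) (n := y)
    (fun d hd => Finset.mem_Icc.mpr ⟨hk1 d hd, hk2 d hd⟩) (by
      obtain ⟨d, hd⟩ := hT0
      exact ⟨k d, Finset.mem_Icc.mpr ⟨hk1 d hd, hk2 d hd⟩⟩) (by simpa [mul_comm] using hy)
  rw [Finset.mem_Icc] at hb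
  refine ⟨b, T.filter (fun d => k d = b), Finset.filter_subset _ _, hcard, hb.1, hb.2, ?_⟩
  intro d hd
  rw [Finset.mem_filter] at hd
  rw [← hd.2]
  exact hk3 d hd.1

theorem hb_nat (HB : ∃ C : ℝ, 0 < C ∧ ∀ c d : ℕ, 2 ≤ d → Nat.Coprime c d →
      ∃ p : ℕ, p.Prime ∧ p % d = c % d ∧ (p : ℝ) ≤ C * d * (Real.log d) ^ 2) :
    ∃ C : ℕ, 1 ≤ C ∧ ∀ c d x : ℕ, 2 ≤ d → Nat.Coprime c d → d ≤ 2 ^ x →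
      ∃ p : ℕ, p.Prime ∧ p % d = c % d ∧ p ≤ C * d * x ^ 2 := by
  obtain ⟨C, hC, H⟩ := HB
  refine ⟨⌈C⌉₊, Nat.one_le_ceil_iff.mpr hC, ?_⟩
  intro c d x hd hc hx
  obtain ⟨p, hp, hm, hle⟩ := H c d hd hc
  refine ⟨p, hp, hm, ?_⟩
  have hd' : (1 : ℝ) ≤ d := by exact_mod_cast (by omega : 1 ≤ d)
  have h0 : 0 ≤ Real.log d := Real.log_nonneg hd'
  have h1 : Real.log d ≤ x := by
    have : Real.log d ≤ Real.log ((2 : ℝ) ^ x) :=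
      Real.log_le_log (by linarith) (by exact_mod_cast hx)
    rw [Real.log_pow] at this
    have h2 : Real.log 2 ≤ 1 := by have := Real.log_two_lt_d9; linarith
    have : (x : ℝ) * Real.log 2 ≤ x * 1 := mul_le_mul_of_nonneg_left h2 (by positivity)
    linarith
  have : (p : ℝ) ≤ (⌈C⌉₊ : ℝ) * d * (x : ℝ) ^ 2 := by
    refine hle.trans ?_
    gcongr
    exact Nat.le_ceil C
  exact_mod_cast this

theorem smooth_card (a : ℕ) (ha : 1 ≤ a) : ∃ T : Finset ℕ, a ^ 6 ≤ T.card ∧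
    ∀ d ∈ T, 2 ≤ d ∧ d ∣ 30030 ^ a := by
  refine ⟨(30030 ^ a).divisors.erase 1, ?_, ?_⟩
  · have h : (30030 ^ a).divisors.card = (a + 1) ^ 6 := by
      have h1 : (30030 : ℕ) ^ a = 2 ^ a * (3 ^ a * (5 ^ a * (7 ^ a * (11 ^ a * 13 ^ a)))) := by
        simp only [← mul_pow]; norm_num
      have c : ∀ p : ℕ, p.Prime → (p ^ a).divisors.card = a + 1 := by
        intro p hp
        rw [Nat.divisors_prime_pow hp]; simp
      have cm : ∀ u v : ℕ, Nat.Coprime u v → (u * v).divisors.card = u.divisors.card * v.divisors.card :=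
        fun u v h => h.card_divisors_mul
      have cp : ∀ u v : ℕ, Nat.Coprime u v → Nat.Coprime (u ^ a) (v ^ a) := fun u v h => h.pow a a
      rw [h1, cm, cm, cm, cm, cm, c 2 (by norm_num), c 3 (by norm_num), c 5 (by norm_num),
        c 7 (by norm_num), c 11 (by norm_num), c 13 (by norm_num)]
      · ring
      all_goals try simp only [← mul_pow]
      all_goals exact cp _ _ (by norm_num)
    rw [Finset.card_erase_of_mem (by simp), h]
    have : a ^ 6 < (a + 1) ^ 6 := Nat.pow_lt_pow_left (by omega) (by norm_num)
    omega
  · intro d hd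
    rw [Finset.mem_erase, Nat.mem_divisors] at hd
    have := Nat.pos_of_dvd_of_pos hd.2.1 (by positivity)
    exact ⟨by omega, hd.2.1⟩

theorem final_comb (C : ℕ) (H : ∀ c d x : ℕ, 2 ≤ d → Nat.Coprime c d → d ≤ 2 ^ x →
      ∃ p : ℕ, p.Prime ∧ p % d = c % d ∧ p ≤ C * d * x ^ 2)
    (N : ℕ) (hN : 0 < N) (hp0 : (1 + N).Prime) (S : Finset ℕ)
    (hS : ∀ p ∈ S, p.Prime ∧ p - 1 ∣ N ∧ Nat.Coprime p N ∧ p ≠ 1 + N)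
    (e t R : ℕ) (he : 0 < e) (het : e ≤ 2 ^ t) (hR1 : 1 ≤ R) (hNR : N ≤ 2 ^ R)
    (hexp : ∀ g : (ZMod N)ˣ, g ^ e = 1) (hcard : 8 * C * (R ^ t * e) ^ 4 ≤ S.card) :
    ∃ n, N < n ∧ IsCarmichael n ∧ (n.primeFactors.card).Prime := by
  classical
  have : NeZero N := ⟨hN.ne'⟩
  let f : ℕ → (ZMod N)ˣ := fun p =>
    if h : Nat.Coprime p N then ZMod.unitOfCoprime p h else 1
  have hf : ∀ p ∈ S, ((f p : (ZMod N)ˣ) : ZMod N) = p := by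
    intro p hp
    simp only [f]
    rw [dif_pos (hS p hp).2.2.1, ZMod.coe_unitOfCoprime]
  have hGcard : Nat.card (ZMod N)ˣ ≤ 2 ^ R := by
    rw [Nat.card_eq_fintype_card, ZMod.card_units_eq_totient]
    exact (Nat.totient_le N).trans hNR
  set B := R ^ t * e with hB
  have hB1 : 1 ≤ B := Nat.mul_pos (Nat.pow_pos hR1) he
  obtain ⟨F, hFc, hF, hd⟩ := extract (fun J => ∏ j ∈ J, f j = 1) B S
    (fun T _ hT => dav_group e t R he het hR1 hGcard hexp f T hT) (B * (8 * C * B ^ 2))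
    (by refine le_trans (le_of_eq ?_) hcard; ring)
  obtain ⟨s, hs, hsc⟩ := Finset.exists_le_card_fiber_of_mul_le_card_of_maps_to
    (s := F) (t := Finset.Icc 1 B) (f := Finset.card) (n := 8 * C * B ^ 2)
    (fun J hJ => Finset.mem_Icc.mpr ⟨(hF J hJ).2.1.card_pos, (hF J hJ).2.2.1⟩)
    ⟨1, Finset.mem_Icc.mpr ⟨le_rfl, hB1⟩⟩ (by rw [hFc]; simp)
  rw [Finset.mem_Icc] at hs
  obtain ⟨v, hv1, hv, hr⟩ := hb_one C H (2 * s) (2 * s) (by omega) Nat.lt_two_pow_self.le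
  have hu : 2 * v ≤ 8 * C * B ^ 2 := by
    have : s ^ 2 ≤ B ^ 2 := Nat.pow_le_pow_left hs.2 2
    calc 2 * v ≤ 2 * (C * (2 * s) ^ 2) := Nat.mul_le_mul_left _ hv
      _ = 8 * C * s ^ 2 := by ring
      _ ≤ _ := Nat.mul_le_mul_left _ this
  obtain ⟨F', hF', hF'c⟩ := Finset.exists_subset_card_eq (hu.trans hsc)
  have hF'F : F' ⊆ F := hF'.trans (Finset.filter_subset _ _)
  have hF's : ∀ J ∈ F', J.card = s := fun J hJ => (Finset.mem_filter.mp (hF' hJ)).2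
  have hd' : (F' : Set (Finset ℕ)).PairwiseDisjoint id := hd.subset (by exact_mod_cast hF'F)
  set Z := F'.biUnion id with hZ
  have hZS : Z ⊆ S := Finset.biUnion_subset.mpr fun J hJ => (hF J (hF'F hJ)).1
  have hZc : Z.card = 2 * v * s := by
    rw [hZ, Finset.card_biUnion hd', ← hF'c]
    exact Finset.sum_const_nat hF's
  have hZ1 : ∏ p ∈ Z, f p = 1 := by
    rw [hZ, Finset.prod_biUnion hd']
    exact Finset.prod_eq_one fun J hJ => (hF J (hF'F hJ)).2.2.2
  have hnot : 1 + N ∉ Z := fun h => (hS _ (hZS h)).2.2.2 rfl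
  have hcc : (insert (1 + N) Z).card = 1 + 2 * s * v := by
    rw [Finset.card_insert_of_notMem hnot, hZc]; ring
  have hpr : ∀ p ∈ insert (1 + N) Z, p.Prime := by
    intro p hp
    rcases Finset.mem_insert.mp hp with rfl | hp
    · exact hp0
    · exact (hS p (hZS hp)).1
  have hpos : 0 < ∏ p ∈ insert (1 + N) Z, p := Finset.prod_pos fun p hp => (hpr p hp).pos
  obtain ⟨h1, h2⟩ := carm_of (insert (1 + N) Z) hpr N (by
    intro p hp
    rcases Finset.mem_insert.mp hp with rfl | hp
    · simp
    · exact (hS p (hZS hp)).2.1) (by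
    rw [← Nat.modEq_iff_dvd' hpos, ← ZMod.natCast_eq_natCast_iff, Finset.prod_insert hnot]
    push_cast
    rw [ZMod.natCast_self, add_zero, one_mul]
    have := congrArg (Units.val) hZ1
    rw [Units.coe_prod, Units.val_one] at this
    rw [← this]
    exact Finset.prod_congr rfl fun p hp => hf p (hZS hp)) (by
    rw [hcc]; exact hr.two_le)
  refine ⟨_, ?_, h1, ?_⟩
  · have := Nat.le_of_dvd hpos (Finset.dvd_prod_of_mem (fun p => p) (Finset.mem_insert_self (1 + N) Z))
    omega
  · rw [h2, hcc]; exact hr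

theorem stage1 (C : ℕ) (H : ∀ c d x : ℕ, 2 ≤ d → Nat.Coprime c d → d ≤ 2 ^ x →
      ∃ p : ℕ, p.Prime ∧ p % d = c % d ∧ p ≤ C * d * x ^ 2) (a : ℕ)
    (ha2 : 841 * C ≤ a) (ha1 : 1500 ≤ a) :
    ∃ (Q : Finset ℕ) (M : ℕ), 0 < M ∧ M ≤ 2 ^ (18 * a) ∧ Q.card = a ^ 3 ∧
      (∀ q ∈ Q, q.Prime ∧ q - 1 ∣ M) ∧ ∏ q ∈ Q, q ≤ 2 ^ (19 * a ^ 4) := by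
  have haa : a ≤ 2 ^ a := Nat.lt_two_pow_self.le
  obtain ⟨T, hTc, hT⟩ := smooth_card a (by omega)
  have h30 : 30030 ^ a ≤ 2 ^ (15 * a) := by
    rw [pow_mul]; exact Nat.pow_le_pow_left (by norm_num) a
  have hT0 : T.Nonempty := Finset.card_pos.mp (lt_of_lt_of_le (by positivity) hTc)
  obtain ⟨k, T', hT', hT'c, hk1, hk, hpr⟩ := pigeon C H T (15 * a) (a ^ 3)
    (fun d hd => ⟨(hT d hd).1, (Nat.le_of_dvd (by positivity) (hT d hd).2).trans h30⟩) (by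
      refine le_trans ?_ hTc
      calc a ^ 3 * (C * (15 * a) ^ 2) = 225 * C * a ^ 5 := by ring
        _ ≤ a * a ^ 5 := Nat.mul_le_mul_right _ (by omega)
        _ = a ^ 6 := by ring) hT0
  obtain ⟨T'', hT'', hc⟩ := Finset.exists_subset_card_eq hT'c
  have hk3 : k ≤ 2 ^ (3 * a) := by
    calc k ≤ C * (15 * a) ^ 2 := hk
      _ = 225 * C * a ^ 2 := by ring
      _ ≤ a * a ^ 2 := Nat.mul_le_mul_right _ (by omega)
      _ = a ^ 3 := by ring
      _ ≤ (2 ^ a) ^ 3 := Nat.pow_le_pow_left haa 3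
      _ = _ := by rw [← pow_mul, mul_comm]
  have hM : 30030 ^ a * k ≤ 2 ^ (18 * a) := by
    calc _ ≤ 2 ^ (15 * a) * 2 ^ (3 * a) := Nat.mul_le_mul h30 hk3
      _ = _ := by rw [← pow_add]; congr 1; ring
  have hinj : Set.InjOn (fun d => 1 + d * k) (T'' : Set ℕ) := by
    intro x _ y _ hxy
    simp only at hxy
    exact Nat.eq_of_mul_eq_mul_right hk1 (by omega)
  have hQ : ∀ q ∈ T''.image (fun d => 1 + d * k), q.Prime ∧ q - 1 ∣ 30030 ^ a * k := by
    intro q hq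
    obtain ⟨d, hd, rfl⟩ := Finset.mem_image.mp hq
    refine ⟨hpr d (hT'' hd), ?_⟩
    rw [Nat.add_sub_cancel_left]
    exact mul_dvd_mul_right (hT d (hT' (hT'' hd))).2 k
  have hcc : (T''.image (fun d => 1 + d * k)).card = a ^ 3 := by
    rw [Finset.card_image_of_injOn hinj, hc]
  refine ⟨T''.image (fun d => 1 + d * k), 30030 ^ a * k, by positivity, hM, hcc, hQ, ?_⟩
  calc _ ≤ (2 ^ (19 * a)) ^ (T''.image (fun d => 1 + d * k)).card := by
        apply Finset.prod_le_pow_card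
        intro q hq
        have h1 := Nat.le_of_dvd (by positivity) (hQ q hq).2
        have h2 : 2 ^ (19 * a) = 2 ^ (18 * a) * 2 ^ a := by rw [← pow_add]; congr 1; ring
        have h3 : 1 ≤ 2 ^ (18 * a) := Nat.one_le_two_pow
        have h4 : 2 ^ (18 * a) * 2 ≤ 2 ^ (18 * a) * 2 ^ a := Nat.mul_le_mul_left _ (by omega)
        omega
    _ = _ := by rw [hcc, ← pow_mul]; congr 1; ring

theorem subprods (Q : Finset ℕ) (hQ : ∀ q ∈ Q, q.Prime) : ∃ T : Finset ℕ,
    T.card = 2 ^ Q.card - 1 ∧ ∀ d ∈ T, 2 ≤ d ∧ d ∣ ∏ q ∈ Q, q := by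
  classical
  refine ⟨(Q.powerset.erase ∅).image (fun A => ∏ q ∈ A, q), ?_, ?_⟩
  · rw [Finset.card_image_of_injOn, Finset.card_erase_of_mem (by simp), Finset.card_powerset]
    intro A hA B hB hAB
    simp only [Finset.coe_erase, Set.mem_sdiff, Finset.mem_coe, Finset.mem_powerset] at hA hB
    simp only at hAB
    rw [← Nat.primeFactors_prod (s := A) (fun p hp => hQ p (hA.1 hp)), hAB,
      Nat.primeFactors_prod (s := B) (fun p hp => hQ p (hB.1 hp))]
  · intro d hd
    obtain ⟨A, hA, rfl⟩ := Finset.mem_image.mp hd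
    rw [Finset.mem_erase, Finset.mem_powerset] at hA
    refine ⟨?_, Finset.prod_dvd_prod_of_subset _ _ _ hA.2⟩
    obtain ⟨q, hq⟩ := Finset.nonempty_iff_ne_empty.mpr hA.1
    have := Nat.le_of_dvd (Finset.prod_pos fun p hp => (hQ p (hA.2 hp)).pos)
      (Finset.dvd_prod_of_mem (fun p => p) hq)
    exact (hQ q (hA.2 hq)).two_le.trans this

theorem main_step (C : ℕ) (H : ∀ c d x : ℕ, 2 ≤ d → Nat.Coprime c d → d ≤ 2 ^ x →
      ∃ p : ℕ, p.Prime ∧ p % d = c % d ∧ p ≤ C * d * x ^ 2) (a : ℕ)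
    (ha2 : 841 * C ≤ a) (ha1 : 1500 ≤ a) :
    ∃ n, a < n ∧ IsCarmichael n ∧ (n.primeFactors.card).Prime := by
  classical
  have haa : a ≤ 2 ^ a := Nat.lt_two_pow_self.le
  have hapow : ∀ i, a ^ i ≤ 2 ^ (i * a) := fun i => by
    rw [mul_comm, pow_mul]; exact Nat.pow_le_pow_left haa i
  have h2m : ∀ {x y : ℕ}, x ≤ y → 2 ^ x ≤ 2 ^ y := fun h => Nat.pow_le_pow_right (by norm_num) h
  obtain ⟨Q, M, hM0, hM, hQc, hQ, hL⟩ := stage1 C H a ha2 ha1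
  obtain ⟨T, hTc, hT⟩ := subprods Q (fun q hq => (hQ q hq).1)
  rw [hQc] at hTc
  set L := ∏ q ∈ Q, q with hLdef
  have hL0 : 0 < L := Finset.prod_pos fun p hp => (hQ p hp).1.pos
  have hLbig : 2 ^ a ^ 3 ≤ L := by
    rw [← hQc]; exact Finset.pow_card_le_prod _ _ _ fun q hq => (hQ q hq).1.two_le
  have ha3 : a ≤ a ^ 3 := Nat.le_self_pow (by norm_num) a
  have haL : a < L := lt_of_lt_of_le (Nat.lt_two_pow_self.trans_le (h2m ha3)) hLbig
  have hTne : 0 < T.card := by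
    rw [hTc]
    have : 2 ^ 1 ≤ 2 ^ (a ^ 3) := h2m (by omega)
    omega
  have hC8 : ∀ m, m ≤ 841 → m * C * a ^ 8 ≤ a ^ 9 := fun m hm => by
    calc m * C * a ^ 8 ≤ a * a ^ 8 := Nat.mul_le_mul_right _ ((Nat.mul_le_mul_right _ hm).trans ha2)
      _ = a ^ 9 := by ring
  obtain ⟨k, T', hT', hT'c, hk1, hk, hpr⟩ := pigeon C H T (19 * a ^ 4) (2 ^ (1400 * a ^ 2))
    (fun d hd => ⟨(hT d hd).1, (Nat.le_of_dvd hL0 (hT d hd).2).trans hL⟩) (by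
      rw [hTc]
      have h1 : C * (19 * a ^ 4) ^ 2 ≤ 2 ^ (9 * a) := by
        calc C * (19 * a ^ 4) ^ 2 = 361 * C * a ^ 8 := by ring
          _ ≤ _ := (hC8 361 (by norm_num)).trans (hapow 9)
      have h2 : 2 ^ (1400 * a ^ 2) * (C * (19 * a ^ 4) ^ 2) ≤ 2 ^ (1400 * a ^ 2 + 9 * a) := by
        rw [pow_add]; exact Nat.mul_le_mul_left _ h1
      have h3 : 1400 * a ^ 2 + 9 * a < a ^ 3 := by nlinarith [Nat.mul_le_mul_right (a ^ 2) ha1]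
      have h4 : 2 ^ (1400 * a ^ 2 + 9 * a) < 2 ^ (a ^ 3) := Nat.pow_lt_pow_right (by norm_num) h3
      omega) (Finset.card_pos.mp hTne)
  have hk9 : k ≤ a ^ 9 := by
    calc k ≤ C * (19 * a ^ 4) ^ 2 := hk
      _ = 361 * C * a ^ 8 := by ring
      _ ≤ _ := hC8 361 (by norm_num)
  have ha4 : a ≤ a ^ 4 := Nat.le_self_pow (by norm_num) a
  have hLk : L * k ≤ 2 ^ (29 * a ^ 4) := by
    calc L * k ≤ 2 ^ (19 * a ^ 4) * 2 ^ (9 * a) := Nat.mul_le_mul hL (hk9.trans (hapow 9))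
      _ = 2 ^ (19 * a ^ 4 + 9 * a) := by rw [pow_add]
      _ ≤ _ := h2m (by omega)
  have hLkL : L ≤ L * k := Nat.le_mul_of_pos_right _ hk1
  obtain ⟨j, hj1, hj, hp0⟩ := hb_one C H (L * k) (29 * a ^ 4) (by omega) hLk
  have hj9 : j ≤ a ^ 9 := by
    calc j ≤ C * (29 * a ^ 4) ^ 2 := hj
      _ = 841 * C * a ^ 8 := by ring
      _ ≤ _ := hC8 841 le_rfl
  have hkj : k * j ≤ 2 ^ (18 * a) := by
    calc k * j ≤ a ^ 9 * a ^ 9 := Nat.mul_le_mul hk9 hj9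
      _ = a ^ 18 := by ring
      _ ≤ _ := hapow 18
  have hkj0 : 0 < k * j := Nat.mul_pos hk1 hj1
  rw [mul_assoc] at hp0
  set N := L * (k * j) with hNdef
  have hN0 : 0 < N := Nat.mul_pos hL0 hkj0
  have hNR : N ≤ 2 ^ (a ^ 5) := by
    calc N ≤ 2 ^ (19 * a ^ 4) * 2 ^ (18 * a) := Nat.mul_le_mul hL hkj
      _ = 2 ^ (19 * a ^ 4 + 18 * a) := by rw [pow_add]
      _ ≤ _ := h2m (by nlinarith [Nat.mul_le_mul_right (a ^ 4) ha1])
  set e := M * (k * j).totient * (k * j) with hedef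
  have he0 : 0 < e := Nat.mul_pos (Nat.mul_pos hM0 (Nat.totient_pos.mpr hkj0)) hkj0
  have he : e ≤ 2 ^ (54 * a) := by
    calc e ≤ 2 ^ (18 * a) * 2 ^ (18 * a) * 2 ^ (18 * a) :=
          Nat.mul_le_mul (Nat.mul_le_mul hM ((Nat.totient_le _).trans hkj)) hkj
      _ = _ := by rw [← pow_add, ← pow_add]; congr 1; ring
  set S0 := T'.image (fun d => 1 + d * k) with hS0
  have hS0c : 2 ^ (1400 * a ^ 2) ≤ S0.card := by
    rw [hS0, Finset.card_image_of_injOn]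
    · exact hT'c
    · intro x _ y _ hxy
      simp only at hxy
      exact Nat.eq_of_mul_eq_mul_right hk1 (by omega)
  have hpf : N.primeFactors.card ≤ a ^ 5 := by
    have h1 : 2 ^ N.primeFactors.card ≤ ∏ p ∈ N.primeFactors, p :=
      Finset.pow_card_le_prod _ _ _ fun q hq => (Nat.prime_of_mem_primeFactors hq).two_le
    have h2 := Nat.le_of_dvd hN0 (Nat.prod_primeFactors_dvd N)
    exact (Nat.pow_le_pow_iff_right (by norm_num)).mp ((h1.trans h2).trans hNR)
  obtain ⟨n, hn, h1, h2⟩ := final_comb C H N hN0 hp0 ((S0 \ N.primeFactors).erase (1 + N)) (by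
      intro p hp
      rw [Finset.mem_erase, Finset.mem_sdiff] at hp
      obtain ⟨hne, hpS, hpN⟩ := hp
      obtain ⟨d, hd, rfl⟩ := Finset.mem_image.mp hpS
      have hP := hpr d hd
      refine ⟨hP, ?_, ?_, hne⟩
      · rw [Nat.add_sub_cancel_left, hNdef, ← mul_assoc]
        exact (mul_dvd_mul_right (hT d (hT' hd)).2 k).mul_right j
      · rw [hP.coprime_iff_not_dvd]
        intro hdv
        exact hpN (Nat.mem_primeFactors.mpr ⟨hP, hdv, hN0.ne'⟩))
    e (54 * a) (a ^ 5) he0 he (Nat.pow_pos (by omega)) hNR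
    (exp_units L (k * j) M hL0 hkj0 Q (fun q hq => (hQ q hq).1) hLdef fun q hq => (hQ q hq).2) (by
      have hB : (a ^ 5) ^ (54 * a) * e ≤ 2 ^ (324 * a ^ 2) := by
        calc (a ^ 5) ^ (54 * a) * e ≤ (2 ^ (5 * a)) ^ (54 * a) * 2 ^ (54 * a) :=
              Nat.mul_le_mul (Nat.pow_le_pow_left (hapow 5) _) he
          _ = 2 ^ (270 * a ^ 2 + 54 * a) := by rw [← pow_mul, ← pow_add]; congr 1; ring
          _ ≤ _ := h2m (by nlinarith)
      have h8 : 8 * C * ((a ^ 5) ^ (54 * a) * e) ^ 4 ≤ 2 ^ (1296 * a ^ 2 + a) := by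
        calc _ ≤ 2 ^ a * (2 ^ (324 * a ^ 2)) ^ 4 :=
              Nat.mul_le_mul (by omega) (Nat.pow_le_pow_left hB 4)
          _ = _ := by rw [← pow_mul, ← pow_add]; congr 1; ring
      have haq : a ≤ a ^ 2 := Nat.le_self_pow (by norm_num) a
      have hA : 2 ^ (1296 * a ^ 2 + a) ≤ 2 ^ (1399 * a ^ 2) := h2m (by omega)
      have hA2 : a ^ 5 + 1 ≤ 2 ^ (1399 * a ^ 2) := by
        have h5 : 2 ^ (5 * a) < 2 ^ (1399 * a ^ 2) :=
          Nat.pow_lt_pow_right (by norm_num) (by omega)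
        have := hapow 5
        omega
      have hA3 : 2 ^ (1399 * a ^ 2) + 2 ^ (1399 * a ^ 2) ≤ 2 ^ (1400 * a ^ 2) := by
        rw [← two_mul, ← pow_succ']
        exact h2m (by omega)
      have hc1 := Finset.le_card_sdiff N.primeFactors S0
      have hc2 := Finset.pred_card_le_card_erase (s := S0 \ N.primeFactors) (a := 1 + N)
      omega)
  refine ⟨n, ?_, h1, h2⟩
  have : L ≤ N := Nat.le_mul_of_pos_right _ hkj0
  omega

theorem carmichael_prime_omega_of_heathBrown
    (HB : ∃ C : ℝ, 0 < C ∧ ∀ c d : ℕ, 2 ≤ d → Nat.Coprime c d →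
      ∃ p : ℕ, p.Prime ∧ p % d = c % d ∧ (p : ℝ) ≤ C * d * (Real.log d) ^ 2) :
    {n : ℕ | IsCarmichael n ∧ (n.primeFactors.card).Prime}.Infinite := by
  obtain ⟨C, _, H⟩ := hb_nat HB
  rw [Set.infinite_iff_exists_gt]
  intro X
  obtain ⟨n, hn, h1, h2⟩ := main_step C H (X + 841 * C + 1500) (by omega) (by omega)
  exact ⟨n, ⟨h1, h2⟩, by omega⟩
end

section
/- Fix a real number θ with 1 < θ < 2. There exist constants γ > 0 and Y > 0 (depending only on θ) such that for all real y > Y, the number of primes q satisfying y^θ/(log y) ≤ q ≤ y^θ and such that every prime divisor of q − 1 is at most y, is at least γ·y^θ/log(y^θ). -/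
namespace SSP
open Finset

/-- squared modulus of the trigonometric sum -/
noncomputable def tf (B : Finset ℕ) (b : ℕ → ℝ) (t : ℝ) : ℝ :=
  (∑ n ∈ B, b n * Real.cos (2 * Real.pi * n * t)) ^ 2 +
    (∑ n ∈ B, b n * Real.sin (2 * Real.pi * n * t)) ^ 2

lemma tf_nonneg (B : Finset ℕ) (b : ℕ → ℝ) (t : ℝ) : 0 ≤ tf B b t := by
  unfold tf; positivity

lemma tf_expand (B : Finset ℕ) (b : ℕ → ℝ) (t : ℝ) :
    tf B b t = ∑ m ∈ B, ∑ n ∈ B, b m * b n * Real.cos (2 * Real.pi * ((m : ℝ) - n) * t) := by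
  unfold tf
  rw [sq, sq, sum_mul_sum, sum_mul_sum, ← sum_add_distrib]
  refine sum_congr rfl fun m _ => ?_
  rw [← sum_add_distrib]
  refine sum_congr rfl fun n _ => ?_
  rw [show 2 * Real.pi * ((m : ℝ) - n) * t = 2 * Real.pi * m * t - 2 * Real.pi * n * t by ring,
    Real.cos_sub]
  ring

lemma tf_cont (B : Finset ℕ) (b : ℕ → ℝ) : Continuous (tf B b) := by
  unfold tf; fun_prop

lemma integral_cos_int (k : ℤ) (hk : k ≠ 0) :
    ∫ t in (0 : ℝ)..1, Real.cos (2 * Real.pi * k * t) = 0 := by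
  have h : (2 * Real.pi * k : ℝ) ≠ 0 := by
    have : (k : ℝ) ≠ 0 := by exact_mod_cast hk
    positivity
  rw [intervalIntegral.integral_comp_mul_left (fun u => Real.cos u) h]
  simp only [integral_cos, mul_zero, mul_one, Real.sin_zero, sub_zero]
  rw [show (2 * Real.pi * k : ℝ) = ((2 * k : ℤ) : ℝ) * Real.pi by push_cast; ring,
    Real.sin_int_mul_pi]
  simp

lemma tf_parseval (B : Finset ℕ) (b : ℕ → ℝ) :
    ∫ t in (0 : ℝ)..1, tf B b t = ∑ n ∈ B, b n ^ 2 := by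
  simp_rw [tf_expand]
  rw [intervalIntegral.integral_finsetSum]
  · refine sum_congr rfl fun m hm => ?_
    rw [intervalIntegral.integral_finsetSum]
    · rw [sum_eq_single m]
      · simp [sq]
      · intro n _ hnm
        rw [intervalIntegral.integral_const_mul]
        have := integral_cos_int ((m : ℤ) - n) (by omega)
        push_cast at this
        rw [this, mul_zero]
      · intro h; exact absurd hm h
    · intro n _
      apply Continuous.intervalIntegrable; fun_prop
  · intro n _
    apply Continuous.intervalIntegrable; fun_prop

lemma tf_hasDerivAt (B : Finset ℕ) (b : ℕ → ℝ) (t : ℝ) :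
    HasDerivAt (tf B b)
      (2 * (∑ n ∈ B, b n * Real.cos (2 * Real.pi * n * t)) *
          (-∑ n ∈ B, (2 * Real.pi * n * b n) * Real.sin (2 * Real.pi * n * t)) +
        2 * (∑ n ∈ B, b n * Real.sin (2 * Real.pi * n * t)) *
          (∑ n ∈ B, (2 * Real.pi * n * b n) * Real.cos (2 * Real.pi * n * t))) t := by
  have h1 : HasDerivAt (fun t : ℝ => ∑ n ∈ B, b n * Real.cos (2 * Real.pi * n * t))
      (∑ n ∈ B, b n * (-Real.sin (2 * Real.pi * n * t) * (2 * Real.pi * n * 1))) t := by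
    apply HasDerivAt.fun_sum
    intro n _
    exact (((hasDerivAt_id t).const_mul _).cos).const_mul _
  have h2 : HasDerivAt (fun t : ℝ => ∑ n ∈ B, b n * Real.sin (2 * Real.pi * n * t))
      (∑ n ∈ B, b n * (Real.cos (2 * Real.pi * n * t) * (2 * Real.pi * n * 1))) t := by
    apply HasDerivAt.fun_sum
    intro n _
    exact (((hasDerivAt_id t).const_mul _).sin).const_mul _
  have h3 := (h1.pow 2).add (h2.pow 2)
  have e1 : (∑ n ∈ B, b n * (-Real.sin (2 * Real.pi * n * t) * (2 * Real.pi * n * 1))) =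
      -∑ n ∈ B, (2 * Real.pi * n * b n) * Real.sin (2 * Real.pi * n * t) := by
    rw [← sum_neg_distrib]; exact sum_congr rfl fun n _ => by ring
  have e2 : (∑ n ∈ B, b n * (Real.cos (2 * Real.pi * n * t) * (2 * Real.pi * n * 1))) =
      ∑ n ∈ B, (2 * Real.pi * n * b n) * Real.cos (2 * Real.pi * n * t) := by
    exact sum_congr rfl fun n _ => by ring
  rw [e1, e2] at h3
  convert! h3 using 1
  simp

lemma tf_deriv_bound (B : Finset ℕ) (b : ℕ → ℝ) (t L : ℝ) (hL : 0 < L) :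
    |deriv (tf B b) t| ≤ L * tf B b t + L⁻¹ * tf B (fun n => 2 * Real.pi * n * b n) t := by
  rw [(tf_hasDerivAt B b t).deriv]
  unfold tf
  set c := ∑ n ∈ B, b n * Real.cos (2 * Real.pi * n * t)
  set d := ∑ n ∈ B, b n * Real.sin (2 * Real.pi * n * t)
  set c' := ∑ n ∈ B, (2 * Real.pi * n * b n) * Real.cos (2 * Real.pi * n * t)
  set d' := ∑ n ∈ B, (2 * Real.pi * n * b n) * Real.sin (2 * Real.pi * n * t)
  have hi : L * L⁻¹ = 1 := mul_inv_cancel₀ hL.ne'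
  have hi0 : 0 < L⁻¹ := by positivity
  have key : ∀ u v : ℝ, 2 * u * v ≤ L * u ^ 2 + L⁻¹ * v ^ 2 := by
    intro u v
    have : L * u ^ 2 + L⁻¹ * v ^ 2 - 2 * u * v = L⁻¹ * (L * u - v) ^ 2 := by
      field_simp; ring
    have h2 : 0 ≤ L⁻¹ * (L * u - v) ^ 2 := by positivity
    linarith
  rw [abs_le]
  constructor
  · have h1 := key c d'
    have h2 := key (-d) c'
    nlinarith
  · have h1 := key c (-d')
    have h2 := key d c'
    nlinarith

lemma tf_deriv_cont (B : Finset ℕ) (b : ℕ → ℝ) : Continuous (deriv (tf B b)) := by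
  have : deriv (tf B b) = fun t => _ := funext fun t => (tf_hasDerivAt B b t).deriv
  rw [this]; fun_prop

/-- Gallagher pointwise. -/
lemma gallagher_point (B : Finset ℕ) (b : ℕ → ℝ) (α h : ℝ) (hh : 0 < h) :
    tf B b α ≤ (2 * h)⁻¹ * (∫ t in (α - h)..(α + h), tf B b t) +
      ∫ t in (α - h)..(α + h), |deriv (tf B b) t| := by
  set I := ∫ t in (α - h)..(α + h), |deriv (tf B b) t| with hI
  have hint : ∀ a c : ℝ, IntervalIntegrable (fun t => |deriv (tf B b) t|) MeasureTheory.volume a c :=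
    fun a c => ((tf_deriv_cont B b).abs).intervalIntegrable a c
  have hpt : ∀ t ∈ Set.Icc (α - h) (α + h), tf B b α ≤ tf B b t + I := by
    intro t ht
    have hd : ∫ s in t..α, deriv (tf B b) s = tf B b α - tf B b t := by
      apply intervalIntegral.integral_deriv_eq_sub
      · intro s _; exact (tf_hasDerivAt B b s).differentiableAt
      · exact (tf_deriv_cont B b).intervalIntegrable _ _
    have h1 : |∫ s in t..α, deriv (tf B b) s| ≤ abs (∫ s in t..α, abs (deriv (tf B b) s)) :=
      by simpa only [Real.norm_eq_abs] using
        intervalIntegral.norm_integral_le_abs_integral_norm (f := deriv (tf B b)) (a := t) (b := α)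
          (μ := MeasureTheory.volume)
    have h2 : abs (∫ s in t..α, abs (deriv (tf B b) s)) ≤ |I| := by
      apply intervalIntegral.abs_integral_mono_interval
      · apply Set.uIoc_subset_uIoc_of_uIcc_subset_uIcc
        rw [Set.uIcc_of_le (by linarith : α - h ≤ α + h)]
        apply Set.uIcc_subset_Icc ht
        constructor <;> linarith
      · filter_upwards with s; positivity
      · exact hint _ _
    have h3 : 0 ≤ I := by
      apply intervalIntegral.integral_nonneg (by linarith)
      intro s _; positivity
    rw [abs_of_nonneg h3] at h2
    rw [hd] at h1
    have := le_abs_self (tf B b α - tf B b t)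
    linarith
  have hmono : ∫ t in (α - h)..(α + h), tf B b α ≤ ∫ t in (α - h)..(α + h), (tf B b t + I) := by
    apply intervalIntegral.integral_mono_on (by linarith)
    · simp
    · exact ((tf_cont B b).add continuous_const).intervalIntegrable _ _
    · exact hpt
  rw [intervalIntegral.integral_add ((tf_cont B b).intervalIntegrable _ _) (by simp)] at hmono
  simp only [intervalIntegral.integral_const, smul_eq_mul] at hmono
  rw [show α + h - (α - h) = 2 * h by ring] at hmono
  have h2h : 0 < 2 * h := by linarith
  rw [← mul_le_mul_iff_right₀ h2h, mul_add, ← mul_assoc, mul_inv_cancel₀ h2h.ne', one_mul]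
  exact hmono

lemma sum_integral_le {ι : Type*} (R : Finset ι) (α : ι → ℝ) (h : ℝ) (hh : 0 < h)
    (hsep : ∀ r ∈ R, ∀ s ∈ R, r ≠ s → 2 * h ≤ |α r - α s|)
    (h0 : ∀ r ∈ R, h ≤ α r) (h1 : ∀ r ∈ R, α r + h ≤ 1)
    (g : ℝ → ℝ) (hg : Continuous g) (hg0 : ∀ t, 0 ≤ g t) :
    ∑ r ∈ R, ∫ t in (α r - h)..(α r + h), g t ≤ ∫ t in (0 : ℝ)..1, g t := by
  have e : ∀ r ∈ R, ∫ t in (α r - h)..(α r + h), g t =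
      ∫ t in Set.Ioc (α r - h) (α r + h), g t := by
    intro r _
    rw [intervalIntegral.integral_of_le (by linarith)]
  rw [sum_congr rfl e, intervalIntegral.integral_of_le (by norm_num)]
  have hloc : ∀ a c : ℝ, MeasureTheory.IntegrableOn g (Set.Ioc a c) :=
    fun a c => hg.integrableOn_Ioc
  rw [← MeasureTheory.integral_biUnion_finset R (fun _ _ => measurableSet_Ioc)]
  · apply MeasureTheory.setIntegral_mono_set (hloc 0 1)
    · filter_upwards with t using hg0 t
    · apply Filter.Eventually.of_forall
      intro t ht
      obtain ⟨r, hr, ht⟩ := Set.mem_iUnion₂.1 ht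
      exact ⟨by linarith [ht.1, h0 r hr], by linarith [ht.2, h1 r hr]⟩
  · intro r hr s hs hrs
    rw [Function.onFun, Set.disjoint_left]
    intro t ht1 ht2
    have := hsep r hr s hs hrs
    have : |α r - α s| < 2 * h := by
      rw [abs_lt]; constructor <;> linarith [ht1.1, ht1.2, ht2.1, ht2.2]
    linarith
  · intro r _; exact hloc _ _

lemma large_sieve {ι : Type*} (R : Finset ι) (α : ι → ℝ) (h : ℝ) (hh : 0 < h)
    (hsep : ∀ r ∈ R, ∀ s ∈ R, r ≠ s → 2 * h ≤ |α r - α s|)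
    (h0 : ∀ r ∈ R, h ≤ α r) (h1 : ∀ r ∈ R, α r + h ≤ 1)
    (N : ℕ) (hN : 0 < N) (B : Finset ℕ) (hB : B ⊆ range N) (b : ℕ → ℝ) :
    ∑ r ∈ R, tf B b (α r) ≤ ((2 * h)⁻¹ + 13 * N) * ∑ n ∈ B, b n ^ 2 := by
  set L : ℝ := 2 * Real.pi * N with hL
  have hNr : (0 : ℝ) < N := by exact_mod_cast hN
  have hLp : 0 < L := by have := Real.pi_pos; positivity
  have s1 : ∑ r ∈ R, tf B b (α r) ≤ (2 * h)⁻¹ * (∫ t in (0 : ℝ)..1, tf B b t) +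
      ∫ t in (0 : ℝ)..1, |deriv (tf B b) t| := by
    calc _ ≤ ∑ r ∈ R, ((2 * h)⁻¹ * (∫ t in (α r - h)..(α r + h), tf B b t) +
        ∫ t in (α r - h)..(α r + h), |deriv (tf B b) t|) :=
          sum_le_sum fun r _ => gallagher_point B b (α r) h hh
      _ = (2 * h)⁻¹ * (∑ r ∈ R, ∫ t in (α r - h)..(α r + h), tf B b t) +
        ∑ r ∈ R, ∫ t in (α r - h)..(α r + h), |deriv (tf B b) t| := by
          rw [sum_add_distrib, mul_sum]
      _ ≤ _ := by
        gcongr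
        · exact sum_integral_le R α h hh hsep h0 h1 _ (tf_cont B b) (tf_nonneg B b)
        · exact sum_integral_le R α h hh hsep h0 h1 _ (tf_deriv_cont B b).abs
            (fun t => abs_nonneg _)
  have s2 : ∫ t in (0 : ℝ)..1, |deriv (tf B b) t| ≤
      ∫ t in (0 : ℝ)..1, (L * tf B b t + L⁻¹ * tf B (fun n => 2 * Real.pi * n * b n) t) := by
    apply intervalIntegral.integral_mono_on (by norm_num)
    · exact (tf_deriv_cont B b).abs.intervalIntegrable _ _
    · apply Continuous.intervalIntegrable
      have := tf_cont B b
      have := tf_cont B (fun n => 2 * Real.pi * n * b n)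
      fun_prop
    · intro t _; exact tf_deriv_bound B b t L hLp
  rw [intervalIntegral.integral_add
    (((tf_cont B b).const_mul _).intervalIntegrable _ _)
    (((tf_cont B _).const_mul _).intervalIntegrable _ _),
    intervalIntegral.integral_const_mul, intervalIntegral.integral_const_mul,
    tf_parseval, tf_parseval] at s2
  rw [tf_parseval] at s1
  have s3 : ∑ n ∈ B, (2 * Real.pi * n * b n) ^ 2 ≤ L ^ 2 * ∑ n ∈ B, b n ^ 2 := by
    rw [mul_sum]
    refine sum_le_sum fun n hn => ?_
    have hn' : (n : ℝ) ≤ N := by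
      have := mem_range.1 (hB hn); exact_mod_cast this.le
    rw [mul_pow]
    have := Real.pi_pos
    gcongr
    rw [hL]; gcongr
  have hS : 0 ≤ ∑ n ∈ B, b n ^ 2 := sum_nonneg fun _ _ => sq_nonneg _
  have s4 : L⁻¹ * ∑ n ∈ B, (2 * Real.pi * n * b n) ^ 2 ≤ L * ∑ n ∈ B, b n ^ 2 := by
    calc _ ≤ L⁻¹ * (L ^ 2 * ∑ n ∈ B, b n ^ 2) := by gcongr
      _ = _ := by field_simp
  have s5 : 2 * L ≤ 13 * N := by
    rw [hL]; nlinarith [Real.pi_lt_d2]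
  nlinarith

end SSP


namespace SSP
open Finset

lemma cos_sum (p : ℕ) (hp : 0 < p) (k : ℤ) :
    ∑ a ∈ range p, Real.cos (2 * Real.pi * k * (a / p)) = if (p : ℤ) ∣ k then (p : ℝ) else 0 := by
  have hpr : (p : ℝ) ≠ 0 := by positivity
  have hpc : (p : ℂ) ≠ 0 := by exact_mod_cast hp.ne'
  split_ifs with hk
  · obtain ⟨c, rfl⟩ := hk
    have : ∀ a ∈ range p, Real.cos (2 * Real.pi * ((p * c : ℤ) : ℝ) * (a / p)) = 1 := by
      intro a _
      rw [show 2 * Real.pi * ((p * c : ℤ) : ℝ) * (a / p) = ((c * a : ℤ) : ℝ) * (2 * Real.pi) by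
        push_cast; field_simp]
      exact Real.cos_int_mul_two_pi _
    rw [sum_congr rfl this]; simp
  · set z : ℂ := Complex.exp (2 * Real.pi * Complex.I * (k / p)) with hz
    have hzp : z ^ p = 1 := by
      rw [hz, ← Complex.exp_nat_mul, Complex.exp_eq_one_iff]
      exact ⟨k, by field_simp⟩
    have hz1 : z ≠ 1 := by
      intro h
      rw [hz, Complex.exp_eq_one_iff] at h
      obtain ⟨n, hn⟩ := h
      have hpi : (2 * Real.pi * Complex.I : ℂ) ≠ 0 := by simp [Real.pi_ne_zero]
      have h2 : (k : ℂ) / p = n := by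
        apply mul_left_cancel₀ hpi; rw [hn]; ring
      rw [div_eq_iff hpc] at h2
      apply hk
      refine ⟨n, ?_⟩
      have : k = n * p := by exact_mod_cast h2
      rw [this]; ring
    have hs : ∑ a ∈ range p, z ^ a = 0 := by
      have := geom_sum_mul z p
      rw [hzp, sub_self] at this
      exact (mul_eq_zero.1 this).resolve_right (sub_ne_zero.2 hz1)
    have hre : ∀ a ∈ range p, Real.cos (2 * Real.pi * k * (a / p)) = (z ^ a).re := by
      intro a _
      rw [hz, ← Complex.exp_nat_mul,
        show (a : ℂ) * (2 * Real.pi * Complex.I * (k / p)) =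
          ((2 * Real.pi * k * (a / p) : ℝ) : ℂ) * Complex.I by push_cast; ring,
        Complex.exp_ofReal_mul_I_re]
    rw [sum_congr rfl hre, ← Complex.re_sum, hs]; simp

noncomputable def Zc (p : ℕ) (B : Finset ℕ) (b : ℕ → ℝ) (h : ZMod p) : ℝ :=
  ∑ n ∈ B.filter (fun n : ℕ => (n : ZMod p) = h), b n

noncomputable def Vp (p : ℕ) [NeZero p] (B : Finset ℕ) (b : ℕ → ℝ) : ℝ :=
  ∑ h : ZMod p, Zc p B b h ^ 2 - (∑ n ∈ B, b n) ^ 2 / p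

lemma sum_Zc_sq (p : ℕ) [NeZero p] (B : Finset ℕ) (b : ℕ → ℝ) :
    ∑ h : ZMod p, Zc p B b h ^ 2 =
      ∑ m ∈ B, ∑ n ∈ B, if (m : ZMod p) = n then b m * b n else 0 := by
  have : ∀ h : ZMod p, Zc p B b h ^ 2 = ∑ m ∈ B, ∑ n ∈ B,
      if (m : ZMod p) = h then (if (n : ZMod p) = h then b m * b n else 0) else 0 := by
    intro h
    unfold Zc
    rw [sq, sum_filter, sum_mul_sum]
    refine sum_congr rfl fun m _ => sum_congr rfl fun n _ => ?_
    split_ifs <;> simp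
  simp_rw [this]
  rw [sum_comm]
  refine sum_congr rfl fun m _ => ?_
  rw [sum_comm]
  refine sum_congr rfl fun n _ => ?_
  rw [sum_ite_eq]
  simp [eq_comm]

lemma sum_tf_frac (p : ℕ) [NeZero p] (B : Finset ℕ) (b : ℕ → ℝ) :
    ∑ a ∈ range p, tf B b (a / p) = p * ∑ h : ZMod p, Zc p B b h ^ 2 := by
  have hp : 0 < p := Nat.pos_of_ne_zero (NeZero.ne p)
  simp_rw [tf_expand]
  rw [sum_comm, sum_Zc_sq, mul_sum]
  refine sum_congr rfl fun m _ => ?_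
  rw [sum_comm, mul_sum]
  refine sum_congr rfl fun n _ => ?_
  rw [← mul_sum]
  have := cos_sum p hp ((m : ℤ) - n)
  push_cast at this
  rw [this]
  have hiff : ((p : ℤ) ∣ (m : ℤ) - n) ↔ ((m : ZMod p) = n) := by
    rw [← ZMod.intCast_zmod_eq_zero_iff_dvd]; push_cast; rw [sub_eq_zero]
  simp only [hiff]
  split_ifs
  · ring
  · simp

lemma sum_tf_frac' (p : ℕ) [NeZero p] (B : Finset ℕ) (b : ℕ → ℝ) :
    ∑ a ∈ Ico 1 p, tf B b (a / p) = p * Vp p B b := by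
  have hp : 0 < p := Nat.pos_of_ne_zero (NeZero.ne p)
  have h := sum_tf_frac p B b
  rw [range_eq_Ico, sum_eq_sum_Ico_succ_bot hp] at h
  have h0 : tf B b ((0 : ℕ) / p) = (∑ n ∈ B, b n) ^ 2 := by simp [tf]
  rw [h0] at h
  unfold Vp
  have hpr : (p : ℝ) ≠ 0 := by positivity
  rw [mul_sub, mul_div_cancel₀ _ hpr]
  simp only [zero_add] at h
  linarith

lemma Vp_nonneg (p : ℕ) [NeZero p] (B : Finset ℕ) (b : ℕ → ℝ) : 0 ≤ Vp p B b := by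
  have h := sum_tf_frac' p B b
  have hp : (0 : ℝ) < p := by exact_mod_cast Nat.pos_of_ne_zero (NeZero.ne p)
  have h2 : 0 ≤ ∑ a ∈ Ico 1 p, tf B b (a / p) := sum_nonneg fun _ _ => tf_nonneg _ _ _
  rw [h] at h2
  exact nonneg_of_mul_nonneg_right h2 hp

/-- version without an instance argument -/
noncomputable def Vq (p : ℕ) (B : Finset ℕ) (b : ℕ → ℝ) : ℝ :=
  (∑ a ∈ Ico 1 p, tf B b (a / p)) / p

lemma Vq_eq (p : ℕ) [NeZero p] (B : Finset ℕ) (b : ℕ → ℝ) : Vq p B b = Vp p B b := by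
  have hpr : (p : ℝ) ≠ 0 := by exact_mod_cast NeZero.ne p
  unfold Vq; rw [sum_tf_frac']; field_simp

lemma frac_sep (Q p p' a a' : ℕ) (hp : p.Prime) (hp' : p'.Prime) (hpQ : p ≤ Q) (hpQ' : p' ≤ Q)
    (ha : 1 ≤ a) (hap : a < p) (hap' : a' < p') (hne : ¬ (p = p' ∧ a = a')) :
    1 / (Q : ℝ) ^ 2 ≤ |(a : ℝ) / p - a' / p'| := by
  have hp0 : (0 : ℝ) < p := by exact_mod_cast hp.pos
  have hp0' : (0 : ℝ) < p' := by exact_mod_cast hp'.pos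
  have hQ0 : (0 : ℝ) < Q := by
    have : (p : ℝ) ≤ Q := by exact_mod_cast hpQ
    linarith
  rw [div_sub_div _ _ hp0.ne' hp0'.ne', abs_div, abs_of_pos (mul_pos hp0 hp0')]
  have hint : (1 : ℝ) ≤ |(a : ℝ) * p' - p * a'| := by
    have : (1 : ℤ) ≤ |(a : ℤ) * p' - p * a'| := by
      apply Int.one_le_abs
      intro h
      have h1 : a * p' = p * a' := by
        have : (a : ℤ) * p' = p * a' := by linarith
        exact_mod_cast this
      apply hne
      have hd : p ∣ a * p' := ⟨a', h1⟩
      rcases (Nat.Prime.dvd_mul hp).1 hd with h2 | h2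
      · exact absurd (Nat.le_of_dvd (by omega) h2) (by omega)
      · have h3 := (Nat.prime_dvd_prime_iff_eq hp hp').1 h2
        refine ⟨h3, ?_⟩
        subst h3
        rw [mul_comm] at h1
        exact Nat.eq_of_mul_eq_mul_left hp.pos h1
    exact_mod_cast this
  have hQ1 : (p : ℝ) * p' ≤ (Q : ℝ) ^ 2 := by
    rw [sq]; gcongr
  calc 1 / (Q : ℝ) ^ 2 ≤ 1 / (p * p') := by gcongr
    _ ≤ _ := by gcongr

lemma large_sieve_primes (P : Finset ℕ) (Q : ℕ) (Q1 : ℝ) (hQ1 : 0 < Q1)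
    (hP : ∀ p ∈ P, p.Prime ∧ Q1 ≤ p ∧ p ≤ Q)
    (N : ℕ) (hN : 0 < N) (B : Finset ℕ) (hB : B ⊆ range N) (b : ℕ → ℝ) :
    ∑ p ∈ P, Vq p B b ≤ ((Q : ℝ) ^ 2 + 13 * N) / Q1 * ∑ n ∈ B, b n ^ 2 := by
  rcases P.eq_empty_or_nonempty with rfl | hPne
  · simp only [sum_empty]
    have : 0 ≤ ∑ n ∈ B, b n ^ 2 := sum_nonneg fun _ _ => sq_nonneg _
    positivity
  obtain ⟨p0, hp0⟩ := hPne
  have hQ : (1 : ℝ) ≤ Q := by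
    have := (hP p0 hp0).1.one_lt
    have h2 := (hP p0 hp0).2.2
    exact_mod_cast (by omega : 1 ≤ Q)
  set h : ℝ := 1 / (2 * (Q : ℝ) ^ 2) with hh
  have hhp : 0 < h := by positivity
  have h2h : 2 * h = 1 / (Q : ℝ) ^ 2 := by rw [hh]; field_simp
  have hhQ : h ≤ 1 / Q := by
    rw [hh]; gcongr; nlinarith
  have key := large_sieve (P.sigma fun p => Ico 1 p) (fun r => (r.2 : ℝ) / r.1) h hhp
    (by
      rintro ⟨p, a⟩ hr ⟨p', a'⟩ hs hrs
      simp only [mem_sigma, mem_Ico] at hr hs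
      rw [h2h]
      apply frac_sep Q p p' a a' (hP p hr.1).1 (hP p' hs.1).1 (hP p hr.1).2.2 (hP p' hs.1).2.2
        hr.2.1 hr.2.2 hs.2.2
      rintro ⟨rfl, rfl⟩
      exact hrs rfl)
    (by
      rintro ⟨p, a⟩ hr
      simp only [mem_sigma, mem_Ico] at hr
      refine hhQ.trans ?_
      have h1 : (1 : ℝ) ≤ a := by exact_mod_cast hr.2.1
      have h2 : (p : ℝ) ≤ Q := by exact_mod_cast (hP p hr.1).2.2
      have h3 : (0 : ℝ) < p := by exact_mod_cast (hP p hr.1).1.pos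
      gcongr)
    (by
      rintro ⟨p, a⟩ hr
      simp only [mem_sigma, mem_Ico] at hr
      have h1 : (a : ℝ) + 1 ≤ p := by exact_mod_cast hr.2.2
      have h2 : (p : ℝ) ≤ Q := by exact_mod_cast (hP p hr.1).2.2
      have h3 : (0 : ℝ) < p := by exact_mod_cast (hP p hr.1).1.pos
      have h4 : h ≤ 1 / p := hhQ.trans (by gcongr)
      calc (a : ℝ) / p + h ≤ a / p + 1 / p := by linarith
        _ = (a + 1) / p := by ring
        _ ≤ 1 := by rw [div_le_one h3]; exact h1)
    N hN B hB b
  rw [sum_sigma] at key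
  have hinv : (2 * h)⁻¹ = (Q : ℝ) ^ 2 := by rw [h2h]; simp
  rw [hinv] at key
  have : ∑ p ∈ P, Vq p B b ≤ (∑ p ∈ P, ∑ a ∈ Ico 1 p, tf B b (a / p)) / Q1 := by
    rw [sum_div]
    refine sum_le_sum fun p hp => ?_
    unfold Vq
    have : 0 ≤ ∑ a ∈ Ico 1 p, tf B b (a / p) := sum_nonneg fun _ _ => tf_nonneg _ _ _
    have := (hP p hp).2.1
    gcongr
  refine this.trans ?_
  rw [div_mul_eq_mul_div]
  gcongr

/-- the discrepancy weight -/
noncomputable def ep (p k : ℕ) : ℝ :=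
  (if (k : ZMod p) = 1 then 1 else 0) - (if (k : ZMod p) = 0 then 0 else 1) / ((p : ℝ) - 1)

lemma rect_p (p : ℕ) (hp : p.Prime) (A B : Finset ℕ) (a b : ℕ → ℝ) :
    |∑ m ∈ A, ∑ n ∈ B, a m * b n * ep p (m * n)| ≤ √(Vq p A a) * √(Vq p B b) := by
  have : Fact p.Prime := ⟨hp⟩
  rw [Vq_eq, Vq_eq]
  have hp1 : (0 : ℝ) < (p : ℝ) - 1 := by
    have : (1 : ℝ) < p := by exact_mod_cast hp.one_lt
    linarith
  have hp0 : (0 : ℝ) < p := by linarith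
  set H : Finset (ZMod p) := univ.erase 0 with hH
  have hHcard : (H.card : ℝ) = p - 1 := by
    rw [hH, card_erase_of_mem (mem_univ _), card_univ, ZMod.card, Nat.cast_sub hp.one_lt.le]; simp
  have hsum : ∀ (C : Finset ℕ) (c : ℕ → ℝ) (g : ZMod p → ℝ),
      ∑ n ∈ C, c n * g n = ∑ h : ZMod p, Zc p C c h * g h := by
    intro C c g
    unfold Zc
    rw [← sum_fiberwise C (fun n => (n : ZMod p))]
    refine sum_congr rfl fun h _ => ?_
    rw [sum_mul]
    refine sum_congr rfl fun n hn => ?_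
    rw [(mem_filter.1 hn).2]
  have htot : ∀ (C : Finset ℕ) (c : ℕ → ℝ), ∑ n ∈ C, c n = Zc p C c 0 + ∑ h ∈ H, Zc p C c h := by
    intro C c
    have := hsum C c (fun _ => 1)
    simp only [mul_one] at this
    rw [this, hH, add_sum_erase _ _ (mem_univ _)]
  set α := Zc p A a with hα
  set β := Zc p B b with hβ
  set SA := ∑ h ∈ H, α h with hSA
  set SB := ∑ h ∈ H, β h with hSB
  have hinvsum : ∀ f : ZMod p → ℝ, ∑ h ∈ H, f h⁻¹ = ∑ h ∈ H, f h := by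
    intro f
    apply sum_nbij' (fun h => h⁻¹) (fun h => h⁻¹)
    · intro h hh; simp only [hH, mem_erase, mem_univ, and_true] at hh ⊢; exact inv_ne_zero hh
    · intro h hh; simp only [hH, mem_erase, mem_univ, and_true] at hh ⊢; exact inv_ne_zero hh
    · simp
    · simp
    · simp
  -- main identity
  have hid : ∑ m ∈ A, ∑ n ∈ B, a m * b n * ep p (m * n) =
      ∑ h ∈ H, α h⁻¹ * β h - SA * SB / (p - 1) := by
    have e1 : ∑ m ∈ A, ∑ n ∈ B, a m * b n * ep p (m * n) =
        ∑ h : ZMod p, ∑ k : ZMod p, α h * β k *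
          ((if h * k = 1 then 1 else 0) - (if h * k = 0 then 0 else 1) / ((p : ℝ) - 1)) := by
      have : ∀ m ∈ A, ∑ n ∈ B, a m * b n * ep p (m * n) = a m *
          (fun h : ZMod p => ∑ k : ZMod p, β k *
          ((if h * k = 1 then 1 else 0) - (if h * k = 0 then 0 else 1) / ((p : ℝ) - 1))) m := by
        intro m _
        simp only
        rw [← hsum B b (fun k => ((if (m : ZMod p) * k = 1 then 1 else 0) -
          (if (m : ZMod p) * k = 0 then 0 else 1) / ((p : ℝ) - 1))), mul_sum]
        refine sum_congr rfl fun n _ => ?_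
        unfold ep; push_cast; ring
      rw [sum_congr rfl this, hsum A a (fun h : ZMod p => ∑ k : ZMod p, β k *
          ((if h * k = 1 then 1 else 0) - (if h * k = 0 then 0 else 1) / ((p : ℝ) - 1)))]
      refine sum_congr rfl fun h _ => ?_
      rw [mul_sum]
      exact sum_congr rfl fun k _ => by ring
    rw [e1, sum_comm, ← add_sum_erase _ _ (mem_univ (0 : ZMod p))]
    simp only [mul_zero, zero_ne_one, if_false, if_true, zero_div, sub_zero, sum_const_zero,
      zero_add]
    rw [← hH]
    have e2 : ∀ k ∈ H, ∑ h : ZMod p, α h * β k *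
          ((if h * k = 1 then 1 else 0) - (if h * k = 0 then 0 else 1) / ((p : ℝ) - 1)) =
          α k⁻¹ * β k - SA * β k / (p - 1) := by
      intro k hk
      have hk0 : k ≠ 0 := by simpa [hH] using hk
      rw [← add_sum_erase _ _ (mem_univ (0 : ZMod p)), ← hH]
      simp only [zero_mul, zero_ne_one, if_false, if_true, zero_div, sub_zero, mul_zero, zero_add]
      have e3 : ∀ h ∈ H, α h * β k *
          ((if h * k = 1 then 1 else 0) - (if h * k = 0 then 0 else 1) / ((p : ℝ) - 1)) =
          (if h = k⁻¹ then α h * β k else 0) - α h * (β k / (p - 1)) := by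
        intro h hh
        have hh0 : h ≠ 0 := by simpa [hH] using hh
        have : h * k = 1 ↔ h = k⁻¹ := by
          constructor
          · intro h1; exact eq_inv_of_mul_eq_one_left h1
          · rintro rfl; exact inv_mul_cancel₀ hk0
        simp only [this, mul_eq_zero, hh0, hk0, or_self, if_false]
        split_ifs <;> ring
      rw [sum_congr rfl e3, sum_sub_distrib, sum_ite_eq', ← sum_mul]
      have : k⁻¹ ∈ H := by simp [hH, hk0]
      rw [if_pos this]; ring
    rw [sum_congr rfl e2, sum_sub_distrib, ← sum_div, ← mul_sum]
  have hcent : ∑ h ∈ H, α h⁻¹ * β h - SA * SB / (p - 1) =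
      ∑ h ∈ H, (α h⁻¹ - SA / (p - 1)) * (β h - SB / (p - 1)) := by
    have : ∀ h ∈ H, (α h⁻¹ - SA / (p - 1)) * (β h - SB / (p - 1)) =
      α h⁻¹ * β h - α h⁻¹ * (SB / (p - 1)) - (SA / (p - 1)) * β h +
        (SA / (p - 1)) * (SB / (p - 1)) := fun h _ => by ring
    rw [sum_congr rfl this, sum_add_distrib, sum_sub_distrib, sum_sub_distrib, ← sum_mul,
      ← mul_sum, hinvsum α, sum_const, nsmul_eq_mul, hHcard, ← hSA, ← hSB]
    field_simp; ring
  have hvar : ∀ (C : Finset ℕ) (c : ℕ → ℝ), ∑ h ∈ H,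
      (Zc p C c h - (∑ h ∈ H, Zc p C c h) / (p - 1)) ^ 2 ≤ Vp p C c := by
    intro C c
    set S := ∑ h ∈ H, Zc p C c h with hS
    have : ∀ h ∈ H, (Zc p C c h - S / (p - 1)) ^ 2 =
      Zc p C c h ^ 2 - Zc p C c h * (2 * S / (p - 1)) + (S / (p - 1)) ^ 2 := fun h _ => by ring
    rw [sum_congr rfl this, sum_add_distrib, sum_sub_distrib, ← sum_mul, ← hS, sum_const,
      nsmul_eq_mul, hHcard]
    unfold Vp
    rw [htot C c, ← hS, ← add_sum_erase univ (fun h => Zc p C c h ^ 2) (mem_univ (0 : ZMod p)),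
      ← hH]
    set z := Zc p C c 0
    have h1 : (z + S) ^ 2 / p ≤ z ^ 2 + S ^ 2 / (p - 1) := by
      have : z ^ 2 + S ^ 2 / (p - 1) - (z + S) ^ 2 / p = ((p - 1) * z - S) ^ 2 / (p * (p - 1)) := by
        field_simp; ring
      have h2 : 0 ≤ ((p - 1) * z - S) ^ 2 / (p * (p - 1)) := by positivity
      linarith
    have h3 : S * (2 * S / (p - 1)) - ((p : ℝ) - 1) * (S / (p - 1)) ^ 2 = S ^ 2 / (p - 1) := by
      field_simp; ring
    linarith
  rw [hid, hcent, ← Real.sqrt_mul (Vp_nonneg p A a)]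
  apply Real.abs_le_sqrt
  refine (sum_mul_sq_le_sq_mul_sq H _ _).trans ?_
  rw [hinvsum (fun h => (α h - SA / (p - 1)) ^ 2)]
  gcongr
  · exact Vp_nonneg _ _ _
  · exact hvar A a
  · exact hvar B b

lemma rect (P : Finset ℕ) (Q : ℕ) (Q1 : ℝ) (hQ1 : 0 < Q1)
    (hP : ∀ p ∈ P, p.Prime ∧ Q1 ≤ p ∧ p ≤ Q)
    (M N : ℕ) (hM : 0 < M) (hN : 0 < N) (A B : Finset ℕ) (hA : A ⊆ range M) (hB : B ⊆ range N)
    (a b : ℕ → ℝ) :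
    ∑ p ∈ P, |∑ m ∈ A, ∑ n ∈ B, a m * b n * ep p (m * n)| ≤
      (√(((Q : ℝ) ^ 2 + 13 * M) * ((Q : ℝ) ^ 2 + 13 * N)) / Q1) *
        (√(∑ m ∈ A, a m ^ 2) * √(∑ n ∈ B, b n ^ 2)) := by
  have hV : ∀ p ∈ P, ∀ C c, 0 ≤ Vq p C c := by
    intro p hp C c
    have : Fact p.Prime := ⟨(hP p hp).1⟩
    rw [Vq_eq]; exact Vp_nonneg _ _ _
  calc _ ≤ ∑ p ∈ P, √(Vq p A a) * √(Vq p B b) :=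
        sum_le_sum fun p hp => rect_p p (hP p hp).1 A B a b
    _ ≤ √(∑ p ∈ P, √(Vq p A a) ^ 2) * √(∑ p ∈ P, √(Vq p B b) ^ 2) :=
        Real.sum_mul_le_sqrt_mul_sqrt _ _ _
    _ = √(∑ p ∈ P, Vq p A a) * √(∑ p ∈ P, Vq p B b) := by
        rw [sum_congr rfl fun p hp => Real.sq_sqrt (hV p hp A a),
          sum_congr rfl fun p hp => Real.sq_sqrt (hV p hp B b)]
    _ ≤ √(((Q : ℝ) ^ 2 + 13 * M) / Q1 * ∑ n ∈ A, a n ^ 2) *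
        √(((Q : ℝ) ^ 2 + 13 * N) / Q1 * ∑ n ∈ B, b n ^ 2) := by
        gcongr
        · exact large_sieve_primes P Q Q1 hQ1 hP M hM A hA a
        · exact large_sieve_primes P Q Q1 hQ1 hP N hN B hB b
    _ = _ := by
        rw [Real.sqrt_mul (by positivity), Real.sqrt_mul (by positivity),
          Real.sqrt_div (by positivity), Real.sqrt_div (by positivity),
          Real.sqrt_mul (by positivity)]
        have : √Q1 * √Q1 = Q1 := Real.mul_self_sqrt hQ1.le
        have hs : 0 < √Q1 := Real.sqrt_pos.2 hQ1
        conv_rhs => rw [← this]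
        field_simp

end SSP


namespace SSP
open Finset

lemma stair (P : Finset ℕ) (M N : ℕ) (K : ℝ) (hK : 0 ≤ K) (a b : ℕ → ℝ)
    (hR : ∀ A B : Finset ℕ, A ⊆ range M → B ⊆ range N →
      ∑ p ∈ P, |∑ m ∈ A, ∑ n ∈ B, a m * b n * ep p (m * n)| ≤
        K * (√(∑ m ∈ A, a m ^ 2) * √(∑ n ∈ B, b n ^ 2))) (J : ℕ) :
    ∀ (s : ℕ) (A : Finset ℕ) (z : ℕ → ℕ), A ⊆ range M → s + 2 ^ J ≤ N →
      (∀ m ∈ A, z m ≤ s + 2 ^ J) →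
      ∑ p ∈ P, |∑ m ∈ A, ∑ n ∈ Ico s (z m), a m * b n * ep p (m * n)| ≤
        (J + 1) * K * (√(∑ m ∈ A, a m ^ 2) * √(∑ n ∈ Ico s (s + 2 ^ J), b n ^ 2)) := by
  induction J with
  | zero =>
    intro s A z hA hs hz
    simp only [pow_zero] at hs hz ⊢
    have hsub : A.filter (fun m => z m = s + 1) ⊆ A := filter_subset _ _
    have e : ∀ p, ∑ m ∈ A, ∑ n ∈ Ico s (z m), a m * b n * ep p (m * n) =
        ∑ m ∈ A.filter (fun m => z m = s + 1), ∑ n ∈ Ico s (s + 1), a m * b n * ep p (m * n) := by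
      intro p
      rw [sum_filter]
      refine sum_congr rfl fun m hm => ?_
      split_ifs with h
      · rw [h]
      · rw [Ico_eq_empty (by have := hz m hm; omega), sum_empty]
    simp only [e]
    refine (hR _ _ (hsub.trans hA) ?_).trans ?_
    · intro n hn; simp only [mem_Ico, mem_range] at hn ⊢; omega
    · simp only [Nat.cast_zero, zero_add, one_mul]
      gcongr
  | succ J ih =>
    intro s A z hA hs hz
    have hpow : 2 ^ (J + 1) = 2 ^ J + 2 ^ J := by ring
    have hpos : 0 < 2 ^ J := by positivity
    rw [hpow] at hs hz ⊢
    set t := s + 2 ^ J with ht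
    set A1 := A.filter (fun m => z m ≤ t) with hA1
    set A2 := A.filter (fun m => ¬ z m ≤ t) with hA2
    have hA1s : A1 ⊆ A := filter_subset _ _
    have hA2s : A2 ⊆ A := filter_subset _ _
    have e : ∀ p, ∑ m ∈ A, ∑ n ∈ Ico s (z m), a m * b n * ep p (m * n) =
        ∑ m ∈ A1, ∑ n ∈ Ico s (z m), a m * b n * ep p (m * n) +
        (∑ m ∈ A2, ∑ n ∈ Ico s t, a m * b n * ep p (m * n) +
        ∑ m ∈ A2, ∑ n ∈ Ico t (z m), a m * b n * ep p (m * n)) := by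
      intro p
      rw [← sum_filter_add_sum_filter_not A (fun m => z m ≤ t), ← hA1, ← hA2, ← sum_add_distrib]
      congr 1
      refine sum_congr rfl fun m hm => ?_
      have hm2 := (mem_filter.1 hm).2
      rw [sum_Ico_consecutive]
      · omega
      · omega
    have i1 := ih s A1 z (hA1s.trans hA) (by omega) (fun m hm => (mem_filter.1 hm).2)
    have i2 := hR A2 (Ico s t) (hA2s.trans hA) (by
      intro n hn; simp only [mem_Ico, mem_range] at hn ⊢; omega)
    have i3 := ih t A2 z (hA2s.trans hA) (by omega) (fun m hm => by
      have := hz m (hA2s hm); omega)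
    have hb : ∑ n ∈ Ico s (s + (2 ^ J + 2 ^ J)), b n ^ 2 =
        ∑ n ∈ Ico s t, b n ^ 2 + ∑ n ∈ Ico t (t + 2 ^ J), b n ^ 2 := by
      rw [sum_Ico_consecutive _ (by omega) (by omega)]
      congr 2; omega
    have ha : ∑ m ∈ A, a m ^ 2 = ∑ m ∈ A1, a m ^ 2 + ∑ m ∈ A2, a m ^ 2 :=
      (sum_filter_add_sum_filter_not A (fun m => z m ≤ t) _).symm
    rw [hb, ha]
    have n1 : 0 ≤ ∑ m ∈ A1, a m ^ 2 := sum_nonneg fun _ _ => sq_nonneg _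
    have n2 : 0 ≤ ∑ m ∈ A2, a m ^ 2 := sum_nonneg fun _ _ => sq_nonneg _
    have n3 : 0 ≤ ∑ n ∈ Ico s t, b n ^ 2 := sum_nonneg fun _ _ => sq_nonneg _
    have n4 : 0 ≤ ∑ n ∈ Ico t (t + 2 ^ J), b n ^ 2 := sum_nonneg fun _ _ => sq_nonneg _
    rw [← ht] at i1
    set x1 := ∑ m ∈ A1, a m ^ 2
    set x2 := ∑ m ∈ A2, a m ^ 2
    set y1 := ∑ n ∈ Ico s t, b n ^ 2
    set y2 := ∑ n ∈ Ico t (t + 2 ^ J), b n ^ 2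
    have c1 : √x1 * √y1 + √x2 * √y2 ≤ √(x1 + x2) * √(y1 + y2) := by
      rw [← Real.sqrt_mul (add_nonneg n1 n2)]
      apply Real.le_sqrt_of_sq_le
      have q1 := Real.sq_sqrt n1
      have q2 := Real.sq_sqrt n2
      have q3 := Real.sq_sqrt n3
      have q4 := Real.sq_sqrt n4
      rw [← q1, ← q2, ← q3, ← q4]
      simp only [Real.sqrt_sq (Real.sqrt_nonneg _)]
      nlinarith [sq_nonneg (√x1 * √y2 - √x2 * √y1)]
    have c2 : √x2 * √y1 ≤ √(x1 + x2) * √(y1 + y2) := by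
      gcongr <;> linarith
    simp only [e]
    calc _ ≤ ∑ p ∈ P, (|∑ m ∈ A1, ∑ n ∈ Ico s (z m), a m * b n * ep p (m * n)| +
        (|∑ m ∈ A2, ∑ n ∈ Ico s t, a m * b n * ep p (m * n)| +
        |∑ m ∈ A2, ∑ n ∈ Ico t (z m), a m * b n * ep p (m * n)|)) := by
          refine sum_le_sum fun p _ => ?_
          refine (abs_add_le _ _).trans ?_
          gcongr
          exact abs_add_le _ _
      _ ≤ (J + 1) * K * (√x1 * √y1) + (K * (√x2 * √y1) + (J + 1) * K * (√x2 * √y2)) := by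
          rw [sum_add_distrib, sum_add_distrib]; gcongr
      _ = (J + 1) * K * (√x1 * √y1 + √x2 * √y2) + K * (√x2 * √y1) := by ring
      _ ≤ (J + 1) * K * (√(x1 + x2) * √(y1 + y2)) + K * (√(x1 + x2) * √(y1 + y2)) := by gcongr
      _ = _ := by push_cast; ring

lemma typeII (P : Finset ℕ) (Q : ℕ) (Q1 : ℝ) (hQ1 : 0 < Q1)
    (hP : ∀ p ∈ P, p.Prime ∧ Q1 ≤ p ∧ p ≤ Q) (X U : ℕ) (hU : 0 < U) (L : ℝ) (hL : 0 ≤ L)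
    (a b : ℕ → ℝ) (ha : ∀ m, |a m| ≤ 1) (ha0 : ∀ m ≤ U, a m = 0)
    (hb : ∀ n ≤ 2 * X, |b n| ≤ L) (hb0 : ∀ n ≤ U, b n = 0) :
    ∑ p ∈ P, |∑ m ∈ Ioc 0 X, ∑ n ∈ Ioc 0 (X / m), a m * b n * ep p (m * n)| ≤
      ((Nat.log 2 X : ℝ) + 2) ^ 2 * (L / Q1 *
        √(4 * X * ((Q : ℝ) ^ 4 + 78 * Q ^ 2 * (X / U) + 676 * X))) := by
  set ℓ := Nat.log 2 X with hℓ
  set T := L / Q1 * √(4 * X * ((Q : ℝ) ^ 4 + 78 * Q ^ 2 * (X / U) + 676 * X)) with hT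
  have hT0 : 0 ≤ T := by positivity
  set A : ℕ → Finset ℕ := fun i => (Ioc 0 X).filter (fun m => Nat.log 2 m = i) with hA
  have hmaps : ∀ m ∈ Ioc 0 X, Nat.log 2 m ∈ range (ℓ + 1) := by
    intro m hm
    rw [mem_range, Nat.lt_succ_iff]
    exact Nat.log_mono_right (mem_Ioc.1 hm).2
  have block : ∀ i ∈ range (ℓ + 1),
      ∑ p ∈ P, |∑ m ∈ A i, ∑ n ∈ Ioc 0 (X / m), a m * b n * ep p (m * n)| ≤ (ℓ + 2) * T := by
    intro i hi
    have hAm : ∀ m ∈ A i, 0 < m ∧ m ≤ X ∧ 2 ^ i ≤ m ∧ m < 2 ^ (i + 1) := by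
      intro m hm
      simp only [hA, mem_filter, mem_Ioc] at hm
      obtain ⟨⟨h1, h2⟩, h3⟩ := hm
      refine ⟨h1, h2, ?_, ?_⟩
      · rw [← h3]; exact Nat.pow_log_le_self 2 h1.ne'
      · rw [← h3]; exact Nat.lt_pow_succ_log_self (by norm_num) m
    have hz : ∀ m ∈ A i, X / m ≤ X / 2 ^ i := fun m hm =>
      Nat.div_le_div_left (hAm m hm).2.2.1 (by positivity)
    have triv : (∀ m ∈ A i, ∀ n ∈ Ioc 0 (X / m), a m * b n = 0) →
        ∑ p ∈ P, |∑ m ∈ A i, ∑ n ∈ Ioc 0 (X / m), a m * b n * ep p (m * n)| ≤ (ℓ + 2) * T := by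
      intro h
      rw [sum_eq_zero]
      · positivity
      · intro p _
        rw [abs_eq_zero]
        refine sum_eq_zero fun m hm => sum_eq_zero fun n hn => ?_
        rw [h m hm n hn, zero_mul]
    by_cases c1 : 2 ^ (i + 1) ≤ U
    · apply triv
      intro m hm n _
      rw [ha0 m (by have := (hAm m hm).2.2.2; omega), zero_mul]
    by_cases c2 : X / 2 ^ i ≤ U
    · apply triv
      intro m hm n hn
      rw [hb0 n (by have := hz m hm; have := (mem_Ioc.1 hn).2; omega), mul_zero]
    push Not at c1 c2
    set D := X / 2 ^ i with hD
    have hDpos : 0 < D := by omega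
    set J := Nat.log 2 D + 1 with hJ
    have hJ1 : D < 2 ^ J := Nat.lt_pow_succ_log_self (by norm_num) D
    have hJ2 : 2 ^ J ≤ 2 * D := by
      rw [hJ, pow_succ, mul_comm]
      exact Nat.mul_le_mul_left 2 (Nat.pow_log_le_self 2 hDpos.ne')
    have hDX : D ≤ X := Nat.div_le_self _ _
    have hJℓ : J ≤ ℓ + 1 := by
      rw [hJ]; exact Nat.succ_le_succ (Nat.log_mono_right hDX)
    have hDi : 2 ^ i * D ≤ X := Nat.mul_div_le X (2 ^ i)
    have hDir : (2 : ℝ) ^ i * D ≤ X := by exact_mod_cast hDi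
    have hUr : (0 : ℝ) < U := by exact_mod_cast hU
    -- sizes
    set M := 2 ^ (i + 1) with hM
    set N := 2 ^ J with hN
    have hMr : (M : ℝ) = 2 * 2 ^ i := by rw [hM]; push_cast; ring
    have hNr : (N : ℝ) ≤ 2 * D := by exact_mod_cast hJ2
    have hUD : (U : ℝ) ≤ D := by exact_mod_cast c2.le
    have hUM : (U : ℝ) ≤ M := by exact_mod_cast c1.le
    have hMN : (M : ℝ) * N ≤ 4 * X := by
      calc (M : ℝ) * N ≤ (2 * 2 ^ i) * (2 * D) := by rw [hMr]; gcongr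
        _ = 4 * (2 ^ i * D) := by ring
        _ ≤ _ := by gcongr
    have hM2 : (M : ℝ) ≤ 2 * (X / U) := by
      rw [mul_div_assoc', le_div_iff₀ hUr, hMr]
      calc (2 : ℝ) * 2 ^ i * U ≤ 2 * 2 ^ i * D := by gcongr
        _ ≤ _ := by linarith
    have hN2 : (N : ℝ) ≤ 4 * (X / U) := by
      rw [mul_div_assoc', le_div_iff₀ hUr]
      calc (N : ℝ) * U ≤ N * M := by gcongr
        _ ≤ _ := by linarith
    have hprod : ((Q : ℝ) ^ 2 + 13 * M) * ((Q : ℝ) ^ 2 + 13 * N) ≤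
        (Q : ℝ) ^ 4 + 78 * Q ^ 2 * (X / U) + 676 * X := by
      have : (Q : ℝ) ^ 2 * (M + N) ≤ Q ^ 2 * (6 * (X / U)) := by gcongr; linarith
      nlinarith
    have hAsub : A i ⊆ range M := by
      intro m hm; rw [mem_range]; exact (hAm m hm).2.2.2
    have hst := stair P M N
      (√(((Q : ℝ) ^ 2 + 13 * M) * ((Q : ℝ) ^ 2 + 13 * N)) / Q1) (by positivity) a b
      (fun A B hA hB => rect P Q Q1 hQ1 hP M N (by positivity) (by positivity) A B hA hB a b)
      J 0 (A i) (fun m => X / m + 1) hAsub (by omega)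
      (by intro m hm; have := hz m hm; simp only [zero_add]; omega)
    have hsumeq : ∀ p, ∑ m ∈ A i, ∑ n ∈ Ico 0 (X / m + 1), a m * b n * ep p (m * n) =
        ∑ m ∈ A i, ∑ n ∈ Ioc 0 (X / m), a m * b n * ep p (m * n) := by
      intro p
      refine sum_congr rfl fun m _ => ?_
      rw [sum_eq_sum_Ico_succ_bot (Nat.succ_pos _), hb0 0 (by omega)]
      simp only [mul_zero, zero_mul, zero_add]
      rfl
    simp only [hsumeq] at hst
    refine hst.trans ?_
    have sa : ∑ m ∈ A i, a m ^ 2 ≤ M := by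
      calc ∑ m ∈ A i, a m ^ 2 ≤ ∑ m ∈ range M, (1 : ℝ) := by
            refine (sum_le_sum_of_subset_of_nonneg hAsub fun _ _ _ => sq_nonneg _).trans ?_
            refine sum_le_sum fun m _ => ?_
            rw [← sq_abs]; have := ha m; have := abs_nonneg (a m); nlinarith
        _ = M := by simp
    have sb : ∑ n ∈ Ico 0 (0 + 2 ^ J), b n ^ 2 ≤ N * L ^ 2 := by
      calc ∑ n ∈ Ico 0 (0 + 2 ^ J), b n ^ 2 ≤ ∑ n ∈ Ico 0 (0 + 2 ^ J), L ^ 2 := by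
            refine sum_le_sum fun n hn => ?_
            rw [← sq_abs]
            have := hb n (by have := (mem_Ico.1 hn).2; omega)
            gcongr
        _ = N * L ^ 2 := by simp [hN]
    have hJr : (J : ℝ) + 1 ≤ ℓ + 2 := by
      have : (J : ℝ) ≤ ℓ + 1 := by exact_mod_cast hJℓ
      linarith
    calc _ ≤ ((ℓ : ℝ) + 2) * (√((Q : ℝ) ^ 4 + 78 * Q ^ 2 * (X / U) + 676 * X) / Q1) *
          (√(M : ℝ) * √(N * L ^ 2)) := by gcongr
      _ = ((ℓ : ℝ) + 2) * (L / Q1 * (√((Q : ℝ) ^ 4 + 78 * Q ^ 2 * (X / U) + 676 * X) *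
          √((M : ℝ) * N))) := by
          rw [Real.sqrt_mul (by positivity) (L ^ 2), Real.sqrt_sq hL,
            Real.sqrt_mul (by positivity) (N : ℝ)]
          ring
      _ ≤ ((ℓ : ℝ) + 2) * (L / Q1 * (√((Q : ℝ) ^ 4 + 78 * Q ^ 2 * (X / U) + 676 * X) *
          √(4 * X))) := by gcongr
      _ = _ := by
          rw [hT, Real.sqrt_mul (x := 4 * (X : ℝ)) (by positivity)]
          ring
  calc _ ≤ ∑ p ∈ P, ∑ i ∈ range (ℓ + 1),
        |∑ m ∈ A i, ∑ n ∈ Ioc 0 (X / m), a m * b n * ep p (m * n)| := by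
        refine sum_le_sum fun p _ => ?_
        rw [← sum_fiberwise_of_maps_to hmaps]
        exact abs_sum_le_sum_abs _ _
    _ = ∑ i ∈ range (ℓ + 1), ∑ p ∈ P,
        |∑ m ∈ A i, ∑ n ∈ Ioc 0 (X / m), a m * b n * ep p (m * n)| := sum_comm
    _ ≤ ∑ i ∈ range (ℓ + 1), (ℓ + 2) * T := sum_le_sum block
    _ = (ℓ + 1) * ((ℓ + 2) * T) := by simp
    _ ≤ (ℓ + 2) * ((ℓ + 2) * T) := by gcongr; linarith
    _ = _ := by ring

end SSP


namespace SSP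
open Finset

lemma ep_abs (p k : ℕ) (hp : p.Prime) : |ep p k| ≤ 1 := by
  have : Fact p.Prime := ⟨hp⟩
  have hp2 : (2 : ℝ) ≤ p := by exact_mod_cast hp.two_le
  have h1 : 0 ≤ 1 / ((p : ℝ) - 1) := by apply div_nonneg <;> linarith
  have h2 : 1 / ((p : ℝ) - 1) ≤ 1 := by rw [div_le_one] <;> linarith
  unfold ep
  split_ifs with c1 c2 c2
  · exact absurd (c1.symm.trans c2) one_ne_zero
  · rw [abs_le]; constructor <;> linarith
  · simp
  · rw [abs_le]; constructor <;> linarith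

lemma count_res (p K : ℕ) (hp : 0 < p) (v : ZMod p) :
    |(((Ioc 0 K).filter (fun k : ℕ => (k : ZMod p) = v)).card : ℝ) - K / p| ≤ 1 := by
  have : NeZero p := ⟨hp.ne'⟩
  have e : (Ioc 0 K).filter (fun k : ℕ => (k : ZMod p) = v) =
      (Ioc 0 K).filter (fun k : ℕ => k ≡ v.val [MOD p]) := by
    apply filter_congr
    intro k _
    rw [← ZMod.natCast_eq_natCast_iff, ZMod.natCast_zmod_val]
  rw [e]
  have h := Nat.Ioc_filter_modEq_card (a := 0) (b := K) (r := p) hp v.val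
  set c := ((Ioc 0 K).filter (fun k : ℕ => k ≡ v.val [MOD p])).card
  have hpq : (0 : ℚ) < p := by exact_mod_cast hp
  set x : ℚ := ((K : ℚ) - v.val) / p with hx
  set y : ℚ := (((0 : ℕ) : ℚ) - v.val) / p with hy
  have hxy : x - y = K / p := by rw [hx, hy]; field_simp; push_cast; ring
  have hKp : (0 : ℚ) ≤ K / p := by positivity
  have f1 := Int.floor_le x
  have f2 := Int.lt_floor_add_one x
  have f3 := Int.floor_le y
  have f4 := Int.lt_floor_add_one y
  have hq : |(c : ℚ) - K / p| ≤ 1 := by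
    have hc : (c : ℚ) = max ((⌊x⌋ : ℚ) - ⌊y⌋) 0 := by
      have := congrArg (fun z : ℤ => (z : ℚ)) h
      push_cast at this
      simpa using this
    rw [hc, abs_le]
    rcases max_cases ((⌊x⌋ : ℚ) - ⌊y⌋) 0 with ⟨h1, h2⟩ | ⟨h1, h2⟩ <;> rw [h1] <;>
      constructor <;> linarith
  have hr : |(((c : ℚ) - K / p : ℚ) : ℝ)| ≤ 1 := by exact_mod_cast hq
  push_cast at hr
  exact hr

lemma ep_sum (p : ℕ) (hp : p.Prime) (d K : ℕ) : |∑ k ∈ Ioc 0 K, ep p (d * k)| ≤ 2 := by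
  have : Fact p.Prime := ⟨hp⟩
  have hp2 : (2 : ℝ) ≤ p := by exact_mod_cast hp.two_le
  have hp1 : (0 : ℝ) < p - 1 := by linarith
  by_cases hd : (d : ZMod p) = 0
  · rw [sum_eq_zero]
    · simp
    · intro k _; unfold ep; push_cast; rw [hd]; simp
  · have e : ∑ k ∈ Ioc 0 K, ep p (d * k) =
        (((Ioc 0 K).filter (fun k : ℕ => (k : ZMod p) = (d : ZMod p)⁻¹)).card : ℝ) -
        ((K : ℝ) - ((Ioc 0 K).filter (fun k : ℕ => (k : ZMod p) = 0)).card) / (p - 1) := by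
      unfold ep
      rw [sum_sub_distrib, ← sum_div]
      congr 1
      · rw [card_filter]; push_cast
        refine sum_congr rfl fun k _ => ?_
        have : (d : ZMod p) * k = 1 ↔ (k : ZMod p) = (d : ZMod p)⁻¹ := by
          constructor
          · intro h1; exact eq_inv_of_mul_eq_one_right h1
          · intro h; rw [h]; exact mul_inv_cancel₀ hd
        simp only [this]
      · congr 1
        rw [card_filter]; push_cast
        have : (K : ℝ) = ∑ k ∈ Ioc 0 K, (1 : ℝ) := by simp
        rw [this, ← sum_sub_distrib]
        refine sum_congr rfl fun k _ => ?_
        simp only [mul_eq_zero, hd, false_or]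
        split_ifs <;> simp
    rw [e]
    have h1 := count_res p K hp.pos (d : ZMod p)⁻¹
    have h2 := count_res p K hp.pos 0
    set c1 := (((Ioc 0 K).filter (fun k : ℕ => (k : ZMod p) = (d : ZMod p)⁻¹)).card : ℝ)
    set c0 := (((Ioc 0 K).filter (fun k : ℕ => (k : ZMod p) = 0)).card : ℝ)
    have e2 : c1 - ((K : ℝ) - c0) / (p - 1) = (c1 - K / p) + (c0 - K / p) / (p - 1) := by
      field_simp; ring
    rw [e2]
    refine (abs_add_le _ _).trans ?_
    rw [abs_div, abs_of_pos hp1]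
    have : |c0 - K / p| / ((p : ℝ) - 1) ≤ 1 := by
      rw [div_le_one hp1]; linarith
    linarith

lemma abel_log (c : ℕ → ℝ) (hc : ∀ K, |∑ k ∈ Ioc 0 K, c k| ≤ 2) (K : ℕ) :
    |∑ k ∈ Ioc 0 K, Real.log k * c k| ≤ 4 * Real.log K := by
  have mono : ∀ K : ℕ, Real.log K ≤ Real.log ((K + 1 : ℕ) : ℝ) := by
    intro K
    rcases K.eq_zero_or_pos with rfl | h
    · simp
    · apply Real.log_le_log (by exact_mod_cast h); push_cast; linarith
  have h0 : ∀ K : ℕ, |∑ k ∈ Ioc 0 K, Real.log k * c k - Real.log K * ∑ k ∈ Ioc 0 K, c k| ≤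
      2 * Real.log K := by
    intro K
    induction K with
    | zero => simp
    | succ K ih =>
      rw [sum_Ioc_succ_top (by omega), sum_Ioc_succ_top (by omega)]
      have e : ∑ k ∈ Ioc 0 K, Real.log k * c k + Real.log ((K + 1 : ℕ) : ℝ) * c (K + 1) -
          Real.log ((K + 1 : ℕ) : ℝ) * (∑ k ∈ Ioc 0 K, c k + c (K + 1)) =
          (∑ k ∈ Ioc 0 K, Real.log k * c k - Real.log K * ∑ k ∈ Ioc 0 K, c k) +
          (Real.log K - Real.log ((K + 1 : ℕ) : ℝ)) * ∑ k ∈ Ioc 0 K, c k := by ring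
      rw [e]
      refine (abs_add_le _ _).trans ?_
      rw [abs_mul, abs_of_nonpos (show Real.log K - Real.log ((K + 1 : ℕ) : ℝ) ≤ 0 by linarith [mono K])]
      have := hc K
      have := mono K
      nlinarith [abs_nonneg (∑ k ∈ Ioc 0 K, c k)]
  have h1 := h0 K
  have h2 : |Real.log K * ∑ k ∈ Ioc 0 K, c k| ≤ 2 * Real.log K := by
    rw [abs_mul, abs_of_nonneg (Real.log_natCast_nonneg K)]
    nlinarith [hc K, Real.log_natCast_nonneg K]
  have := abs_add_le (∑ k ∈ Ioc 0 K, Real.log k * c k - Real.log K * ∑ k ∈ Ioc 0 K, c k)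
    (Real.log K * ∑ k ∈ Ioc 0 K, c k)
  rw [sub_add_cancel] at this
  linarith

open ArithmeticFunction in
lemma hyper (f g : ArithmeticFunction ℝ) (w : ℕ → ℝ) (X : ℕ) :
    ∑ n ∈ Ioc 0 X, (f * g) n * w n =
      ∑ m ∈ Ioc 0 X, ∑ n ∈ Ioc 0 (X / m), f m * g n * w (m * n) := by
  have e1 : ∑ n ∈ Ioc 0 X, (f * g) n * w n =
      ∑ x ∈ (Ioc 0 X ×ˢ Ioc 0 X).filter (fun x => x.1 * x.2 ≤ X),
        f x.1 * g x.2 * w (x.1 * x.2) := by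
    simp only [mul_apply]
    trans ∑ n ∈ Ioc 0 X, ∑ x ∈ (Ioc 0 X ×ˢ Ioc 0 X).filter (fun x => x.1 * x.2 = n),
      f x.1 * g x.2 * w (x.1 * x.2)
    · refine sum_congr rfl fun n hn ↦ ?_
      simp only [mem_Ioc] at hn
      rw [Nat.divisorsAntidiagonal_eq_prod_filter_of_le hn.1.ne' hn.2, sum_mul]
      refine sum_congr rfl fun x hx => ?_
      rw [(mem_filter.1 hx).2]
    · simp_rw [sum_filter]
      rw [sum_comm]
      exact sum_congr rfl fun _ _ ↦ (by simp_all)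
  rw [e1, sum_filter, sum_product]
  refine sum_congr rfl fun n hn ↦ ?_
  rw [← sum_filter]
  apply sum_congr _ (fun _ _ => rfl)
  ext m
  simp only [mem_filter, mem_Ioc] at hn ⊢
  rw [Nat.le_div_iff_mul_le hn.1, mul_comm m n]
  constructor
  · rintro ⟨⟨h1, h2⟩, h3⟩; exact ⟨h1, h3⟩
  · rintro ⟨h1, h3⟩
    exact ⟨⟨h1, le_trans (Nat.le_mul_of_pos_left m hn.1) h3⟩, h3⟩

open ArithmeticFunction

/-- truncation -/
noncomputable def trunc (f : ArithmeticFunction ℝ) (U : ℕ) : ArithmeticFunction ℝ :=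
  ⟨fun n => if n ≤ U then f n else 0, by simp⟩

lemma trunc_apply (f : ArithmeticFunction ℝ) (U n : ℕ) :
    trunc f U n = if n ≤ U then f n else 0 := rfl

noncomputable def muR : ArithmeticFunction ℝ := ((moebius : ArithmeticFunction ℤ) : ArithmeticFunction ℝ)

lemma muR_abs (n : ℕ) : |muR n| ≤ 1 := by
  unfold muR
  rw [intCoe_apply]
  have := abs_moebius_le_one (n := n)
  exact_mod_cast this

noncomputable def zR : ArithmeticFunction ℝ := ((zeta : ArithmeticFunction ℕ) : ArithmeticFunction ℝ)

lemma zR_apply (n : ℕ) (hn : n ≠ 0) : zR n = 1 := by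
  unfold zR; rw [natCoe_apply, zeta_apply_ne hn]; simp

lemma vaughan (U : ℕ) :
    vonMangoldt = trunc vonMangoldt U + trunc muR U * ArithmeticFunction.log
      - (trunc muR U * trunc vonMangoldt U) * zR
      + (muR - trunc muR U) * ((vonMangoldt - trunc vonMangoldt U) * zR) := by
  have h1 : muR * zR = 1 := coe_moebius_mul_coe_zeta
  have h2 : vonMangoldt * zR = ArithmeticFunction.log := vonMangoldt_mul_zeta
  rw [← h2]
  linear_combination (-(vonMangoldt - trunc vonMangoldt U)) * h1

lemma AFsub (f g : ArithmeticFunction ℝ) (n : ℕ) : (f - g) n = f n - g n := by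
  rw [sub_eq_add_neg, ArithmeticFunction.add_apply, sub_eq_add_neg]; rfl

lemma tail_nonneg (U n : ℕ) : 0 ≤ (vonMangoldt - trunc vonMangoldt U) n ∧
    (vonMangoldt - trunc vonMangoldt U) n ≤ vonMangoldt n := by
  rw [AFsub, trunc_apply]
  have := vonMangoldt_nonneg (n := n)
  split_ifs <;> constructor <;> linarith

lemma bcoef (U n : ℕ) : |((vonMangoldt - trunc vonMangoldt U) * zR) n| ≤ Real.log n := by
  unfold zR
  rw [coe_mul_zeta_apply, ← vonMangoldt_sum, abs_of_nonneg (sum_nonneg fun i _ => (tail_nonneg U i).1)]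
  exact sum_le_sum fun i _ => (tail_nonneg U i).2

lemma bcoef0 (U n : ℕ) (hn : n ≤ U) : ((vonMangoldt - trunc vonMangoldt U) * zR) n = 0 := by
  unfold zR
  rw [coe_mul_zeta_apply]
  refine sum_eq_zero fun i hi => ?_
  have := Nat.divisor_le hi
  rw [AFsub, trunc_apply, if_pos (by omega), sub_self]

lemma trunc_mu_abs (U n : ℕ) : |trunc muR U n| ≤ 1 := by
  rw [trunc_apply]; split_ifs
  · exact muR_abs n
  · simp

lemma trunc_L (U n : ℕ) : 0 ≤ trunc vonMangoldt U n ∧ trunc vonMangoldt U n ≤ vonMangoldt n := by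
  rw [trunc_apply]
  have := vonMangoldt_nonneg (n := n)
  split_ifs <;> constructor <;> linarith

lemma gcoef (U n : ℕ) : |(trunc muR U * trunc vonMangoldt U) n| ≤ Real.log n := by
  rw [mul_apply]
  refine (abs_sum_le_sum_abs _ _).trans ?_
  rw [← vonMangoldt_sum, ← Nat.sum_divisorsAntidiagonal' (fun _ j => vonMangoldt j)]
  refine sum_le_sum fun x _ => ?_
  rw [abs_mul, abs_of_nonneg (trunc_L U x.2).1]
  have := trunc_mu_abs U x.1
  have := trunc_L U x.2
  nlinarith [abs_nonneg (trunc muR U x.1)]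

lemma gcoef0 (U n : ℕ) (hn : U ^ 2 < n) : (trunc muR U * trunc vonMangoldt U) n = 0 := by
  rw [mul_apply]
  refine sum_eq_zero fun x hx => ?_
  rw [trunc_apply, trunc_apply]
  have := (Nat.mem_divisorsAntidiagonal.1 hx).1
  split_ifs with h1 h2
  · nlinarith
  all_goals simp

/-- Sum of bounded-support coefficients. -/
lemma supp_bound (F : ℕ → ℝ) (X W : ℕ) (c : ℝ) (hc : 0 ≤ c) (h0 : ∀ m, W < m → F m = 0)
    (h1 : ∀ m ∈ Ioc 0 X, |F m| ≤ c) : |∑ m ∈ Ioc 0 X, F m| ≤ W * c := by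
  have e : ∑ m ∈ Ioc 0 X, F m = ∑ m ∈ (Ioc 0 X).filter (fun m => m ≤ W), F m := by
    rw [sum_filter]
    refine sum_congr rfl fun m _ => ?_
    split_ifs with h
    · rfl
    · exact h0 m (by omega)
  rw [e]
  refine (abs_sum_le_sum_abs _ _).trans ?_
  calc _ ≤ ∑ m ∈ (Ioc 0 X).filter (fun m => m ≤ W), c :=
        sum_le_sum fun m hm => h1 m (mem_filter.1 hm).1
    _ = ((Ioc 0 X).filter (fun m => m ≤ W)).card * c := by simp
    _ ≤ W * c := by
      gcongr
      calc _ ≤ (Ioc 0 W).card := by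
            apply card_le_card
            intro m hm
            simp only [mem_filter, mem_Ioc] at hm ⊢
            omega
        _ = W := by simp

lemma bv_light (P : Finset ℕ) (Q : ℕ) (Q1 : ℝ) (hQ1 : 0 < Q1)
    (hP : ∀ p ∈ P, p.Prime ∧ Q1 ≤ p ∧ p ≤ Q) (X U : ℕ) (hU : 0 < U) (hX : 0 < X) :
    ∑ p ∈ P, |∑ n ∈ Ioc 0 X, vonMangoldt n * ep p n| ≤
      Q * (7 * (U : ℝ) ^ 2 * Real.log X) +
      ((Nat.log 2 X : ℝ) + 2) ^ 2 * (Real.log (2 * X) / Q1 *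
        √(4 * X * ((Q : ℝ) ^ 4 + 78 * Q ^ 2 * (X / U) + 676 * X))) := by
  have hlogX : 0 ≤ Real.log X := Real.log_natCast_nonneg X
  have hU1 : (1 : ℝ) ≤ U := by exact_mod_cast hU
  have loglem : ∀ m ∈ Ioc 0 X, Real.log m ≤ Real.log X := by
    intro m hm
    have := mem_Ioc.1 hm
    exact Real.log_le_log (by exact_mod_cast this.1) (by exact_mod_cast this.2)
  have t1 : ∀ p ∈ P, |∑ n ∈ Ioc 0 X, trunc vonMangoldt U n * ep p n| ≤ U * Real.log X := by
    intro p hp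
    apply supp_bound _ _ _ _ hlogX
    · intro m hm; rw [trunc_apply, if_neg (by omega), zero_mul]
    · intro m hm
      rw [abs_mul, abs_of_nonneg (trunc_L U m).1]
      have h1 := (trunc_L U m).2
      have h2 := vonMangoldt_le_log (n := m)
      have h3 := loglem m hm
      have h4 := ep_abs p m (hP p hp).1
      nlinarith [(trunc_L U m).1]
  have t2 : ∀ p ∈ P, |∑ n ∈ Ioc 0 X, (trunc muR U * ArithmeticFunction.log) n * ep p n| ≤
      U * (4 * Real.log X) := by
    intro p hp
    rw [hyper]
    apply supp_bound _ _ _ _ (by positivity)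
    · intro m hm
      refine sum_eq_zero fun n _ => ?_
      rw [trunc_apply, if_neg (by omega), zero_mul, zero_mul]
    · intro m hm
      have := mem_Ioc.1 hm
      have e : ∑ n ∈ Ioc 0 (X / m), trunc muR U m * ArithmeticFunction.log n * ep p (m * n) =
          trunc muR U m * ∑ n ∈ Ioc 0 (X / m), Real.log n * ep p (m * n) := by
        rw [mul_sum]
        refine sum_congr rfl fun n _ => ?_
        rw [ArithmeticFunction.log_apply]; ring
      rw [e, abs_mul]
      have h1 := abel_log (fun n => ep p (m * n)) (fun K => ep_sum p (hP p hp).1 m K) (X / m)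
      have h2 : Real.log ((X / m : ℕ) : ℝ) ≤ Real.log X := by
        rcases (X / m).eq_zero_or_pos with h | h
        · rw [h]; simpa using hlogX
        · apply Real.log_le_log (by exact_mod_cast h)
          exact_mod_cast Nat.div_le_self _ _
      have h3 := trunc_mu_abs U m
      nlinarith [abs_nonneg (trunc muR U m),
        abs_nonneg (∑ n ∈ Ioc 0 (X / m), Real.log n * ep p (m * n))]
  have t3 : ∀ p ∈ P, |∑ n ∈ Ioc 0 X, ((trunc muR U * trunc vonMangoldt U) * zR) n * ep p n| ≤
      (U ^ 2 : ℕ) * (2 * Real.log X) := by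
    intro p hp
    rw [hyper]
    apply supp_bound _ _ _ _ (by positivity)
    · intro m hm
      refine sum_eq_zero fun n _ => ?_
      rw [gcoef0 U m hm, zero_mul, zero_mul]
    · intro m hm
      have e : ∑ n ∈ Ioc 0 (X / m), (trunc muR U * trunc vonMangoldt U) m * zR n * ep p (m * n) =
          (trunc muR U * trunc vonMangoldt U) m * ∑ n ∈ Ioc 0 (X / m), ep p (m * n) := by
        rw [mul_sum]
        refine sum_congr rfl fun n hn => ?_
        rw [zR_apply n (by have := (mem_Ioc.1 hn).1; omega)]; ring
      rw [e, abs_mul]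
      have h1 := ep_sum p (hP p hp).1 m (X / m)
      have h2 := loglem m hm
      have h3 := gcoef U m
      calc _ ≤ Real.log X * 2 := by gcongr; linarith
        _ = _ := by ring
  have t4 := typeII P Q Q1 hQ1 hP X U hU (Real.log (2 * X))
    (Real.log_nonneg (by have : (1 : ℝ) ≤ X := by exact_mod_cast hX
                         linarith))
    (fun m => (muR - trunc muR U) m) (fun n => ((vonMangoldt - trunc vonMangoldt U) * zR) n)
    (by
      intro m
      simp only [AFsub, trunc_apply]
      split_ifs
      · simp
      · rw [sub_zero]; exact muR_abs m)
    (by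
      intro m hm
      simp only [AFsub, trunc_apply]
      rw [if_pos hm, sub_self])
    (by
      intro n hn
      refine (bcoef U n).trans ?_
      rcases n.eq_zero_or_pos with rfl | h
      · simp only [Nat.cast_zero, Real.log_zero]
        apply Real.log_nonneg
        have : (1 : ℝ) ≤ X := by exact_mod_cast hX
        linarith
      · apply Real.log_le_log (by exact_mod_cast h); exact_mod_cast hn)
    (fun n hn => bcoef0 U n hn)
  have hcard : (P.card : ℝ) ≤ Q := by
    have : P ⊆ Ioc 0 Q := by
      intro p hp; exact mem_Ioc.2 ⟨(hP p hp).1.pos, (hP p hp).2.2⟩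
    have := card_le_card this
    simp only [Nat.card_Ioc, tsub_zero] at this
    exact_mod_cast this
  have per : ∀ p ∈ P, |∑ n ∈ Ioc 0 X, vonMangoldt n * ep p n| ≤ 7 * (U : ℝ) ^ 2 * Real.log X +
      |∑ m ∈ Ioc 0 X, ∑ n ∈ Ioc 0 (X / m), (muR - trunc muR U) m *
        ((vonMangoldt - trunc vonMangoldt U) * zR) n * ep p (m * n)| := by
    intro p hp
    have e : ∑ n ∈ Ioc 0 X, vonMangoldt n * ep p n =
        ∑ n ∈ Ioc 0 X, trunc vonMangoldt U n * ep p n +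
        ∑ n ∈ Ioc 0 X, (trunc muR U * ArithmeticFunction.log) n * ep p n -
        ∑ n ∈ Ioc 0 X, ((trunc muR U * trunc vonMangoldt U) * zR) n * ep p n +
        ∑ m ∈ Ioc 0 X, ∑ n ∈ Ioc 0 (X / m), (muR - trunc muR U) m *
        ((vonMangoldt - trunc vonMangoldt U) * zR) n * ep p (m * n) := by
      rw [← hyper, ← sum_add_distrib, ← sum_sub_distrib, ← sum_add_distrib]
      refine sum_congr rfl fun n _ => ?_
      have := congrArg (fun f : ArithmeticFunction ℝ => f n) (vaughan U)
      simp only [ArithmeticFunction.add_apply, AFsub] at this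
      rw [this]; ring
    rw [e]
    refine (abs_add_le _ _).trans ?_
    gcongr
    refine (abs_sub _ _).trans ?_
    have := abs_add_le (∑ n ∈ Ioc 0 X, trunc vonMangoldt U n * ep p n)
      (∑ n ∈ Ioc 0 X, (trunc muR U * ArithmeticFunction.log) n * ep p n)
    have a1 := t1 p hp
    have a2 := t2 p hp
    have a3 := t3 p hp
    push_cast at a3
    have hUU : (U : ℝ) * Real.log X ≤ U ^ 2 * Real.log X := by gcongr; nlinarith
    linarith
  calc _ ≤ ∑ p ∈ P, (7 * (U : ℝ) ^ 2 * Real.log X +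
      |∑ m ∈ Ioc 0 X, ∑ n ∈ Ioc 0 (X / m), (muR - trunc muR U) m *
        ((vonMangoldt - trunc vonMangoldt U) * zR) n * ep p (m * n)|) := sum_le_sum per
    _ = P.card * (7 * (U : ℝ) ^ 2 * Real.log X) + _ := by
        rw [sum_add_distrib, sum_const, nsmul_eq_mul]
    _ ≤ _ := by gcongr

end SSP


namespace SSP
open Finset Filter Asymptotics

lemma theta_half : ∀ᶠ x : ℝ in atTop, x / 2 ≤ Chebyshev.theta x - Real.log x ∧
    0.65 * x ≤ Chebyshev.theta x := by
  have h1 := (isLittleO_log_rpow_atTop (r := 1/2) (by norm_num)).bound (c := 1/1000) (by norm_num)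
  filter_upwards [h1, eventually_ge_atTop 1000] with x h1 hx
  have hx0 : (0:ℝ) < x := by linarith
  have h := Chebyshev.theta_ge' (x := x) (by linarith)
  rw [← Real.sqrt_eq_rpow] at h1
  have hl : 0 ≤ Real.log x := Real.log_nonneg (by linarith)
  rw [Real.norm_of_nonneg hl, Real.norm_of_nonneg (Real.sqrt_nonneg _)] at h1
  have hs : √x * √x = x := Real.mul_self_sqrt hx0.le
  have hs1 : 1 ≤ √x := Real.one_le_sqrt.2 (by linarith)
  have h2 : Real.log (x + 2) ≤ Real.log x + 1 := by
    have : x + 2 ≤ x * Real.exp 1 := by nlinarith [Real.exp_one_gt_d9]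
    calc _ ≤ Real.log (x * Real.exp 1) := Real.log_le_log (by linarith) this
      _ = _ := by rw [Real.log_mul hx0.ne' (Real.exp_ne_zero _), Real.log_exp]
  have h3 := Real.log_two_gt_d9
  have h4 := Real.log_two_lt_d9
  have h5 : 2 * √x * Real.log x ≤ x / 500 := by nlinarith
  have h6 : Real.log x ≤ x / 1000 := by nlinarith
  constructor <;> nlinarith

lemma block : ∃ Q0 : ℝ, 1 ≤ Q0 ∧ ∀ Q, Q0 ≤ Q →
    Q ≤ Chebyshev.theta (5 * Q) - Chebyshev.theta Q := by
  obtain ⟨Q0, h⟩ := eventually_atTop.1 theta_half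
  refine ⟨max Q0 1, le_max_right _ _, fun Q hQ => ?_⟩
  have h1 := le_max_left Q0 1
  have h2 := le_max_right Q0 1
  have := (h (5 * Q) (by linarith)).2
  have h3 := Chebyshev.theta_le_log4_mul_x (x := Q) (by linarith)
  have h4 : Real.log 4 ≤ 1.4 := by
    rw [show (4:ℝ) = 2 ^ 2 by norm_num, Real.log_pow]
    have := Real.log_two_lt_d9
    push_cast; linarith
  nlinarith

noncomputable def Sl (z : ℝ) : ℝ := ∑ p ∈ (Ioc 0 ⌊z⌋₊).filter Nat.Prime, Real.log p / p

lemma Ioc_split (f : ℕ → ℝ) (a b : ℕ) (h : a ≤ b) :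
    ∑ p ∈ (Ioc 0 b).filter Nat.Prime, f p - ∑ p ∈ (Ioc 0 a).filter Nat.Prime, f p =
    ∑ p ∈ (Ioc a b).filter Nat.Prime, f p := by
  rw [sub_eq_iff_eq_add', ← sum_union]
  · rw [← filter_union, Ioc_union_Ioc_eq_Ioc (Nat.zero_le a) h]
  · rw [disjoint_left]; intro q h1 h2
    simp only [mem_filter, mem_Ioc] at h1 h2; omega

lemma Sl_block (Q : ℝ) (hQ : 0 < Q) (h : Q ≤ Chebyshev.theta (5 * Q) - Chebyshev.theta Q) :
    1 / 5 ≤ Sl (5 * Q) - Sl Q := by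
  unfold Sl
  unfold Chebyshev.theta at h
  have hf : ⌊Q⌋₊ ≤ ⌊5 * Q⌋₊ := Nat.floor_mono (by linarith)
  rw [Ioc_split _ _ _ hf] at h ⊢
  calc (1:ℝ) / 5 = Q / (5 * Q) := by field_simp
    _ ≤ (∑ p ∈ (Ioc ⌊Q⌋₊ ⌊5 * Q⌋₊).filter Nat.Prime, Real.log p) / (5 * Q) := by gcongr
    _ ≤ _ := by
      rw [sum_div]
      refine sum_le_sum fun p hp => ?_
      simp only [mem_filter, mem_Ioc] at hp
      have : (p : ℝ) ≤ 5 * Q := (Nat.le_floor_iff (by linarith)).1 hp.1.2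
      have h0 : (0 : ℝ) < p := by exact_mod_cast hp.2.pos
      have := Real.log_natCast_nonneg p
      gcongr

lemma mertens_light (α β : ℝ) (hα : 0 < α) (hαβ : α < β) :
    ∃ c0 : ℝ, 0 < c0 ∧ ∀ᶠ x : ℝ in atTop,
      c0 ≤ ∑ p ∈ (Ioc ⌊x ^ α⌋₊ ⌊x ^ β⌋₊).filter Nat.Prime, 1 / (p : ℝ) := by
  obtain ⟨Q0, hQ0, hb⟩ := block
  have l5 : 0 < Real.log 5 := Real.log_pos (by norm_num)
  have hβ : 0 < β := hα.trans hαβ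
  have hd : 0 < β - α := by linarith
  refine ⟨(β - α) / (10 * β * Real.log 5), by positivity, ?_⟩
  filter_upwards [(tendsto_rpow_atTop hα).eventually_ge_atTop Q0, eventually_gt_atTop 1,
    Real.tendsto_log_atTop.eventually_ge_atTop (2 * Real.log 5 / (β - α))] with x h1 hx h2
  have hx0 : 0 < x := by linarith
  have hL : 0 < Real.log x := Real.log_pos hx
  have ind : ∀ k : ℕ, (k : ℝ) / 5 ≤ Sl (5 ^ k * x ^ α) - Sl (x ^ α) := by
    intro k
    induction k with
    | zero => simp
    | succ k ih =>
      have h5 : (1 : ℝ) ≤ 5 ^ k := one_le_pow₀ (by norm_num)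
      have hp : Q0 ≤ 5 ^ k * x ^ α := by nlinarith
      have := Sl_block _ (by linarith) (hb _ hp)
      rw [pow_succ', mul_assoc]
      push_cast
      linarith
  set k := ⌊(β - α) * Real.log x / Real.log 5⌋₊ with hk
  have hk1 : (k : ℝ) ≤ (β - α) * Real.log x / Real.log 5 := Nat.floor_le (by positivity)
  have hk2 := Nat.lt_floor_add_one ((β - α) * Real.log x / Real.log 5)
  rw [← hk] at hk2
  have hkk : (5:ℝ) ^ k * x ^ α ≤ x ^ β := by
    rw [← Real.log_le_log_iff (by positivity) (by positivity),
      Real.log_mul (by positivity) (by positivity), Real.log_pow, Real.log_rpow hx0,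
      Real.log_rpow hx0]
    rw [le_div_iff₀ l5] at hk1
    linarith
  have mono : Sl (5 ^ k * x ^ α) ≤ Sl (x ^ β) := by
    unfold Sl
    apply sum_le_sum_of_subset_of_nonneg
    · exact filter_subset_filter _ (Ioc_subset_Ioc_right (Nat.floor_mono hkk))
    · intro p _ _; exact div_nonneg (Real.log_natCast_nonneg p) (by positivity)
  have h3 := ind k
  have hf : ⌊x ^ α⌋₊ ≤ ⌊x ^ β⌋₊ :=
    Nat.floor_mono (Real.rpow_le_rpow_of_exponent_le hx.le hαβ.le)
  have h4 : (k : ℝ) / 5 ≤ ∑ p ∈ (Ioc ⌊x ^ α⌋₊ ⌊x ^ β⌋₊).filter Nat.Prime, Real.log p / p := by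
    rw [← Ioc_split _ _ _ hf]
    unfold Sl at *
    linarith
  have h5 : ∑ p ∈ (Ioc ⌊x ^ α⌋₊ ⌊x ^ β⌋₊).filter Nat.Prime, Real.log p / p ≤
      (β * Real.log x) * ∑ p ∈ (Ioc ⌊x ^ α⌋₊ ⌊x ^ β⌋₊).filter Nat.Prime, 1 / (p : ℝ) := by
    rw [mul_sum]
    refine sum_le_sum fun p hp => ?_
    simp only [mem_filter, mem_Ioc] at hp
    have hpb : (p : ℝ) ≤ x ^ β := (Nat.le_floor_iff (by positivity)).1 hp.1.2
    have h0 : (0 : ℝ) < p := by exact_mod_cast hp.2.pos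
    have : Real.log p ≤ β * Real.log x := by
      rw [← Real.log_rpow hx0]; exact Real.log_le_log h0 hpb
    rw [mul_one_div]; gcongr
  rw [div_le_iff₀ hd] at h2
  have h6 : (β - α) * Real.log x / Real.log 5 / 2 ≤ k := by
    have : 2 ≤ (β - α) * Real.log x / Real.log 5 := by
      rw [le_div_iff₀ l5]; linarith
    linarith
  have hbl : 0 < β * Real.log x := by positivity
  have h7 : (β - α) * Real.log x / Real.log 5 / 10 ≤
      (β * Real.log x) * ∑ p ∈ (Ioc ⌊x ^ α⌋₊ ⌊x ^ β⌋₊).filter Nat.Prime, 1 / (p : ℝ) := by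
    linarith
  rw [← div_le_iff₀' hbl] at h7
  refine le_trans (le_of_eq ?_) h7
  field_simp

set_option maxHeartbeats 1000000 in
lemma error_bound (ε δ : ℝ) (hε : 0 < ε) (hε2 : ε ≤ 1 / 20) (hδ : 0 < δ) :
    ∀ᶠ x : ℝ in atTop,
      ∑ p ∈ (Ioc ⌊x ^ (1 / 2 - 3 / 2 * ε)⌋₊ ⌊x ^ (1 / 2 - ε)⌋₊).filter Nat.Prime,
        |∑ n ∈ Ioc 0 ⌊x⌋₊, ArithmeticFunction.vonMangoldt n * ep p n| ≤ δ * x := by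
  have hη : 0 < ε / 2 / 3 := by linarith
  have hlo := (isLittleO_log_rpow_atTop hη).bound
    (c := min 1 (δ / 1863)) (by positivity)
  filter_upwards [hlo, eventually_ge_atTop 3] with x h1 hx
  have hx0 : 0 < x := by linarith
  have hL1 : 1 ≤ Real.log x := by
    rw [Real.le_log_iff_exp_le hx0]; linarith [Real.exp_one_lt_d9]
  set L := Real.log x with hL
  rw [Real.norm_of_nonneg (by linarith), Real.norm_of_nonneg (by positivity)] at h1
  set c := min 1 (δ / 1863) with hc
  have hc0 : 0 < c := by positivity
  have hc1 : c ≤ 1 := min_le_left _ _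
  have hc2 : c ≤ δ / 1863 := min_le_right _ _
  have hL3 : L ^ 3 ≤ δ / 1863 * x ^ (ε / 2) := by
    calc L ^ 3 ≤ (c * x ^ (ε / 2 / 3)) ^ 3 := by gcongr
      _ = c ^ 3 * x ^ (ε / 2) := by
        rw [mul_pow, ← Real.rpow_natCast (x ^ _), ← Real.rpow_mul hx0.le]; norm_num
      _ ≤ _ := by
        gcongr
        calc c ^ 3 ≤ c ^ 1 := pow_le_pow_of_le_one hc0.le hc1 (by norm_num)
          _ ≤ _ := by rw [pow_one]; exact hc2
  set α := 1 / 2 - 3 / 2 * ε with hα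
  set β := 1 / 2 - ε with hβ
  set Q := ⌊x ^ β⌋₊ with hQ
  set X := ⌊x⌋₊ with hX
  set U := ⌊x ^ (1 / 10 : ℝ)⌋₊ with hU
  have hx1 : 1 ≤ x := by linarith
  have hXp : 0 < X := Nat.floor_pos.2 hx1
  have hu1 : 1 ≤ x ^ (1 / 10 : ℝ) := Real.one_le_rpow hx1 (by norm_num)
  have hUp : 0 < U := Nat.floor_pos.2 hu1
  have hXx : (X : ℝ) ≤ x := Nat.floor_le hx0.le
  have hX1 : (1 : ℝ) ≤ X := by exact_mod_cast hXp
  have hU1 : (1 : ℝ) ≤ U := by exact_mod_cast hUp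
  have hUx : (U : ℝ) ≤ x ^ (1 / 10 : ℝ) := Nat.floor_le (by positivity)
  have hUx2 : x ^ (1 / 10 : ℝ) / 2 ≤ U := by
    have := Nat.lt_floor_add_one (x ^ (1 / 10 : ℝ))
    rw [← hU] at this
    linarith
  have hQx : (Q : ℝ) ≤ x ^ β := Nat.floor_le (by positivity)
  have bv := bv_light ((Ioc ⌊x ^ α⌋₊ Q).filter Nat.Prime) Q (x ^ α) (by positivity)
    (by
      intro p hp
      simp only [mem_filter, mem_Ioc] at hp
      exact ⟨hp.2, (Nat.lt_of_floor_lt hp.1.1).le, hp.1.2⟩) X U hUp hXp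
  refine bv.trans ?_
  have hlX : Real.log X ≤ L := Real.log_le_log (by linarith) hXx
  have hlX0 : 0 ≤ Real.log X := Real.log_nonneg hX1
  have e1 : (Q : ℝ) * (7 * (U : ℝ) ^ 2 * Real.log X) ≤ 7 * (L ^ 3 * x ^ (1 - ε / 2)) := by
    calc (Q : ℝ) * (7 * (U : ℝ) ^ 2 * Real.log X) ≤
        x ^ β * (7 * (x ^ (1 / 10 : ℝ)) ^ 2 * L) := by gcongr
      _ = 7 * (L ^ 1 * x ^ (β + 1 / 5)) := by
        rw [← Real.rpow_natCast (x ^ (1 / 10 : ℝ)), ← Real.rpow_mul hx0.le, Real.rpow_add hx0]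
        norm_num; ring
      _ ≤ _ := by
        have b1 : L ^ 1 ≤ L ^ 3 := pow_le_pow_right₀ hL1 (by norm_num)
        have b2 : x ^ (β + 1 / 5) ≤ x ^ (1 - ε / 2) :=
          Real.rpow_le_rpow_of_exponent_le hx1 (by rw [hβ]; linarith)
        have : 0 ≤ L ^ 3 := by positivity
        exact mul_le_mul_of_nonneg_left (mul_le_mul b1 b2 (by positivity) this) (by norm_num)
  have e2 : (Nat.log 2 X : ℝ) + 2 ≤ 4 * L := by
    have : (Nat.log 2 X : ℝ) ≤ Real.logb 2 X := by
      rw [← Real.natFloor_logb_natCast]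
      exact Nat.floor_le (Real.logb_nonneg (by norm_num) hX1)
    have h2 : Real.logb 2 X ≤ 2 * L := by
      unfold Real.logb
      rw [div_le_iff₀ (Real.log_pos (by norm_num))]
      have := Real.log_two_gt_d9
      push_cast
      nlinarith
    linarith
  have e3 : Real.log (2 * X) ≤ 2 * L := by
    rw [Real.log_mul (by norm_num) (by linarith)]
    have := Real.log_two_lt_d9
    linarith
  have e4 : √(4 * X * ((Q : ℝ) ^ 4 + 78 * Q ^ 2 * (X / U) + 676 * X)) ≤
      58 * x ^ (α + 1 - ε / 2) := by
    rw [Real.sqrt_le_left (by positivity)]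
    have hg : (x ^ (α + 1 - ε / 2)) ^ 2 = x * x ^ (2 * α + 1 - ε) := by
      rw [← Real.rpow_natCast, ← Real.rpow_mul hx0.le, ← Real.rpow_one_add' hx0.le]
      · congr 1; push_cast; ring
      · rw [hα]; apply ne_of_gt; linarith
    rw [mul_pow, hg]
    have a1 : (Q : ℝ) ^ 4 ≤ x ^ (2 * α + 1 - ε) := by
      calc (Q : ℝ) ^ 4 ≤ (x ^ β) ^ 4 := by gcongr
        _ = x ^ (β * 4) := by rw [← Real.rpow_natCast, ← Real.rpow_mul hx0.le]; norm_num
        _ ≤ _ := Real.rpow_le_rpow_of_exponent_le hx1 (by rw [hα, hβ]; linarith)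
    have a2 : (Q : ℝ) ^ 2 * (X / U) ≤ 2 * x ^ (2 * α + 1 - ε) := by
      calc (Q : ℝ) ^ 2 * (X / U) ≤ (x ^ β) ^ 2 * (x / (x ^ (1 / 10 : ℝ) / 2)) := by gcongr
        _ = 2 * x ^ (β * 2 + 1 - 1 / 10) := by
          rw [← Real.rpow_natCast (x ^ β), ← Real.rpow_mul hx0.le, Real.rpow_sub hx0,
            Real.rpow_add hx0, Real.rpow_one]
          push_cast
          field_simp
        _ ≤ _ := by
          have : x ^ (β * 2 + 1 - 1 / 10) ≤ x ^ (2 * α + 1 - ε) :=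
            Real.rpow_le_rpow_of_exponent_le hx1 (by rw [hα, hβ]; linarith)
          linarith
    have a3 : (X : ℝ) ≤ x ^ (2 * α + 1 - ε) := by
      calc (X : ℝ) ≤ x ^ (1 : ℝ) := by rw [Real.rpow_one]; exact hXx
        _ ≤ _ := Real.rpow_le_rpow_of_exponent_le hx1 (by rw [hα]; linarith)
    set T := x ^ (2 * α + 1 - ε)
    have hT : 0 ≤ T := by positivity
    calc _ ≤ 4 * x * (T + 78 * (2 * T) + 676 * T) := by
          rw [mul_assoc 78]; gcongr
      _ ≤ 58 ^ 2 * (x * T) := by nlinarith [mul_nonneg hx0.le hT]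
  have e5 : 0 ≤ Real.log (2 * X) := Real.log_nonneg (by linarith)
  calc _ ≤ 7 * (L ^ 3 * x ^ (1 - ε / 2)) + (4 * L) ^ 2 * (2 * L / x ^ α *
        (58 * x ^ (α + 1 - ε / 2))) := by
        gcongr
    _ = 1863 * (L ^ 3 * x ^ (1 - ε / 2)) := by
        rw [show α + 1 - ε / 2 = α + (1 - ε / 2) by ring, Real.rpow_add hx0 α]
        have hne : x ^ α ≠ 0 := by positivity
        generalize x ^ α = A at hne
        generalize x ^ (1 - ε / 2) = B
        have : 2 * L / A * (58 * (A * B)) = 116 * L * B := by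
          field_simp; ring
        rw [this]; ring
    _ ≤ 1863 * (δ / 1863 * x ^ (ε / 2) * x ^ (1 - ε / 2)) := by gcongr
    _ = δ * x := by
        rw [mul_assoc (δ / 1863), ← Real.rpow_add hx0]
        rw [show ε / 2 + (1 - ε / 2) = 1 by ring, Real.rpow_one]; ring

end SSP


namespace SSP
open Finset Filter Asymptotics

lemma omega_le (x α : ℝ) (hx : 1 < x) (hα : 1 < 4 * α) (P : Finset ℕ)
    (hP : ∀ p ∈ P, p.Prime ∧ x ^ α < p) (n : ℕ) (hn : 2 ≤ n) (hnx : (n : ℝ) ≤ x) :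
    ((P.filter (fun p => (n : ZMod p) = 1)).card : ℝ) ≤ 3 := by
  set R := P.filter (fun p => (n : ZMod p) = 1) with hR
  have hdvd : ∀ p ∈ R, p ∣ n - 1 := by
    intro p hp
    rw [← ZMod.natCast_eq_zero_iff, Nat.cast_sub (by omega), (mem_filter.1 hp).2]; simp
  have h1 : ∏ p ∈ R, p ∣ n - 1 :=
    Finset.prod_primes_dvd _ (fun p hp => (hP p (mem_filter.1 hp).1).1.prime) hdvd
  have h2 : ∏ p ∈ R, p ≤ n - 1 := Nat.le_of_dvd (by omega) h1
  have h3 : ((∏ p ∈ R, p : ℕ) : ℝ) ≤ x := by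
    refine le_trans ?_ hnx
    exact_mod_cast h2.trans (Nat.sub_le _ _)
  have h4 : (x ^ α) ^ R.card ≤ ((∏ p ∈ R, p : ℕ) : ℝ) := by
    push_cast
    rw [← Finset.prod_const]
    apply Finset.prod_le_prod
    · intro i _; positivity
    · intro p hp; exact (hP p (mem_filter.1 hp).1).2.le
  by_contra hc
  push Not at hc
  have hc4 : 4 ≤ R.card := by
    have : 3 < R.card := by exact_mod_cast hc
    omega
  have hx0 : 0 < x := by linarith
  have h5 : x < x := by
    calc x = x ^ (1 : ℝ) := (Real.rpow_one x).symm
      _ < x ^ (α * 4) := Real.rpow_lt_rpow_of_exponent_lt hx (by linarith)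
      _ = (x ^ α) ^ 4 := by
        rw [← Real.rpow_natCast (x ^ α), ← Real.rpow_mul hx0.le]; norm_num
      _ ≤ (x ^ α) ^ R.card :=
        pow_le_pow_right₀ (Real.one_le_rpow hx.le (by linarith)) hc4
      _ ≤ x := h4.trans h3
  exact lt_irrefl _ h5

open ArithmeticFunction in
lemma lower (x E : ℝ) (hx : 1 < x) (P : Finset ℕ) (hP : ∀ p ∈ P, p.Prime ∧ (p : ℝ) ≤ x)
    (hE : ∑ p ∈ P, |∑ n ∈ Ioc 0 ⌊x⌋₊, vonMangoldt n * ep p n| ≤ E)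
    (hth : 0 ≤ Chebyshev.theta x - Real.log x) :
    (∑ p ∈ P, 1 / (p : ℝ)) * (Chebyshev.theta x - Real.log x) ≤
      E + ∑ p ∈ P, ∑ n ∈ Ioc 0 ⌊x⌋₊, if (n : ZMod p) = 1 then vonMangoldt n else 0 := by
  rw [← sub_le_iff_le_add]
  have key : ∀ p ∈ P, 1 / (p : ℝ) * (Chebyshev.theta x - Real.log x) ≤
      |∑ n ∈ Ioc 0 ⌊x⌋₊, vonMangoldt n * ep p n| +
      ∑ n ∈ Ioc 0 ⌊x⌋₊, if (n : ZMod p) = 1 then vonMangoldt n else 0 := by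
    intro p hp
    have hpp := (hP p hp).1
    have hp2 : (2 : ℝ) ≤ p := by exact_mod_cast hpp.two_le
    have e : ∑ n ∈ Ioc 0 ⌊x⌋₊, vonMangoldt n * ep p n =
        (∑ n ∈ Ioc 0 ⌊x⌋₊, if (n : ZMod p) = 1 then vonMangoldt n else 0) -
        (∑ n ∈ Ioc 0 ⌊x⌋₊, if (n : ZMod p) = 0 then 0 else vonMangoldt n) / ((p : ℝ) - 1) := by
      rw [sum_div, ← sum_sub_distrib]
      refine sum_congr rfl fun n _ => ?_
      unfold ep
      split_ifs <;> ring
    have h1 : Chebyshev.theta x - Real.log x ≤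
        ∑ n ∈ Ioc 0 ⌊x⌋₊, if (n : ZMod p) = 0 then 0 else vonMangoldt n := by
      have hmem : p ∈ (Ioc 0 ⌊x⌋₊).filter Nat.Prime := by
        simp only [mem_filter, mem_Ioc]
        exact ⟨⟨hpp.pos, Nat.le_floor (hP p hp).2⟩, hpp⟩
      unfold Chebyshev.theta
      rw [← Finset.sum_erase_add _ _ hmem]
      have : Real.log p ≤ Real.log x := Real.log_le_log (by linarith) (hP p hp).2
      have : ∑ q ∈ ((Ioc 0 ⌊x⌋₊).filter Nat.Prime).erase p, Real.log q ≤
          ∑ n ∈ Ioc 0 ⌊x⌋₊, if (n : ZMod p) = 0 then 0 else vonMangoldt n := by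
        calc _ = ∑ q ∈ ((Ioc 0 ⌊x⌋₊).filter Nat.Prime).erase p,
              if (q : ZMod p) = 0 then 0 else vonMangoldt q := by
              refine sum_congr rfl fun q hq => ?_
              simp only [mem_erase, mem_filter] at hq
              rw [if_neg, vonMangoldt_apply_prime hq.2.2]
              rw [ZMod.natCast_eq_zero_iff, Nat.prime_dvd_prime_iff_eq hpp hq.2.2]
              exact fun h => hq.1 h.symm
          _ ≤ _ := by
              apply sum_le_sum_of_subset_of_nonneg
              · exact (erase_subset _ _).trans (filter_subset _ _)
              · intro q _ _
                split_ifs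
                · exact le_rfl
                · exact vonMangoldt_nonneg
      linarith
    have h2 : 1 / (p : ℝ) * (Chebyshev.theta x - Real.log x) ≤
        (∑ n ∈ Ioc 0 ⌊x⌋₊, if (n : ZMod p) = 0 then 0 else vonMangoldt n) / ((p : ℝ) - 1) := by
      rw [one_div_mul_eq_div]
      apply div_le_div₀ (hth.trans h1) h1 <;> linarith
    have h3 := neg_abs_le (∑ n ∈ Ioc 0 ⌊x⌋₊, vonMangoldt n * ep p n)
    linarith
  have := sum_le_sum key
  rw [sum_add_distrib, ← sum_mul] at this
  linarith

open ArithmeticFunction in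
lemma upper (x z α : ℝ) (hx : 1 < x) (hz : 0 ≤ z) (hzx : z ≤ x) (hα : 1 < 4 * α) (P : Finset ℕ)
    (hP : ∀ p ∈ P, p.Prime ∧ x ^ α < p) :
    ∑ p ∈ P, ∑ n ∈ Ioc 0 ⌊x⌋₊, (if (n : ZMod p) = 1 then vonMangoldt n else 0) ≤
      3 * (Chebyshev.psi x - Chebyshev.theta x) + 3 * Chebyshev.theta z + 3 * Real.log x *
        ((Ioc 0 ⌊x⌋₊).filter (fun q : ℕ => q.Prime ∧ z ≤ (q : ℝ) ∧
          ∃ p ∈ P, (q : ZMod p) = 1)).card := by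
  have hx0 : 0 < x := by linarith
  rw [sum_comm]
  have e : ∀ n, ∑ p ∈ P, (if (n : ZMod p) = 1 then vonMangoldt n else 0) =
      (P.filter (fun p => (n : ZMod p) = 1)).card * vonMangoldt n := by
    intro n
    rw [← sum_filter, sum_const, nsmul_eq_mul]
  have pt : ∀ n ∈ Ioc 0 ⌊x⌋₊, ∑ p ∈ P, (if (n : ZMod p) = 1 then vonMangoldt n else 0) ≤
      3 * (if ¬ n.Prime then vonMangoldt n else 0) +
      3 * (if n ≤ ⌊z⌋₊ ∧ n.Prime then Real.log n else 0) +
      3 * Real.log x * (if (n.Prime ∧ z ≤ (n : ℝ) ∧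
          ∃ p ∈ P, (n : ZMod p) = 1) then 1 else 0) := by
    intro n hn
    rw [e]
    simp only [mem_Ioc] at hn
    have hnx : (n : ℝ) ≤ x := (Nat.le_floor_iff hx0.le).1 hn.2
    have hlx : 0 ≤ Real.log x := Real.log_nonneg hx.le
    have hln := Real.log_natCast_nonneg n
    have c1 : 0 ≤ (if n ≤ ⌊z⌋₊ ∧ n.Prime then Real.log n else 0) := by split_ifs <;> simp [hln]
    have c2 : (0 : ℝ) ≤ (if (n.Prime ∧ z ≤ (n : ℝ) ∧
          ∃ p ∈ P, (n : ZMod p) = 1) then 1 else 0) := by split_ifs <;> simp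
    have c3 : 0 ≤ 3 * Real.log x * (if (n.Prime ∧ z ≤ (n : ℝ) ∧
          ∃ p ∈ P, (n : ZMod p) = 1) then 1 else 0) := by positivity
    rcases Nat.lt_or_ge n 2 with h2 | h2
    · have : n = 1 := by omega
      subst this
      have c4 : 0 ≤ (if ¬ Nat.Prime 1 then vonMangoldt 1 else 0) := by simp
      have c5 : vonMangoldt 1 = 0 := vonMangoldt_apply_one
      rw [c5, mul_zero]
      rw [c5] at c4
      linarith
    · have hw := omega_le x α hx hα P hP n h2 hnx
      have hL := vonMangoldt_nonneg (n := n)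
      by_cases hp : n.Prime
      · rw [if_neg (not_not.2 hp)]
        have hLn : vonMangoldt n = Real.log n := vonMangoldt_apply_prime hp
        rw [hLn]
        have hlnx : Real.log n ≤ Real.log x :=
          Real.log_le_log (by exact_mod_cast hn.1) hnx
        by_cases hnz : n ≤ ⌊z⌋₊
        · rw [if_pos ⟨hnz, hp⟩]
          nlinarith
        · have hzn : z ≤ n := (Nat.lt_of_floor_lt (not_le.1 hnz)).le
          by_cases hex : ∃ p ∈ P, (n : ZMod p) = 1
          · rw [if_pos (show n.Prime ∧ z ≤ (n : ℝ) ∧ ∃ p ∈ P, (n : ZMod p) = 1 from ⟨hp, hzn, hex⟩)]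
            nlinarith
          · have : P.filter (fun p => (n : ZMod p) = 1) = ∅ := by
              rw [filter_eq_empty_iff]
              intro p hpP h; exact hex ⟨p, hpP, h⟩
            rw [this]
            simp only [card_empty, Nat.cast_zero, zero_mul]
            linarith
      · rw [if_pos hp]
        nlinarith
  refine (sum_le_sum pt).trans ?_
  rw [sum_add_distrib, sum_add_distrib, ← mul_sum, ← mul_sum, ← mul_sum]
  rw [Chebyshev.psi_sub_theta_eq_sum_not_prime, sum_filter]
  have t : ∑ n ∈ Ioc 0 ⌊x⌋₊, (if n ≤ ⌊z⌋₊ ∧ n.Prime then Real.log n else 0) ≤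
      Chebyshev.theta z := by
    unfold Chebyshev.theta
    rw [← sum_filter]
    apply sum_le_sum_of_subset_of_nonneg
    · intro q hq
      simp only [mem_filter, mem_Ioc] at hq ⊢
      exact ⟨⟨hq.1.1, hq.2.1⟩, hq.2.2⟩
    · intro q _ _; exact Real.log_natCast_nonneg q
  rw [card_filter]
  push_cast
  linarith

end SSP

theorem smooth_shifted_primes_count (θ : ℝ) (hθ₁ : 1 < θ) (hθ₂ : θ < 2) :
    ∃ γ : ℝ, 0 < γ ∧ ∃ Y : ℝ, 0 < Y ∧ ∀ y : ℝ, Y < y →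
      γ * y ^ θ / Real.log (y ^ θ) ≤
        ({q : ℕ | q.Prime ∧ y ^ θ / Real.log y ≤ (q : ℝ) ∧ (q : ℝ) ≤ y ^ θ ∧
            ∀ p : ℕ, p.Prime → p ∣ q - 1 → (p : ℝ) ≤ y}.ncard : ℝ) := by
  have hθ0 : 0 < θ := by linarith
  have hinv : 1 / 2 < 1 / θ := one_div_lt_one_div_of_lt hθ0 hθ₂
  obtain ⟨ε, hε, hε2, hε3⟩ : ∃ ε : ℝ, 0 < ε ∧ ε ≤ 1 / 20 ∧ 3 / 2 * ε ≤ 1 / θ - 1 / 2 := by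
    refine ⟨min (2 / 3 * (1 / θ - 1 / 2)) (1 / 20), ?_, min_le_right _ _, ?_⟩
    · apply lt_min <;> linarith
    · have := min_le_left (2 / 3 * (1 / θ - 1 / 2)) (1 / 20); linarith
  obtain ⟨c0, hc0, hm⟩ := SSP.mertens_light (1 / 2 - 3 / 2 * ε) (1 / 2 - ε) (by linarith) (by linarith)
  have herr := SSP.error_bound ε (c0 / 16) hε hε2 (by positivity)
  have hsq : ∀ᶠ x : ℝ in Filter.atTop, 6 * √x * Real.log x ≤ c0 / 16 * x := by
    have h1 := (isLittleO_log_rpow_atTop (r := 1/2) (by norm_num)).bound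
      (c := c0 / 96) (by positivity)
    filter_upwards [h1, Filter.eventually_ge_atTop 1] with x h1 hx
    rw [← Real.sqrt_eq_rpow] at h1
    rw [Real.norm_of_nonneg (Real.log_nonneg hx), Real.norm_of_nonneg (Real.sqrt_nonneg _)] at h1
    have hs : √x * √x = x := Real.mul_self_sqrt (by linarith)
    nlinarith [Real.sqrt_nonneg x]
  have hall := (tendsto_rpow_atTop hθ0).eventually
    (hm.and (herr.and (hsq.and (SSP.theta_half.and (Filter.eventually_gt_atTop 1)))))
  have hlog := Real.tendsto_log_atTop.eventually_ge_atTop (max 1 (16 * (3 * Real.log 4) / c0))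
  obtain ⟨Y, hY⟩ := Filter.eventually_atTop.1 (hall.and hlog)
  refine ⟨c0 / 12, by positivity, max Y 1, by positivity, fun y hy => ?_⟩
  have hy1 : 1 < y := (le_max_right _ _).trans_lt hy
  have hy0 : 0 < y := by linarith
  obtain ⟨⟨h1, h2, h3, ⟨h4, -⟩, hx1⟩, h6⟩ := hY y ((le_max_left _ _).trans hy.le)
  have h6a : 1 ≤ Real.log y := (le_max_left _ _).trans h6
  have h6b : 16 * (3 * Real.log 4) / c0 ≤ Real.log y := (le_max_right _ _).trans h6
  clear h6
  have hβy : (y ^ θ) ^ (1 / 2 - ε) ≤ y := by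
    rw [← Real.rpow_mul hy0.le]
    calc y ^ (θ * (1 / 2 - ε)) ≤ y ^ (1 : ℝ) :=
          Real.rpow_le_rpow_of_exponent_le hy1.le (by nlinarith)
      _ = y := Real.rpow_one y
  have hαy : y ^ θ ≤ y * (y ^ θ) ^ (1 / 2 - 3 / 2 * ε) := by
    rw [← Real.rpow_mul hy0.le, ← Real.rpow_one_add' hy0.le]
    · apply Real.rpow_le_rpow_of_exponent_le hy1.le
      have : θ * (3 / 2 * ε) ≤ θ * (1 / θ - 1 / 2) := by gcongr
      have e : θ * (1 / θ - 1 / 2) = 1 - θ / 2 := by field_simp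
      nlinarith
    · have : 0 < θ * (1 / 2 - 3 / 2 * ε) := by apply mul_pos hθ0; linarith
      linarith
  set x := y ^ θ with hx
  have hx0 : 0 < x := by linarith
  set P := (Finset.Ioc ⌊x ^ (1 / 2 - 3 / 2 * ε)⌋₊ ⌊x ^ (1 / 2 - ε)⌋₊).filter Nat.Prime with hP
  have hPm : ∀ p ∈ P, p.Prime ∧ x ^ (1 / 2 - 3 / 2 * ε) < p ∧ (p : ℝ) ≤ x ^ (1 / 2 - ε) := by
    intro p hp
    simp only [hP, Finset.mem_filter, Finset.mem_Ioc] at hp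
    exact ⟨hp.2, Nat.lt_of_floor_lt hp.1.1, (Nat.le_floor_iff (by positivity)).1 hp.1.2⟩
  have hth : 0 ≤ Chebyshev.theta x - Real.log x := by linarith
  have hlow := SSP.lower x _ hx1 P (fun p hp => ⟨(hPm p hp).1, (hPm p hp).2.2.trans (by
    calc x ^ (1 / 2 - ε) ≤ x ^ (1 : ℝ) :=
          Real.rpow_le_rpow_of_exponent_le hx1.le (by linarith)
      _ = x := Real.rpow_one x)⟩) h2 hth
  have hz0 : 0 ≤ x / Real.log y := by positivity
  have hup := SSP.upper x (x / Real.log y) (1 / 2 - 3 / 2 * ε) hx1 hz0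
    (div_le_self hx0.le h6a) (by linarith) P (fun p hp => ⟨(hPm p hp).1, (hPm p hp).2.1⟩)
  have hps := Chebyshev.psi_sub_theta_le hx1.le
  have hthz := Chebyshev.theta_le_log4_mul_x hz0
  have hz2 : 3 * (Real.log 4 * (x / Real.log y)) ≤ c0 / 16 * x := by
    rw [div_le_iff₀ hc0] at h6b
    have e : 3 * (Real.log 4 * (x / Real.log y)) = (3 * Real.log 4 * x) / Real.log y := by ring
    rw [e, div_le_iff₀ (by linarith)]
    nlinarith
  have hmain : c0 * (x / 2) ≤ (∑ p ∈ P, 1 / (p : ℝ)) * (Chebyshev.theta x - Real.log x) := by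
    apply mul_le_mul h1 h4 (by positivity) (hc0.le.trans h1)
  set S := {q : ℕ | q.Prime ∧ x / Real.log y ≤ (q : ℝ) ∧ (q : ℝ) ≤ x ∧
            ∀ p : ℕ, p.Prime → p ∣ q - 1 → (p : ℝ) ≤ y} with hS
  set G := (Finset.Ioc 0 ⌊x⌋₊).filter (fun q : ℕ => q.Prime ∧ x / Real.log y ≤ (q : ℝ) ∧
          ∃ p ∈ P, (q : ZMod p) = 1) with hG
  have hfin : S.Finite := by
    apply (Finset.Iic ⌊x⌋₊).finite_toSet.subset
    intro q hq
    simp only [Finset.coe_Iic, Set.mem_Iic]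
    exact Nat.le_floor hq.2.2.1
  have hsub : (G : Set ℕ) ⊆ S := by
    intro q hq
    simp only [hG, Finset.coe_filter, Finset.mem_Ioc, Set.mem_ofPred_eq] at hq
    obtain ⟨⟨hq0, hqx⟩, hqp, hqz, p, hpP, hqp1⟩ := hq
    have hqx' : (q : ℝ) ≤ x := (Nat.le_floor_iff hx0.le).1 hqx
    refine ⟨hqp, hqz, hqx', ?_⟩
    intro r hr hrq
    have hpd : p ∣ q - 1 := by
      rw [← ZMod.natCast_eq_zero_iff, Nat.cast_sub hqp.one_le, hqp1]; simp
    obtain ⟨m, hm⟩ := hpd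
    obtain ⟨hpp, hpa, hpb⟩ := hPm p hpP
    rw [hm] at hrq
    rcases (Nat.Prime.dvd_mul hr).1 hrq with h | h
    · rw [(Nat.prime_dvd_prime_iff_eq hr hpp).1 h]
      exact hpb.trans hβy
    · have hm0 : 0 < m := by
        rcases m.eq_zero_or_pos with h0 | h0
        · rw [h0, mul_zero] at hm; have := hqp.two_le; omega
        · exact h0
      have hrm : (r : ℝ) ≤ m := by exact_mod_cast Nat.le_of_dvd hm0 h
      have hpm : (p : ℝ) * m ≤ x := by
        have : p * m ≤ q := by omega
        refine le_trans ?_ hqx'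
        exact_mod_cast this
      have hm1 : (0 : ℝ) < m := by exact_mod_cast hm0
      have ha : 0 < x ^ (1 / 2 - 3 / 2 * ε) := by positivity
      by_contra hcon
      push Not at hcon
      nlinarith
  have hcard : (G.card : ℝ) ≤ S.ncard := by
    rw [← Set.ncard_coe_finset G]
    exact_mod_cast Set.ncard_le_ncard hsub hfin
  have hlx : 0 < Real.log x := Real.log_pos hx1
  rw [div_le_iff₀ hlx]
  have hf : c0 * x / 4 ≤ 3 * Real.log x * G.card := by
    have := mul_pos hc0 hx0
    linarith
  nlinarith
end

section
/- Let G be a finite abelian group (written multiplicatively) and let D be its Davenport constant, i.e., the least positive integer such that every list of D elements of G has a nonempty sublist whose product is the identity. Let r, t be integers with r > t > D. Then for every function s : Fin r → G, the number of subsets S of Fin r satisfying t − D ≤ |S| ≤ t and ∏_{i ∈ S} s(i) = 1 is at least (choose(r,t))/(choose(r,D)), as an inequality of real numbers. -/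
/-- The Davenport constant of a finite abelian group `G`: the least positive integer `n`
such that every list of `n` elements of `G` has a nonempty sublist whose product is `1`. -/
noncomputable def davenportConstant (G : Type*) [CommGroup G] [Fintype G] : ℕ :=
  sInf {n : ℕ | 0 < n ∧ ∀ l : List G, l.length = n →
    ∃ t : List G, t ≠ [] ∧ t.Sublist l ∧ t.prod = 1}

theorem dav_set_nonempty (G : Type*) [CommGroup G] [Fintype G] :
    {n : ℕ | 0 < n ∧ ∀ l : List G, l.length = n →
      ∃ t : List G, t ≠ [] ∧ t.Sublist l ∧ t.prod = 1}.Nonempty := by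
  refine ⟨Fintype.card G, Fintype.card_pos, fun l hl => ?_⟩
  have h : Fintype.card G < Fintype.card (Fin (Fintype.card G + 1)) := by simp
  obtain ⟨i, j, hij, he⟩ := Fintype.exists_ne_map_eq_of_card_lt
    (fun i : Fin (Fintype.card G + 1) => (l.take i).prod) h
  have key : ∀ a b : ℕ, a < b → b ≤ l.length → (l.take a).prod = (l.take b).prod →
      ∃ t : List G, t ≠ [] ∧ t.Sublist l ∧ t.prod = 1 := by
    intro a b hab hb he
    refine ⟨(l.take b).drop a, ?_, (List.drop_sublist _ _).trans (List.take_sublist _ _), ?_⟩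
    · intro h0
      have := congrArg List.length h0
      simp at this
      omega
    · have h1 : ((l.take b).take a).prod * ((l.take b).drop a).prod = (l.take b).prod :=
        List.prod_take_mul_prod_drop _ _
      rw [List.take_take, min_eq_left hab.le, he] at h1
      exact mul_eq_left.mp h1
  have hne : (i : ℕ) ≠ j := fun h => hij (Fin.ext h)
  rcases lt_or_gt_of_ne hne with h | h
  · exact key i j h (by omega) he
  · exact key j i h (by omega) he.symm

theorem dav_finset (G : Type*) [CommGroup G] [Fintype G] {ι : Type*} [DecidableEq ι]
    (s : ι → G) (A : Finset ι) (hA : davenportConstant G ≤ A.card) :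
    ∃ B ⊆ A, B.Nonempty ∧ ∏ i ∈ B, s i = 1 := by
  obtain ⟨_, hD⟩ := Nat.sInf_mem (dav_set_nonempty G)
  obtain ⟨u, hu, hsub, hp⟩ := hD ((A.toList.take (davenportConstant G)).map s) (by
    simp only [List.length_map, List.length_take, Finset.length_toList]
    exact min_eq_left hA)
  obtain ⟨l, hl, rfl⟩ := List.sublist_map_iff.mp hsub
  have hl' : l.Sublist A.toList := hl.trans (List.take_sublist _ _)
  have hnd : l.Nodup := A.nodup_toList.sublist hl'
  refine ⟨l.toFinset, fun x hx => ?_, ?_, ?_⟩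
  · exact Finset.mem_toList.mp (hl'.subset (List.mem_toFinset.mp hx))
  · rw [List.toFinset_nonempty_iff]
    rintro rfl
    simp at hu
  · rw [List.prod_toFinset _ hnd, hp]

theorem dav_large (G : Type*) [CommGroup G] [Fintype G] {ι : Type*} [DecidableEq ι]
    (s : ι → G) (T : Finset ι) :
    ∃ S ⊆ T, T.card < S.card + davenportConstant G ∧ ∏ i ∈ S, s i = 1 := by
  classical
  obtain ⟨S, hS, hmax⟩ := Finset.exists_max_image
    (T.powerset.filter (fun S => ∏ i ∈ S, s i = 1)) Finset.card ⟨∅, by simp⟩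
  simp only [Finset.mem_filter, Finset.mem_powerset] at hS hmax
  refine ⟨S, hS.1, ?_, hS.2⟩
  by_contra hc
  have hcard := Finset.card_sdiff_add_card_eq_card hS.1
  obtain ⟨B, hB, hne, hp⟩ := dav_finset G s (T \ S) (by omega)
  have hd : Disjoint S B := (Finset.disjoint_sdiff).mono_right hB
  have := hmax (S ∪ B) ⟨Finset.union_subset hS.1 (hB.trans Finset.sdiff_subset), by
    rw [Finset.prod_union hd, hS.2, hp, one_mul]⟩
  rw [Finset.card_union_of_disjoint hd] at this
  have := hne.card_pos
  omega

theorem agp_subsequence_counting (G : Type*) [CommGroup G] [Fintype G] [DecidableEq G]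
    (r t : ℕ) (hrt : t < r) (htD : davenportConstant G < t) (s : Fin r → G) :
    ((r.choose t : ℝ) / (r.choose (davenportConstant G) : ℝ)) ≤
      ((Finset.univ.filter (fun S : Finset (Fin r) =>
          t - davenportConstant G ≤ S.card ∧ S.card ≤ t ∧ ∏ i ∈ S, s i = 1)).card : ℝ) := by
  have hpos : 0 < r.choose (davenportConstant G) := Nat.choose_pos (by omega)
  rw [div_le_iff₀ (by exact_mod_cast hpos)]
  norm_cast
  set F := Finset.univ.filter (fun S : Finset (Fin r) =>
          t - davenportConstant G ≤ S.card ∧ S.card ≤ t ∧ ∏ i ∈ S, s i = 1) with hF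
  set P := Finset.powersetCard t (Finset.univ : Finset (Fin r)) with hP
  have hPc : P.card = r.choose t := by simp [hP]
  rw [← hPc]
  have hsub : P ⊆ F.biUnion (fun S => P.filter (fun T => S ⊆ T)) := by
    intro T hT
    obtain ⟨S, hST, hc, hp⟩ := dav_large G s T
    have hTc : T.card = t := (Finset.mem_powersetCard.mp hT).2
    have := Finset.card_le_card hST
    simp only [Finset.mem_biUnion, Finset.mem_filter, hF, Finset.mem_univ, true_and]
    exact ⟨S, ⟨by omega, by omega, hp⟩, hT, hST⟩
  refine (Finset.card_le_card hsub).trans (Finset.card_biUnion_le_card_mul _ _ _ ?_)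
  intro S hS
  simp only [hF, Finset.mem_filter, Finset.mem_univ, true_and] at hS
  have h1 : (P.filter (fun T => S ⊆ T)).card ≤ (Finset.powersetCard (t - S.card) Sᶜ).card := by
    apply Finset.card_le_card_of_injOn (fun T => T \ S)
    · intro T hT
      simp only [hP, Finset.coe_filter, Set.mem_setOf_eq, Finset.mem_powersetCard] at hT
      simp only [Finset.mem_coe, Finset.mem_powersetCard]
      refine ⟨fun x hx => by simp at hx ⊢; exact hx.2, ?_⟩
      rw [Finset.card_sdiff_of_subset hT.2, hT.1.2]
    · intro T hT T' hT' he
      simp only [Finset.coe_filter, Set.mem_setOf_eq] at hT hT'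
      have he' : T \ S = T' \ S := he
      rw [← Finset.sdiff_union_of_subset hT.2, he', Finset.sdiff_union_of_subset hT'.2]
  refine h1.trans ?_
  rw [Finset.card_powersetCard, Finset.card_compl, Fintype.card_fin]
  obtain ⟨hS1, hS2, -⟩ := hS
  generalize davenportConstant G = D at *
  calc (r - S.card).choose (t - S.card) = (r - S.card).choose (r - t) := by
        rw [← Nat.choose_symm (by omega)]; congr 1; omega
    _ ≤ (r - t + D).choose (r - t) := Nat.choose_le_choose _ (by omega)
    _ = (r - t + D).choose D := by rw [Nat.choose_symm_add]
    _ ≤ r.choose D := Nat.choose_le_choose _ (by omega)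
end

section
/- Let G be a finite abelian group with exponent λ = exponent(G) and order |G|, and let D be its Davenport constant, i.e., the least positive integer such that every list of D elements of G has a nonempty sublist whose product is the identity. Then D ≤ λ·(1 + log(|G|/λ)), as an inequality of real numbers (with log the natural logarithm). -/
theorem dav_good (G : Type*) [CommGroup G] [Fintype G] (m : ℕ) (hm : 0 < m)
    (hexp : ∀ g : G, g ^ m = 1) (r : ℕ) :
    ∃ t : ℕ, (0 < r → 0 < t) ∧ (r < m → t ≤ r) ∧
      (m ≤ r → (t : ℝ) ≤ m * (1 + Real.log ((r : ℝ) / m))) ∧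
      ∀ S : Finset (AddChar (Additive G) ℂ), S.card ≤ r → ∀ l : List G, l.length = t →
        ∃ L : List (G × ℂ), L.map Prod.fst = l ∧ (∀ p ∈ L, p.2 ≠ 0) ∧
          ∀ χ ∈ S, ∃ p ∈ L, χ (Additive.ofMul p.1) = p.2 := by
  induction r using Nat.strong_induction_on with
  | _ r ih =>
  rcases Nat.eq_zero_or_pos r with rfl | hr
  · refine ⟨0, by simp, by simp, by omega, ?_⟩
    intro S hS l hl
    refine ⟨[], ?_, by simp, ?_⟩
    · simpa using (List.length_eq_zero_iff.mp hl).symm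
    · have : S = ∅ := by simpa using hS
      simp [this]
  have hmr : (0 : ℝ) < m := by exact_mod_cast hm
  have hrr : (0 : ℝ) < r := by exact_mod_cast hr
  have hlt : r * (m - 1) / m < r := by
    rw [Nat.div_lt_iff_lt_mul hm]
    exact Nat.mul_lt_mul_of_pos_left (by omega) hr
  obtain ⟨t, -, h2, h3, h4⟩ := ih _ hlt
  have hle : r * (m - 1) / m * m ≤ r * (m - 1) := Nat.div_mul_le_self _ _
  set r' := r * (m - 1) / m with hr'
  refine ⟨t + 1, by omega, ?_, ?_, ?_⟩
  · intro h
    have := h2 (by omega)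
    omega
  · intro h
    push_cast
    rcases lt_or_ge r' m with hc | hc
    · have h5 : t + 1 ≤ m := by have := h2 hc; omega
      have h6 : (t : ℝ) + 1 ≤ m := by exact_mod_cast h5
      have h7 : 0 ≤ Real.log ((r : ℝ) / m) := by
        apply Real.log_nonneg
        rw [le_div_iff₀ hmr]
        simpa using (by exact_mod_cast h : (m : ℝ) ≤ r)
      nlinarith [mul_nonneg hmr.le h7]
    · have h5 := h3 hc
      have hr0 : (0 : ℝ) < r' := by exact_mod_cast (by omega : 0 < r')
      have h6 : Real.log ((r' : ℝ) / r) ≤ (r' : ℝ) / r - 1 :=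
        Real.log_le_sub_one_of_pos (by positivity)
      have h7 : (r' : ℝ) * m ≤ r * (m - 1) := by
        have : ((r' * m : ℕ) : ℝ) ≤ ((r * (m - 1) : ℕ) : ℝ) := by exact_mod_cast hle
        rwa [Nat.cast_mul, Nat.cast_mul, Nat.cast_sub hm, Nat.cast_one] at this
      have h8 : (m : ℝ) * ((r' : ℝ) / r - 1) ≤ -1 := by
        have : (m : ℝ) * ((r' : ℝ) / r - 1) = (r' * m - r * m) / r := by field_simp
        rw [this, div_le_iff₀ hrr]
        linarith
      rw [Real.log_div hr0.ne' hrr.ne'] at h6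
      rw [Real.log_div hr0.ne' hmr.ne'] at h5
      rw [Real.log_div hrr.ne' hmr.ne']
      nlinarith [mul_le_mul_of_nonneg_left h6 hmr.le]
  · classical
    intro S hS l hl
    match l, hl with
    | g :: l, hl =>
    have hl' : l.length = t := by simpa using hl
    have hmaps : ∀ χ ∈ S, χ (Additive.ofMul g) ∈ Polynomial.nthRootsFinset m (1 : ℂ) := by
      intro χ _
      rw [Polynomial.mem_nthRootsFinset hm, ← AddChar.map_nsmul_eq_pow, ← ofMul_pow, hexp]
      simp
    have hcard : (Polynomial.nthRootsFinset m (1 : ℂ)).card ≤ m := by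
      unfold Polynomial.nthRootsFinset
      exact (Multiset.toFinset_card_le _).trans (Polynomial.card_nthRoots _ _)
    obtain ⟨a, ha, hfib⟩ := Finset.exists_le_card_fiber_of_nsmul_le_card_of_maps_to
      (b := (S.card : ℚ) / m) hmaps ⟨1, by rw [Polynomial.mem_nthRootsFinset hm]; simp⟩ (by
        rw [nsmul_eq_mul, mul_div_assoc', div_le_iff₀ (by exact_mod_cast hm), mul_comm]
        gcongr)
    have hsplit := Finset.card_filter_add_card_filter_not (s := S)
      (fun χ => χ (Additive.ofMul g) = a)
    have hS' : (S.filter (fun χ => ¬ χ (Additive.ofMul g) = a)).card ≤ r' := by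
      rw [hr', Nat.le_div_iff_mul_le hm]
      rw [div_le_iff₀ (by exact_mod_cast hm)] at hfib
      have hfib' : S.card ≤ (S.filter (fun χ => χ (Additive.ofMul g) = a)).card * m := by
        exact_mod_cast hfib
      refine le_trans ?_ (Nat.mul_le_mul_right _ hS)
      obtain ⟨k, rfl⟩ : ∃ k, m = k + 1 := ⟨m - 1, by omega⟩
      simp only [Nat.add_sub_cancel]
      nlinarith
    obtain ⟨L, hL1, hL2, hL3⟩ := h4 _ hS' l hl'
    refine ⟨(g, a) :: L, by simp [hL1], ?_, ?_⟩
    · intro p hp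
      rcases List.mem_cons.mp hp with rfl | hp
      · rw [Polynomial.mem_nthRootsFinset hm] at ha
        rintro h0
        simp only at h0
        simp [h0, hm.ne'] at ha
      · exact hL2 p hp
    · intro χ hχ
      by_cases hc : χ (Additive.ofMul g) = a
      · exact ⟨(g, a), by simp, hc⟩
      · obtain ⟨p, hp, hpe⟩ := hL3 χ (by simp [hχ, hc])
        exact ⟨p, List.mem_cons_of_mem _ hp, hpe⟩

theorem dav_sumA (G : Type*) [CommGroup G] [Fintype G] (L : List (G × ℂ)) :
    ∀ h : G, (∀ t : List G, t.Sublist (L.map Prod.fst) → h * t.prod ≠ 1) →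
    ∑ χ : AddChar (Additive G) ℂ, χ (Additive.ofMul h) *
      (L.map (fun p => p.2 - χ (Additive.ofMul p.1))).prod = 0 := by
  classical
  induction L with
  | nil =>
    intro h hh
    have : h ≠ 1 := by simpa using hh [] (by simp)
    simp only [List.map_nil, List.prod_nil, mul_one]
    rw [AddChar.sum_apply_eq_ite, if_neg]
    simpa using this
  | cons p L ih =>
    intro h hh
    have h1 := ih h (fun t ht => hh t (ht.trans (by simp)))
    have h2 := ih (h * p.1) (fun t ht => by
      have := hh (p.1 :: t) (by simpa using ht)
      simpa [mul_assoc] using this)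
    have : ∀ χ : AddChar (Additive G) ℂ, χ (Additive.ofMul h) *
      ((p :: L).map (fun p => p.2 - χ (Additive.ofMul p.1))).prod =
      p.2 * (χ (Additive.ofMul h) * (L.map (fun p => p.2 - χ (Additive.ofMul p.1))).prod) -
      χ (Additive.ofMul (h * p.1)) * (L.map (fun p => p.2 - χ (Additive.ofMul p.1))).prod := by
      intro χ
      rw [ofMul_mul, AddChar.map_add_eq_mul, List.map_cons, List.prod_cons]
      ring
    simp_rw [this]
    rw [Finset.sum_sub_distrib, ← Finset.mul_sum, h1, h2]
    simp

theorem dav_sumB (G : Type*) [CommGroup G] [Fintype G] (L : List (G × ℂ)) :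
    (∀ t : List G, t ≠ [] → t.Sublist (L.map Prod.fst) → t.prod ≠ 1) →
    ∑ χ : AddChar (Additive G) ℂ,
      (L.map (fun p => p.2 - χ (Additive.ofMul p.1))).prod =
      Fintype.card G * (L.map Prod.snd).prod := by
  classical
  induction L with
  | nil =>
    intro _
    simp only [List.map_nil, List.prod_nil, mul_one, Finset.sum_const, Finset.card_univ,
      nsmul_eq_mul]
    rw [← Nat.card_eq_fintype_card, ← Nat.card_eq_fintype_card, Nat.card_eq_fintype_card,
      AddChar.card_eq, ← Nat.card_eq_fintype_card]
    rfl
  | cons p L ih =>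
    intro hh
    have h1 := ih (fun t h0 ht => hh t h0 (ht.trans (by simp)))
    have h2 := dav_sumA G L p.1 (fun t ht => by
      have := hh (p.1 :: t) (by simp) (by simpa using ht)
      simpa using this)
    simp only [List.map_cons, List.prod_cons, sub_mul]
    rw [Finset.sum_sub_distrib, ← Finset.mul_sum, h1, h2]
    ring

theorem davenport_le_exponent_mul_one_add_log (G : Type*) [CommGroup G] [Fintype G] :
    (davenportConstant G : ℝ) ≤
      (Monoid.exponent G : ℝ) *
        (1 + Real.log ((Fintype.card G : ℝ) / (Monoid.exponent G : ℝ))) := by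
  classical
  have hm : 0 < Monoid.exponent G := Monoid.ExponentExists.exponent_pos
    Monoid.ExponentExists.of_finite
  obtain ⟨t, h1, -, h3, h4⟩ := dav_good G (Monoid.exponent G) hm Monoid.pow_exponent_eq_one
    (Fintype.card G)
  have hle : Monoid.exponent G ≤ Fintype.card G :=
    Nat.le_of_dvd Fintype.card_pos Group.exponent_dvd_card
  refine le_trans ?_ (h3 hle)
  rw [Nat.cast_le]
  refine Nat.sInf_le ⟨h1 Fintype.card_pos, ?_⟩
  intro l hl
  by_contra hcon
  push Not at hcon
  obtain ⟨L, rfl, hL2, hL3⟩ := h4 Finset.univ (by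
    rw [Finset.card_univ, AddChar.card_eq]; exact (Fintype.card_congr Additive.toMul).le) l hl
  have hB := dav_sumB G L hcon
  rw [Finset.sum_eq_zero] at hB
  · have hz := hB.symm
    rw [mul_eq_zero, List.prod_eq_zero_iff] at hz
    rcases hz with hz | hz
    · exact Fintype.card_ne_zero (Nat.cast_eq_zero.mp hz)
    · obtain ⟨p, hp, hp0⟩ := List.mem_map.mp hz
      exact hL2 p hp hp0
  · intro χ _
    obtain ⟨p, hp, hpe⟩ := hL3 χ (Finset.mem_univ _)
    rw [List.prod_eq_zero_iff, List.mem_map]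
    exact ⟨p, hp, by rw [hpe, sub_self]⟩
end

section
/- Let G be a finite abelian group (written multiplicatively) with Davenport constant n ≥ 1, i.e., n is the least positive integer such that every list of n elements of G has a nonempty sublist whose product is the identity. Then for every function s : Fin (4n²) → G, there exists an integer h with n ≤ h ≤ 2n such that the number of subsets S of Fin (4n²) with |S| = h and ∏_{i ∈ S} s(i) = 1 is at least (n/3)^n / (n + 1), as an inequality of real numbers. -/
theorem aux_choose (k : ℕ) (hk : 1 ≤ k) : ∀ (h N m : ℕ), k * m ≤ N → h ≤ m →
    k ^ h * (N - h).choose (m - h) ≤ N.choose m := by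
  intro h
  induction h with
  | zero => intro N m _ _; simp
  | succ h ih =>
    intro N m hN hm
    obtain ⟨m, rfl⟩ : ∃ m', m = m' + 1 := ⟨m - 1, by omega⟩
    have hN0 : 1 ≤ N := by nlinarith
    obtain ⟨N, rfl⟩ : ∃ m', N = m' + 1 := ⟨N - 1, by omega⟩
    have h1 := ih N m (by nlinarith) (by omega)
    have h2 := Nat.add_one_mul_choose_eq N m
    have h3 : k * N.choose m ≤ (N + 1).choose (m + 1) := by
      have : (k * N.choose m) * (m + 1) ≤ (N + 1).choose (m + 1) * (m + 1) := by
        rw [← h2]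
        calc _ = (k * (m + 1)) * N.choose m := by ring
          _ ≤ _ := Nat.mul_le_mul_right _ hN
      exact Nat.le_of_mul_le_mul_right this (by omega)
    rw [Nat.add_sub_add_right, Nat.add_sub_add_right, pow_succ]
    calc _ = k * (k ^ h * (N - h).choose (m - h)) := by ring
      _ ≤ k * N.choose m := Nat.mul_le_mul_left _ h1
      _ ≤ _ := h3

theorem aux_dav {G : Type*} [CommGroup G] [Fintype G] {ι : Type*} [DecidableEq ι]
    (n : ℕ) (hn : n = davenportConstant G) (hn1 : 1 ≤ n) (s : ι → G)
    (T : Finset ι) (hT : n ≤ T.card) :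
    ∃ S ⊆ T, S.Nonempty ∧ S.card ≤ n ∧ ∏ i ∈ S, s i = 1 := by
  have hmem := Nat.sInf_mem (Nat.nonempty_of_pos_sInf
    (show 0 < davenportConstant G by omega))
  change davenportConstant G ∈ _ at hmem
  rw [← hn] at hmem
  obtain ⟨U, hU, hUc⟩ := Finset.exists_subset_card_eq hT
  obtain ⟨t, ht, hts, htp⟩ := hmem.2 (U.toList.map s) (by simp [hUc])
  obtain ⟨l, hl, rfl⟩ := List.sublist_map_iff.1 hts
  have hnd : l.Nodup := hl.nodup U.nodup_toList
  refine ⟨l.toFinset, ?_, ?_, ?_, ?_⟩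
  · intro x hx
    exact hU (by simpa using hl.subset (by simpa using hx))
  · rw [List.toFinset_nonempty_iff]
    rintro rfl
    simp at ht
  · rw [List.toFinset_card_of_nodup hnd, ← hUc, ← Finset.length_toList U]
    exact hl.length_le
  · rw [List.prod_toFinset _ hnd, htp]

theorem aux_mid {G : Type*} [CommGroup G] [Fintype G] {ι : Type*} [DecidableEq ι]
    (n : ℕ) (hn : n = davenportConstant G) (hn1 : 1 ≤ n) (s : ι → G)
    (T : Finset ι) (hT : 2 * n ≤ T.card) :
    ∃ S ⊆ T, n ≤ S.card ∧ S.card ≤ 2 * n ∧ ∏ i ∈ S, s i = 1 := by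
  classical
  obtain ⟨S, hS, hmax⟩ := Finset.exists_max_image
    (T.powerset.filter (fun S => S.card ≤ 2 * n ∧ ∏ i ∈ S, s i = 1)) Finset.card
    ⟨∅, by simp⟩
  simp only [Finset.mem_filter, Finset.mem_powerset] at hS hmax
  refine ⟨S, hS.1, ?_, hS.2⟩
  by_contra hlt
  have hc := Finset.card_sdiff_of_subset hS.1
  obtain ⟨S', hS', hne, hc', hp⟩ := aux_dav n hn hn1 s (T \ S) (by omega)
  have hd : Disjoint S S' := (Finset.disjoint_sdiff).mono_right hS'
  have hu := Finset.card_union_of_disjoint hd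
  have := hmax (S ∪ S') ⟨Finset.union_subset hS.1 (hS'.trans Finset.sdiff_subset),
    by omega, by rw [Finset.prod_union hd, hS.2.2, hp, one_mul]⟩
  have := hne.card_pos
  omega

theorem aux_total {G : Type*} [CommGroup G] [Fintype G] [DecidableEq G]
    (n : ℕ) (hn : n = davenportConstant G) (hn1 : 1 ≤ n) (s : Fin (4 * n ^ 2) → G) :
    (2 * n) ^ n ≤ (Finset.univ.filter (fun S : Finset (Fin (4 * n ^ 2)) =>
      S.card ∈ Finset.Icc n (2 * n) ∧ ∏ i ∈ S, s i = 1)).card := by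
  set F := Finset.univ.filter (fun S : Finset (Fin (4 * n ^ 2)) =>
      S.card ∈ Finset.Icc n (2 * n) ∧ ∏ i ∈ S, s i = 1) with hF
  set P := Finset.powersetCard (2 * n) (Finset.univ : Finset (Fin (4 * n ^ 2))) with hP
  have hPc : P.card = (4 * n ^ 2).choose (2 * n) := by simp [hP]
  have hcov : P ⊆ F.biUnion (fun S => P.filter (fun T => S ⊆ T)) := by
    intro T hT
    obtain ⟨S, hST, h1, h2, h3⟩ := aux_mid n hn hn1 s T (Finset.mem_powersetCard.1 hT).2.ge
    simp only [Finset.mem_biUnion, Finset.mem_filter]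
    exact ⟨S, by simp [hF, h1, h2, h3], hT, hST⟩
  have hle : ∀ S ∈ F, (2 * n) ^ n * (P.filter (fun T => S ⊆ T)).card
      ≤ (4 * n ^ 2).choose (2 * n) := by
    intro S hS
    simp only [hF, Finset.mem_filter, Finset.mem_univ, true_and, Finset.mem_Icc] at hS
    obtain ⟨⟨h1, h2⟩, -⟩ := hS
    have hc : (P.filter (fun T => S ⊆ T)).card
        ≤ (4 * n ^ 2 - S.card).choose (2 * n - S.card) := by
      have : (Finset.powersetCard (2 * n - S.card) (Finset.univ \ S)).card =
          (4 * n ^ 2 - S.card).choose (2 * n - S.card) := by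
        rw [Finset.card_powersetCard, Finset.card_sdiff_of_subset (Finset.subset_univ _)]
        simp
      rw [← this]
      apply Finset.card_le_card_of_injOn (fun T => T \ S)
      · intro T hT
        simp only [hP, Finset.coe_filter, Set.mem_ofPred_eq, Finset.mem_powersetCard] at hT
        simp only [Finset.mem_coe, Finset.mem_powersetCard]
        exact ⟨Finset.sdiff_subset_sdiff hT.1.1 (le_refl _),
          by rw [Finset.card_sdiff_of_subset hT.2, hT.1.2]⟩
      · intro T hT T' hT' h
        simp only [Finset.coe_filter, Set.mem_ofPred_eq] at hT hT' h
        rw [← Finset.sdiff_union_of_subset hT.2, h, Finset.sdiff_union_of_subset hT'.2]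
    calc _ ≤ (2 * n) ^ S.card * (4 * n ^ 2 - S.card).choose (2 * n - S.card) :=
          Nat.mul_le_mul (Nat.pow_le_pow_right (by omega) h1) hc
      _ ≤ _ := aux_choose _ (by omega) _ _ _ (by nlinarith) h2
  have hpos : 0 < (4 * n ^ 2).choose (2 * n) := Nat.choose_pos (by nlinarith)
  refine Nat.le_of_mul_le_mul_right ?_ hpos
  calc (2 * n) ^ n * (4 * n ^ 2).choose (2 * n)
      ≤ (2 * n) ^ n * ∑ S ∈ F, (P.filter (fun T => S ⊆ T)).card := by
        rw [← hPc]
        exact Nat.mul_le_mul_left _ ((Finset.card_le_card hcov).trans Finset.card_biUnion_le)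
    _ ≤ ∑ S ∈ F, (4 * n ^ 2).choose (2 * n) := by
        rw [Finset.mul_sum]
        exact Finset.sum_le_sum hle
    _ = _ := by simp

theorem exists_length_many_product_one_subsets
    (G : Type*) [CommGroup G] [Fintype G] [DecidableEq G]
    (n : ℕ) (hn : n = davenportConstant G) (hn1 : 1 ≤ n)
    (s : Fin (4 * n ^ 2) → G) :
    ∃ h : ℕ, n ≤ h ∧ h ≤ 2 * n ∧
      ((n : ℝ) / 3) ^ n / (n + 1) ≤
        ((Finset.univ.filter (fun S : Finset (Fin (4 * n ^ 2)) =>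
            S.card = h ∧ ∏ i ∈ S, s i = 1)).card : ℝ) := by
  by_contra! hcon
  have htot := aux_total n hn hn1 s
  have hsum : (Finset.univ.filter (fun S : Finset (Fin (4 * n ^ 2)) =>
      S.card ∈ Finset.Icc n (2 * n) ∧ ∏ i ∈ S, s i = 1)).card ≤
      ∑ h ∈ Finset.Icc n (2 * n), (Finset.univ.filter (fun S : Finset (Fin (4 * n ^ 2)) =>
            S.card = h ∧ ∏ i ∈ S, s i = 1)).card := by
    refine (Finset.card_le_card ?_).trans Finset.card_biUnion_le
    intro S hS
    simp only [Finset.mem_filter, Finset.mem_univ, true_and, Finset.mem_biUnion] at hS ⊢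
    exact ⟨_, hS.1, rfl, hS.2⟩
  have hR : ((2 * n : ℝ)) ^ n ≤ ∑ h ∈ Finset.Icc n (2 * n),
      ((Finset.univ.filter (fun S : Finset (Fin (4 * n ^ 2)) =>
            S.card = h ∧ ∏ i ∈ S, s i = 1)).card : ℝ) := by
    exact_mod_cast htot.trans hsum
  have hlt : ∑ h ∈ Finset.Icc n (2 * n),
      ((Finset.univ.filter (fun S : Finset (Fin (4 * n ^ 2)) =>
            S.card = h ∧ ∏ i ∈ S, s i = 1)).card : ℝ)
      < ∑ h ∈ Finset.Icc n (2 * n), ((n : ℝ) / 3) ^ n / (n + 1) := by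
    apply Finset.sum_lt_sum_of_nonempty
    · exact ⟨n, by simp; omega⟩
    · intro h hh
      rw [Finset.mem_Icc] at hh
      exact hcon h hh.1 hh.2
  rw [Finset.sum_const, Nat.card_Icc, show 2 * n + 1 - n = n + 1 by omega, nsmul_eq_mul] at hlt
  push_cast at hlt
  rw [mul_div_cancel₀ _ (by positivity)] at hlt
  have hp : ((n : ℝ) / 3) ^ n ≤ (2 * n : ℝ) ^ n := by
    apply pow_le_pow_left₀ (by positivity)
    have : (0 : ℝ) ≤ n := by positivity
    linarith
  linarith
end

section
/- For every positive integer n, the binomial coefficients satisfy choose(4n², 2n) ≥ (n/3)^n · choose(4n², n), as an inequality of real numbers. -/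
theorem pow_le_choose_mul (j k : ℕ) : (j + 1) ^ k ≤ ((j + 1) * k).choose k := by
  induction k with
  | zero => simp
  | succ k ih =>
    have h := Nat.add_one_mul_choose_eq ((j + 1) * k + j) k
    have e : (j + 1) * k + j + 1 = (j + 1) * (k + 1) := by ring
    rw [e] at h
    have h' : (j + 1) * ((j + 1) * k + j).choose k = ((j + 1) * (k + 1)).choose (k + 1) := by
      apply Nat.eq_of_mul_eq_mul_right (Nat.succ_pos k)
      rw [Nat.succ_eq_add_one, ← h]; ring
    rw [← h', pow_succ, mul_comm]
    exact Nat.mul_le_mul_left _ (ih.trans (Nat.choose_le_choose k (Nat.le_add_right _ _)))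

theorem choose_four_n_sq_two_n_ge (n : ℕ) (hn : 0 < n) :
    ((n : ℝ) / 3) ^ n * ((4 * n ^ 2).choose n : ℝ) ≤ ((4 * n ^ 2).choose (2 * n) : ℝ) := by
  have hn' : (0 : ℝ) < n := by exact_mod_cast hn
  have h1 : ((n : ℝ) / 3) ^ n ≤ (n.factorial : ℝ) := by
    have h := Real.pow_div_factorial_le_exp (n : ℝ) hn'.le n
    have he : Real.exp (n : ℝ) ≤ 3 ^ n := by
      rw [← Real.exp_one_pow]
      exact pow_le_pow_left₀ (Real.exp_pos _).le (by linarith [Real.exp_one_lt_d9]) n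
    have h2 := h.trans he
    rw [div_le_iff₀ (by positivity)] at h2
    rw [div_pow, div_le_iff₀ (by positivity)]
    linarith
  have h2 : (n.factorial : ℝ) * ((4 * n ^ 2).choose n : ℝ) ≤ ((4 * n ^ 2 : ℕ) : ℝ) ^ n := by
    have := Nat.descFactorial_le_pow (4 * n ^ 2) n
    rw [Nat.descFactorial_eq_factorial_mul_choose] at this
    exact_mod_cast this
  have h4 : (((4 * n ^ 2 : ℕ) : ℝ)) ^ n ≤ ((4 * n ^ 2).choose (2 * n) : ℝ) := by
    have h := pow_le_choose_mul (2 * n - 1) (2 * n)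
    have e : 2 * n - 1 + 1 = 2 * n := by omega
    have e2 : 2 * n * (2 * n) = 4 * n ^ 2 := by ring
    rw [e, e2, pow_mul, pow_two, e2] at h
    exact_mod_cast h
  calc _ ≤ (n.factorial : ℝ) * ((4 * n ^ 2).choose n : ℝ) := by gcongr
    _ ≤ _ := h2.trans h4
end

section
/- Let y ≥ 2 be a real number and θ > 0 a real number. Let L be a squarefree positive integer such that every prime q dividing L satisfies q ≤ y^θ and every prime factor of q − 1 is at most y. Then the exponent λ(L) of the unit group (ℤ/Lℤ)ˣ satisfies λ(L) ≤ y^(θ·π(y)), where π(y) is the number of primes at most y. -/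
theorem carmichael_lambda_bound (y θ : ℝ) (hy : 2 ≤ y) (hθ : 0 < θ)
    (L : ℕ) (hL : 0 < L) (hsf : Squarefree L)
    (hq : ∀ q ∈ L.primeFactors, (q : ℝ) ≤ y ^ θ ∧
      ∀ p ∈ (q - 1).primeFactors, (p : ℝ) ≤ y) :
    (Monoid.exponent (ZMod L)ˣ : ℝ) ≤ y ^ (θ * (Nat.primeCounting ⌊y⌋₊ : ℝ)) := by
  classical
  have hy0 : (0 : ℝ) ≤ y := by linarith
  let S := (Finset.range (⌊y⌋₊ + 1)).filter Nat.Prime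
  have hS : S.card = Nat.primeCounting ⌊y⌋₊ := by
    rw [Nat.primeCounting, Nat.primeCounting', Nat.count_eq_card_filter_range]
  let e : ℕ → ℕ := fun p => L.primeFactors.sup (fun q => (q - 1).factorization p)
  let M := ∏ p ∈ S, p ^ e p
  have hMpos : 0 < M := Finset.prod_pos fun p hp =>
    pow_pos (Finset.mem_filter.1 hp).2.pos _
  have h1 : ∀ q ∈ L.primeFactors, q - 1 ∣ M := by
    intro q hqL
    have hqp := Nat.prime_of_mem_primeFactors hqL
    have hne : q - 1 ≠ 0 := by have := hqp.two_le; omega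
    have hsub : (q - 1).primeFactors ⊆ S := by
      intro p hp
      have := Nat.le_floor ((hq q hqL).2 p hp)
      exact Finset.mem_filter.2 ⟨Finset.mem_range.2 (by omega), Nat.prime_of_mem_primeFactors hp⟩
    have h2 : ∏ p ∈ (q - 1).primeFactors, p ^ (q - 1).factorization p = q - 1 :=
      Nat.prod_factorization_pow_eq_self hne
    rw [← h2]
    refine (Finset.prod_dvd_prod_of_dvd _ (fun p => p ^ e p) ?_).trans
      (Finset.prod_dvd_prod_of_subset _ _ _ hsub)
    intro p _
    exact pow_dvd_pow _ (Finset.le_sup (f := fun q => (q - 1).factorization p) hqL)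
  have h2 : Monoid.exponent (ZMod L)ˣ ∣ M := by
    apply Monoid.exponent_dvd_of_forall_pow_eq_one
    intro u
    haveI : NeZero L := ⟨hL.ne'⟩
    have hcop : ((u : ZMod L).val).Coprime L := ZMod.val_coe_unit_coprime u
    set a := (u : ZMod L).val with ha
    have hua : (u : ZMod L) = (a : ZMod L) := by rw [ha, ZMod.natCast_zmod_val]
    have hdvd : (L : ℤ) ∣ (a : ℤ) ^ M - 1 := by
      have hprod : (∏ q ∈ L.primeFactors, (q : ℤ)) = L := by
        rw [← Nat.cast_prod, Nat.prod_primeFactors_of_squarefree hsf]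
      rw [← hprod]
      apply Finset.prod_dvd_of_coprime
      · intro p hp q hq' hpq
        exact Nat.isCoprime_iff_coprime.2 ((Nat.coprime_primes
          (Nat.prime_of_mem_primeFactors hp) (Nat.prime_of_mem_primeFactors hq')).2 hpq)
      · intro q hqL
        have hqp := Nat.prime_of_mem_primeFactors hqL
        haveI := Fact.mk hqp
        obtain ⟨k, hk⟩ := h1 q hqL
        rw [← ZMod.intCast_zmod_eq_zero_iff_dvd]
        have hne : (a : ZMod q) ≠ 0 := by
          rw [Ne, ZMod.natCast_eq_zero_iff]
          intro h
          exact Nat.Prime.not_dvd_one hqp (hcop ▸ Nat.dvd_gcd h (Nat.dvd_of_mem_primeFactors hqL))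
        push_cast
        rw [hk, pow_mul, ZMod.pow_card_sub_one_eq_one hne, one_pow, sub_self]
    rw [← ZMod.intCast_zmod_eq_zero_iff_dvd] at hdvd
    push_cast at hdvd
    ext
    push_cast
    rw [hua]
    exact sub_eq_zero.1 hdvd
  have h3 : (M : ℝ) ≤ (y ^ θ) ^ S.card := by
    simp only [M]
    push_cast
    rw [← Finset.prod_const]
    apply Finset.prod_le_prod
    · intro p _
      positivity
    · intro p _
      rcases L.primeFactors.eq_empty_or_nonempty with h0 | h0
      · have : e p = 0 := by simp only [e]; rw [h0]; rfl
        rw [this, pow_zero]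
        exact Real.one_le_rpow (by linarith) hθ.le
      · obtain ⟨q, hqL, hqe⟩ := Finset.exists_mem_eq_sup _ h0
          (fun q => (q - 1).factorization p)
        have hqp := Nat.prime_of_mem_primeFactors hqL
        have hne : q - 1 ≠ 0 := by have := hqp.two_le; omega
        have he : e p = (q - 1).factorization p := hqe
        have hle : p ^ e p ≤ q := by
          rw [he]
          exact (Nat.le_of_dvd (Nat.pos_of_ne_zero hne) (Nat.ordProj_dvd _ _)).trans (Nat.sub_le _ _)
        refine le_trans ?_ (hq q hqL).1
        exact_mod_cast hle
  calc (Monoid.exponent (ZMod L)ˣ : ℝ) ≤ M := by exact_mod_cast Nat.le_of_dvd hMpos h2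
    _ ≤ (y ^ θ) ^ S.card := h3
    _ = _ := by rw [hS, Real.rpow_mul hy0, Real.rpow_natCast]
end

section
/- Let M be a positive integer, let k ≥ 2, and let p₁, …, p_k be distinct primes such that p_i − 1 divides M for every i, and such that M divides (p₁·p₂⋯p_k) − 1. Then N = p₁·p₂⋯p_k is composite and N divides a^N − a for every integer a; that is, N is a Carmichael number. -/
theorem carmichael_of_korselt_construction
    (M k : ℕ) (hM : 0 < M) (hk : 2 ≤ k) (p : Fin k → ℕ)
    (hp : ∀ i, (p i).Prime) (hinj : Function.Injective p)
    (hdvd : ∀ i, (p i - 1) ∣ M) (hMdvd : M ∣ (∏ i, p i) - 1) :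
    1 < ∏ i, p i ∧ ¬ (∏ i, p i).Prime ∧
      ∀ a : ℤ, ((∏ i, p i : ℕ) : ℤ) ∣ a ^ (∏ i, p i) - a := by
  have hd : ∀ i, p i ∣ ∏ i, p i := fun i => Finset.dvd_prod_of_mem p (Finset.mem_univ i)
  have hpos : 0 < ∏ i, p i := Finset.prod_pos fun i _ => (hp i).pos
  have h1 : 1 < ∏ i, p i :=
    lt_of_lt_of_le (hp ⟨0, by omega⟩).one_lt (Nat.le_of_dvd hpos (hd _))
  refine ⟨h1, ?_, ?_⟩
  · intro hN
    have e0 := (Nat.prime_dvd_prime_iff_eq (hp _) hN).1 (hd ⟨0, by omega⟩)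
    have e1 := (Nat.prime_dvd_prime_iff_eq (hp _) hN).1 (hd ⟨1, by omega⟩)
    have := hinj (e0.trans e1.symm)
    simp at this
  · intro a
    have key : ∀ i, ((p i : ℕ) : ℤ) ∣ a ^ (∏ i, p i) - a := by
      intro i
      haveI : Fact (p i).Prime := ⟨hp i⟩
      rw [← ZMod.intCast_zmod_eq_zero_iff_dvd]
      push_cast
      obtain ⟨c, hc⟩ := (hdvd i).trans hMdvd
      have hN : ∏ i, p i = (p i - 1) * c + 1 := by omega
      rw [hN, pow_succ, pow_mul]
      by_cases ha : (a : ZMod (p i)) = 0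
      · simp [ha]
      · rw [ZMod.pow_card_sub_one_eq_one ha]; simp
    rw [Nat.cast_prod]
    refine Finset.prod_dvd_of_coprime ?_ fun i _ => key i
    intro i _ j _ hij
    exact Nat.isCoprime_iff_coprime.2 ((Nat.coprime_primes (hp i) (hp j)).2 (hinj.ne hij))
end
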